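/- arXiv:2502.11421 — 4 statements merged into one kernel-verified Lean document; each statement's English description precedes it below -/
import Mathlib

section
/- For every even integer n ≥ 14 there exists a connected, asymmetric, 3-regular, non-bipartite, triangle-free graph on n vertices. -/
/-- The injective partial maps `{0, …, j - 1} → {0, …, h - 1}`, as lists of values, that preserve
and reflect the relation `adj`. -/
def partialEmbeddings (adj : ℕ → ℕ → Bool) (h : ℕ) : ℕ → List (List ℕ)
  | 0 => [[]]
  | j + 1 => (partialEmbeddings adj h j).flatMap fun l =>
      ((List.range h).filter fun y => (List.range j).all fun i =>
        !(l.getD i 0 == y) && (adj (l.getD i 0) y == adj i j)).map fun y => l ++ [y]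

theorem map_range_mem_partialEmbeddings {adj : ℕ → ℕ → Bool} {h : ℕ} {f : ℕ → ℕ}
    (hlt : ∀ i < h, f i < h) (hinj : ∀ i < h, ∀ j < h, f i = f j → i = j)
    (hadj : ∀ i < h, ∀ j < h, adj (f i) (f j) = adj i j) (j : ℕ) (hj : j ≤ h) :
    (List.range j).map f ∈ partialEmbeddings adj h j := by
  induction j with
  | zero => simp [partialEmbeddings]
  | succ j ih =>
    simp only [partialEmbeddings, List.mem_flatMap, List.mem_map, List.mem_filter, List.mem_range,
      List.all_eq_true]
    refine ⟨_, ih (by omega), f j, ⟨hlt j (by omega), fun i hi => ?_⟩, by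
      simp [List.range_succ]⟩
    have hget : ((List.range j).map f).getD i 0 = f i := by simp [List.getD, hi]
    rw [hget, hadj i (by omega) j (by omega)]
    have : f i ≠ f j := fun h' => by
      have := hinj i (by omega) j (by omega) h'
      omega
    simp [this]

/-- If the identity is the only total embedding, every self-embedding is the identity. -/
theorem eq_self_of_partialEmbeddings {adj : ℕ → ℕ → Bool} {h : ℕ} {f : ℕ → ℕ}
    (hlt : ∀ i < h, f i < h) (hinj : ∀ i < h, ∀ j < h, f i = f j → i = j)
    (hadj : ∀ i < h, ∀ j < h, adj (f i) (f j) = adj i j)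
    (huniq : partialEmbeddings adj h h = [List.range h]) (i : ℕ) (hi : i < h) : f i = i := by
  have hmem := map_range_mem_partialEmbeddings hlt hinj hadj h le_rfl
  rw [huniq, List.mem_singleton] at hmem
  have := congrArg (fun l : List ℕ => l.getD i 0) hmem
  simpa [List.getD, hi] using this

/-- A function listing three neighbours of each vertex below `n` defines a cubic graph
with the required properties as soon as the listed conditions hold. -/
theorem exists_graph_of_neighbors {n : ℕ} (N : ℕ → List ℕ)
    (hthree : ∀ v < n, ∃ a b c, N v = [a, b, c] ∧ a ≠ b ∧ a ≠ c ∧ b ≠ c ∧ a < n ∧ b < n ∧ c < n)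
    (hsymm : ∀ u < n, ∀ v ∈ N u, u ∈ N v)
    (hdesc : ∀ v < n, 0 < v → ∃ u ∈ N v, u < v)
    (htri : ∀ u < n, ∀ v ∈ N u, ∀ w ∈ N v, w ∉ N u)
    (hodd : ∃ a b c d e, a < n ∧ b ∈ N a ∧ c ∈ N b ∧ d ∈ N c ∧ e ∈ N d ∧ a ∈ N e)
    (hrigid : ∀ f g : ℕ → ℕ, (∀ v < n, f v < n) → (∀ v < n, g v < n) →
      (∀ v < n, f (g v) = v) → (∀ v < n, g (f v) = v) →
      (∀ u < n, ∀ v < n, f v ∈ N (f u) ↔ v ∈ N u) → ∀ v < n, f v = v) :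
    ∃ G : SimpleGraph (Fin n),
      G.Connected ∧
      (∀ e : G ≃g G, ∀ v, e v = v) ∧
      (∀ v, (G.neighborSet v).ncard = 3) ∧
      ¬ G.Colorable 2 ∧
      G.CliqueFree 3 := by
  have hlt : ∀ u < n, ∀ v ∈ N u, v < n := by
    intro u hu v hv
    obtain ⟨a, b, c, h, -, -, -, ha, hb, hc⟩ := hthree u hu
    rw [h] at hv
    simp only [List.mem_cons, List.not_mem_nil, or_false] at hv
    rcases hv with rfl | rfl | rfl <;> assumption
  have hirr : ∀ u < n, u ∉ N u := fun u hu h => htri u hu u h u h h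
  let G : SimpleGraph (Fin n) :=
    { Adj := fun u v => v.1 ∈ N u.1
      symm := ⟨fun u v h => hsymm u.1 u.2 v.1 h⟩
      loopless := ⟨fun u h => hirr u.1 u.2 h⟩ }
  have hG : ∀ u v : Fin n, G.Adj u v ↔ v.1 ∈ N u.1 := fun _ _ => Iff.rfl
  refine ⟨G, ?_, ?_, ?_, ?_, ?_⟩
  · obtain ⟨a, -, -, -, -, ha, -⟩ := hodd
    have hn : 0 < n := by omega
    have hreach : ∀ k (hk : k < n), G.Reachable ⟨k, hk⟩ ⟨0, hn⟩ := by
      intro k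
      induction k using Nat.strong_induction_on with
      | _ k ih =>
        intro hk
        rcases Nat.eq_zero_or_pos k with rfl | hpos
        · exact SimpleGraph.Reachable.refl _
        · obtain ⟨u, hu, huk⟩ := hdesc k hk hpos
          have hadj : G.Adj ⟨k, hk⟩ ⟨u, by omega⟩ := hu
          exact hadj.reachable.trans (ih u huk _)
    have : Nonempty (Fin n) := ⟨⟨0, hn⟩⟩
    exact ⟨fun u v => (hreach u.1 u.2).trans (hreach v.1 v.2).symm⟩
  · intro e v
    let f : ℕ → ℕ := fun k => if h : k < n then (e ⟨k, h⟩).1 else k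
    let g : ℕ → ℕ := fun k => if h : k < n then (e.symm ⟨k, h⟩).1 else k
    have hf : ∀ k (h : k < n), f k = (e ⟨k, h⟩).1 := fun k h => dif_pos h
    have hg : ∀ k (h : k < n), g k = (e.symm ⟨k, h⟩).1 := fun k h => dif_pos h
    have key := hrigid f g (fun k h => by rw [hf k h]; exact (e ⟨k, h⟩).2)
      (fun k h => by rw [hg k h]; exact (e.symm ⟨k, h⟩).2)
      (fun k h => by rw [hg k h, hf _ (e.symm ⟨k, h⟩).2]; simp)
      (fun k h => by rw [hf k h, hg _ (e ⟨k, h⟩).2]; simp)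
      (fun a ha b hb => by
        rw [hf a ha, hf b hb, ← hG, e.map_adj_iff, hG]) v.1 v.2
    rw [hf v.1 v.2] at key
    exact Fin.ext key
  · intro v
    obtain ⟨a, b, c, h, hab, hac, hbc, ha, hb, hc⟩ := hthree v.1 v.2
    rw [Set.ncard_eq_three]
    refine ⟨⟨a, ha⟩, ⟨b, hb⟩, ⟨c, hc⟩, by simpa using hab, by simpa using hac,
      by simpa using hbc, ?_⟩
    ext x
    simp [hG, h, Fin.ext_iff]
  · rintro ⟨C⟩
    obtain ⟨a, b, c, d, e, ha, hb, hc, hd, he, hea⟩ := hodd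
    have hb' := hlt a ha b hb
    have hc' := hlt b hb' c hc
    have hd' := hlt c hc' d hd
    have he' := hlt d hd' e he
    have h1 := C.valid (show G.Adj ⟨a, ha⟩ ⟨b, hb'⟩ from hb)
    have h2 := C.valid (show G.Adj ⟨b, hb'⟩ ⟨c, hc'⟩ from hc)
    have h3 := C.valid (show G.Adj ⟨c, hc'⟩ ⟨d, hd'⟩ from hd)
    have h4 := C.valid (show G.Adj ⟨d, hd'⟩ ⟨e, he'⟩ from he)
    have h5 := C.valid (show G.Adj ⟨e, he'⟩ ⟨a, ha⟩ from hea)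
    omega
  · intro s hs
    rw [SimpleGraph.is3Clique_iff] at hs
    obtain ⟨a, b, c, hab, hac, hbc, -⟩ := hs
    exact htri a.1 a.2 b.1 hab c.1 hbc hac

/-- Neighbour lists of an asymmetric triangle-free cubic graph on 14 vertices. -/
def neighbors14 (v : ℕ) : List ℕ :=
  [[1, 2, 7], [0, 3, 5], [0, 3, 11], [1, 2, 4], [3, 6, 9], [1, 6, 13], [4, 5, 8], [0, 8, 12],
    [6, 7, 10], [4, 10, 12], [8, 9, 11], [2, 10, 13], [7, 9, 13], [5, 11, 12]].getD v []

/-- Neighbour lists of an asymmetric graph on 12 vertices of girth 5, in which exactly the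
vertices `8`, `9`, `10`, `11` have degree 2. -/
def gadgetNeighbors (v : ℕ) : List ℕ :=
  [[1, 4, 8], [0, 2, 11], [1, 3, 5], [2, 4, 10], [0, 3, 9], [2, 6, 8], [5, 7, 9], [6, 10, 11],
    [0, 5], [4, 6], [3, 7], [1, 7]].getD v []

/-- Neighbour lists of the cubic graph on `n` vertices consisting of the gadget on `{0, …, 11}` and
a ladder with rungs `{12, 13}, {14, 15}, …, {n - 2, n - 1}`, joined by the edges `{10, 12}`,
`{11, 13}`, `{8, n - 2}` and `{9, n - 1}`. -/
def ladderNeighbors (n v : ℕ) : List ℕ :=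
  if v < 12 then
    [[1, 4, 8], [0, 2, 11], [1, 3, 5], [2, 4, 10], [0, 3, 9], [2, 6, 8], [5, 7, 9], [6, 10, 11],
      [0, 5, n - 2], [4, 6, n - 1], [3, 7, 12], [1, 7, 13]].getD v []
  else [v - 2, if v + 2 < n then v + 2 else v + 10 - n, if v % 2 = 0 then v + 1 else v - 1]

theorem partialEmbeddings_neighbors14 :
    partialEmbeddings (fun u v => decide (v ∈ neighbors14 u)) 14 14 = [List.range 14] := by
  decide +kernel

theorem partialEmbeddings_gadgetNeighbors :
    partialEmbeddings (fun u v => decide (v ∈ gadgetNeighbors u)) 12 12 = [List.range 12] := by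
  decide +kernel

theorem mem_ladderNeighbors_of_ge {n v x : ℕ} (hv : 12 ≤ v) :
    x ∈ ladderNeighbors n v ↔ x = v - 2 ∨ x = (if v + 2 < n then v + 2 else v + 10 - n) ∨
      x = (if v % 2 = 0 then v + 1 else v - 1) := by
  simp [ladderNeighbors, show ¬ v < 12 by omega]

theorem mem_ladderNeighbors_iff_gadgetNeighbors {n : ℕ} (hn : 16 ≤ n) :
    ∀ u < 12, ∀ v < 12, v ∈ ladderNeighbors n u ↔ v ∈ gadgetNeighbors u := by
  intro u hu v hv
  interval_cases u <;> simp [ladderNeighbors, gadgetNeighbors] <;> omega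

theorem gadgetNeighbors_symm : ∀ u < 12, ∀ v ∈ gadgetNeighbors u, u ∈ gadgetNeighbors v := by
  decide +kernel

theorem gadgetNeighbors_triangleFree : ∀ u < 12, ∀ v ∈ gadgetNeighbors u,
    ∀ w ∈ gadgetNeighbors v, w ∉ gadgetNeighbors u := by
  decide +kernel

theorem gadgetNeighbors_no_four_cycle : ∀ v < 12, ∀ x ∈ gadgetNeighbors v,
    ∀ y ∈ gadgetNeighbors v, x ≠ y → ∀ w ∈ gadgetNeighbors x, w ∈ gadgetNeighbors y → w = v := by
  decide +kernel

theorem gadgetNeighbors_lt_of_ge : ∀ u < 12, ∀ v ∈ gadgetNeighbors u, 8 ≤ u → v < 8 := by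
  decide +kernel

theorem mem_ladderNeighbors_of_lt_of_ge {n u v : ℕ} (hn : 16 ≤ n) (hu : u < 12) (hv : 12 ≤ v) :
    v ∈ ladderNeighbors n u ↔
      (u = 10 ∧ v = 12) ∨ (u = 11 ∧ v = 13) ∨ (u = 8 ∧ v = n - 2) ∨ (u = 9 ∧ v = n - 1) := by
  interval_cases u <;> simp [ladderNeighbors] <;> omega

theorem ladderNeighbors_symm {n : ℕ} (hn : 16 ≤ n) (heven : n % 2 = 0) :
    ∀ u < n, ∀ v ∈ ladderNeighbors n u, u ∈ ladderNeighbors n v := by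
  intro u hu v hv
  by_cases hu' : u < 12 <;> by_cases hv' : v < 12
  · rw [mem_ladderNeighbors_iff_gadgetNeighbors hn _ hv' _ hu']
    rw [mem_ladderNeighbors_iff_gadgetNeighbors hn _ hu' _ hv'] at hv
    exact gadgetNeighbors_symm u hu' v hv
  · rw [mem_ladderNeighbors_of_lt_of_ge hn hu' (by omega)] at hv
    rw [mem_ladderNeighbors_of_ge (by omega)]
    split_ifs <;> omega
  · rw [mem_ladderNeighbors_of_ge (by omega)] at hv
    rw [mem_ladderNeighbors_of_lt_of_ge hn hv' (by omega)]
    split_ifs at hv <;> omega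
  · rw [mem_ladderNeighbors_of_ge (by omega)] at hv ⊢
    split_ifs at hv ⊢ <;> omega

theorem ladderNeighbors_lt {n : ℕ} (hn : 16 ≤ n) (heven : n % 2 = 0) :
    ∀ u < n, ∀ v ∈ ladderNeighbors n u, v < n := by
  intro u hu v hv
  by_cases hv' : v < 12
  · omega
  by_cases hu' : u < 12
  · rw [mem_ladderNeighbors_of_lt_of_ge hn hu' (by omega)] at hv
    omega
  · rw [mem_ladderNeighbors_of_ge (by omega)] at hv
    split_ifs at hv <;> omega

theorem ladderNeighbors_triangleFree {n : ℕ} (hn : 16 ≤ n) (heven : n % 2 = 0) :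
    ∀ u < n, ∀ v ∈ ladderNeighbors n u, ∀ w ∈ ladderNeighbors n v, w ∉ ladderNeighbors n u := by
  intro u hu v huv w hvw huw
  have hv := ladderNeighbors_lt hn heven u hu v huv
  have hw := ladderNeighbors_lt hn heven u hu w huw
  have hvu := ladderNeighbors_symm hn heven u hu v huv
  have hwu := ladderNeighbors_symm hn heven u hu w huw
  have hwv := ladderNeighbors_symm hn heven v hv w hvw
  have hgadget := mem_ladderNeighbors_iff_gadgetNeighbors hn
  by_cases hu' : u < 12 <;> by_cases hv' : v < 12 <;> by_cases hw' : w < 12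
  · rw [hgadget _ ‹_› _ ‹_›] at huv hvw huw
    exact gadgetNeighbors_triangleFree u hu' v huv w hvw huw
  · rw [hgadget _ ‹_› _ ‹_›] at huv
    rw [mem_ladderNeighbors_of_lt_of_ge hn (by omega) (by omega)] at huw hvw
    have := gadgetNeighbors_lt_of_ge u hu' v huv
    omega
  · rw [hgadget _ ‹_› _ ‹_›] at huw
    rw [mem_ladderNeighbors_of_lt_of_ge hn (by omega) (by omega)] at huv hwv
    have := gadgetNeighbors_lt_of_ge u hu' w huw
    omega
  · rw [mem_ladderNeighbors_of_lt_of_ge hn (by omega) (by omega)] at huv huw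
    rw [mem_ladderNeighbors_of_ge (by omega)] at hvw
    split_ifs at hvw <;> omega
  · rw [hgadget _ ‹_› _ ‹_›] at hvw
    rw [mem_ladderNeighbors_of_lt_of_ge hn (by omega) (by omega)] at hvu hwu
    have := gadgetNeighbors_lt_of_ge v hv' w hvw
    omega
  · rw [mem_ladderNeighbors_of_lt_of_ge hn (by omega) (by omega)] at hvu hvw
    rw [mem_ladderNeighbors_of_ge (by omega)] at huw
    split_ifs at huw <;> omega
  · rw [mem_ladderNeighbors_of_lt_of_ge hn (by omega) (by omega)] at hwu hwv
    rw [mem_ladderNeighbors_of_ge (by omega)] at huv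
    split_ifs at huv <;> omega
  · rw [mem_ladderNeighbors_of_ge (by omega)] at huv hvw huw
    split_ifs at huv hvw huw <;> omega

/-- A gadget vertex lies on no 4-cycle. -/
theorem ladderNeighbors_no_four_cycle {n : ℕ} (hn : 16 ≤ n) (heven : n % 2 = 0) :
    ∀ v < 12, ∀ x ∈ ladderNeighbors n v, ∀ y ∈ ladderNeighbors n v, x ≠ y →
      ∀ w ∈ ladderNeighbors n x, w ∈ ladderNeighbors n y → w = v := by
  intro v hv x hvx y hvy hxy w hxw hyw
  have hx := ladderNeighbors_lt hn heven v (by omega) x hvx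
  have hy := ladderNeighbors_lt hn heven v (by omega) y hvy
  have hwx := ladderNeighbors_symm hn heven x hx w hxw
  have hwy := ladderNeighbors_symm hn heven y hy w hyw
  have hgadget := mem_ladderNeighbors_iff_gadgetNeighbors hn
  by_cases hx' : x < 12 <;> by_cases hy' : y < 12 <;> by_cases hw' : w < 12
  · rw [hgadget _ ‹_› _ ‹_›] at hvx hvy hxw hyw
    exact gadgetNeighbors_no_four_cycle v hv x hvx y hvy hxy w hxw hyw
  · rw [mem_ladderNeighbors_of_lt_of_ge hn (by omega) (by omega)] at hxw hyw
    omega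
  · rw [mem_ladderNeighbors_of_lt_of_ge hn (by omega) (by omega)] at hvy hwy
    omega
  · rw [hgadget _ ‹_› _ ‹_›] at hvx
    rw [mem_ladderNeighbors_of_lt_of_ge hn (by omega) (by omega)] at hxw hvy
    have := gadgetNeighbors_lt_of_ge v hv x hvx
    omega
  · rw [mem_ladderNeighbors_of_lt_of_ge hn (by omega) (by omega)] at hvx hwx
    omega
  · rw [hgadget _ ‹_› _ ‹_›] at hvy
    rw [mem_ladderNeighbors_of_lt_of_ge hn (by omega) (by omega)] at hyw hvx
    have := gadgetNeighbors_lt_of_ge v hv y hvy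
    omega
  all_goals
    rw [mem_ladderNeighbors_of_lt_of_ge hn (by omega) (by omega)] at hvx hvy
    omega

/-- A ladder vertex lies on a 4-cycle. -/
theorem ladderNeighbors_exists_four_cycle {n : ℕ} (hn : 16 ≤ n) (heven : n % 2 = 0) :
    ∀ v < n, 12 ≤ v → ∃ x < n, ∃ y < n, ∃ w < n, x ∈ ladderNeighbors n v ∧
      y ∈ ladderNeighbors n v ∧ x ≠ y ∧ w ∈ ladderNeighbors n x ∧ w ∈ ladderNeighbors n y ∧
      w ≠ v := by
  intro v hv hv'
  obtain ⟨p, hp⟩ : ∃ p, p = if v % 2 = 0 then v + 1 else v - 1 := ⟨_, rfl⟩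
  by_cases h : v + 2 < n
  · refine ⟨p, ?_, v + 2, ?_, p + 2, ?_, ?_, ?_, ?_, ?_, ?_, ?_⟩ <;>
      try rw [mem_ladderNeighbors_of_ge (by split_ifs at hp <;> omega)]
    all_goals split_ifs at hp ⊢ <;> omega
  · refine ⟨p, ?_, v - 2, ?_, p - 2, ?_, ?_, ?_, ?_, ?_, ?_, ?_⟩ <;>
      try rw [mem_ladderNeighbors_of_ge (by split_ifs at hp <;> omega)]
    all_goals split_ifs at hp ⊢ <;> omega

theorem ladderNeighbors_rigid {n : ℕ} (hn : 16 ≤ n) (heven : n % 2 = 0) (f g : ℕ → ℕ)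
    (hf : ∀ v < n, f v < n) (hg : ∀ v < n, g v < n) (hfg : ∀ v < n, f (g v) = v)
    (hgf : ∀ v < n, g (f v) = v)
    (hadj : ∀ u < n, ∀ v < n, f v ∈ ladderNeighbors n (f u) ↔ v ∈ ladderNeighbors n u) :
    ∀ v < n, f v = v := by
  have hinj : ∀ u < n, ∀ v < n, f u = f v → u = v := fun u hu v hv h => by
    rw [← hgf u hu, h, hgf v hv]
  have hgadget : ∀ v < 12, f v < 12 := by
    intro v hv
    by_contra! hfv
    obtain ⟨x, hx, y, hy, w, hw, hvx, hvy, hxy, hxw, hyw, hwv⟩ :=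
      ladderNeighbors_exists_four_cycle hn heven (f v) (hf v (by omega)) hfv
    rw [← hfg x hx] at hvx hxw
    rw [← hfg y hy] at hvy hyw
    rw [← hfg w hw] at hxw hyw
    rw [hadj _ (by omega) _ (hg _ ‹_›)] at hvx hvy
    rw [hadj _ (hg _ ‹_›) _ (hg _ ‹_›)] at hxw hyw
    have := ladderNeighbors_no_four_cycle hn heven v hv _ hvx _ hvy
      (fun h => hxy (by rw [← hfg x hx, h, hfg y hy])) _ hxw hyw
    exact hwv (by rw [← this, hfg w hw])
  have hbase : ∀ v < 12, f v = v := by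
    refine eq_self_of_partialEmbeddings hgadget
      (fun u hu v hv => hinj u (by omega) v (by omega)) (fun u hu v hv => ?_)
      partialEmbeddings_gadgetNeighbors
    rw [decide_eq_decide, ← mem_ladderNeighbors_iff_gadgetNeighbors hn _ (hgadget u hu) _
      (hgadget v hv), ← mem_ladderNeighbors_iff_gadgetNeighbors hn _ hu _ hv]
    exact hadj u (by omega) v (by omega)
  intro v
  induction v using Nat.strong_induction_on with
  | _ v ih =>
    intro hv
    by_cases hv' : v < 12
    · exact hbase v hv'
    have hnew : ∀ u < v, f v ≠ u := fun u hu h => by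
      have := hinj v hv u (by omega) (by rw [h, ih u hu (by omega)])
      omega
    have hmem : v ∈ ladderNeighbors n (v - 2) := by
      apply ladderNeighbors_symm hn heven v hv
      simp [mem_ladderNeighbors_of_ge (show 12 ≤ v by omega)]
    rw [← hadj _ (by omega) _ hv, ih (v - 2) (by omega) (by omega)] at hmem
    by_cases h14 : v < 14
    · have h3 := hnew 3 (by omega)
      have h7 := hnew 7 (by omega)
      have h1 := hnew 1 (by omega)
      interval_cases v <;> simp [ladderNeighbors] at hmem <;> omega
    · rw [mem_ladderNeighbors_of_ge (by omega)] at hmem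
      have h1 := hnew (v - 2 - 2) (by omega)
      have h2 := hnew (v - 1) (by omega)
      have h3 := hnew (v - 3) (by omega)
      split_ifs at hmem <;> omega

/-- For every even `n ≥ 14` there exists a connected, asymmetric, 3-regular,
non-bipartite, triangle-free graph on `n` vertices. -/
theorem exists_cubic_asymmetric (n : ℕ) (hn : 14 ≤ n) (heven : Even n) :
    ∃ G : SimpleGraph (Fin n),
      G.Connected ∧
      (∀ e : G ≃g G, ∀ v, e v = v) ∧
      (∀ v, (G.neighborSet v).ncard = 3) ∧
      ¬ G.Colorable 2 ∧
      G.CliqueFree 3 := by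
  rw [Nat.even_iff] at heven
  obtain rfl | hn : n = 14 ∨ 16 ≤ n := by omega
  · refine exists_graph_of_neighbors neighbors14 ?_ (by decide +kernel) (by decide +kernel)
      (by decide +kernel) ⟨1, 3, 4, 6, 5, by decide⟩ ?_
    · intro v hv
      interval_cases v <;> exact ⟨_, _, _, rfl, by decide⟩
    · intro f g hf _ _ hgf hadj
      refine eq_self_of_partialEmbeddings hf (fun u hu v hv h => ?_) (fun u hu v hv => ?_)
        partialEmbeddings_neighbors14
      · rw [← hgf u hu, h, hgf v hv]
      · rw [decide_eq_decide]
        exact hadj u hu v hv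
  · refine exists_graph_of_neighbors (ladderNeighbors n) ?_ (ladderNeighbors_symm hn heven) ?_
      (ladderNeighbors_triangleFree hn heven) ⟨0, 8, 5, 2, 1, by omega, by simp [ladderNeighbors]⟩
      (ladderNeighbors_rigid hn heven)
    · intro v hv
      by_cases hv' : v < 12
      · interval_cases v <;> exact ⟨_, _, _, rfl, by omega⟩
      · refine ⟨_, _, _, if_neg hv', ?_⟩
        split_ifs <;> omega
    · intro v hv hpos
      by_cases hv' : v < 12
      · interval_cases v <;> simp [ladderNeighbors]
      · exact ⟨v - 2, by simp [mem_ladderNeighbors_of_ge (show 12 ≤ v by omega)], by omega⟩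
end

section
/- For every even integer n ≥ 14 there exists a connected, asymmetric, 4-regular, non-bipartite, triangle-free graph on n vertices. -/
namespace SimpleGraph

/-! ### General criteria -/

theorem connected_of_exists_lt_adj {n : ℕ} (hn : 0 < n) (G : SimpleGraph (Fin n))
    (h : ∀ v : Fin n, 0 < v.val → ∃ w, w < v ∧ G.Adj v w) : G.Connected := by
  have : Nonempty (Fin n) := ⟨⟨0, hn⟩⟩
  have key : ∀ k (hk : k < n), G.Reachable ⟨k, hk⟩ ⟨0, hn⟩ := by
    intro k
    induction k using Nat.strong_induction_on with
    | _ k ih =>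
      intro hk
      rcases Nat.eq_zero_or_pos k with rfl | hpos
      · exact Reachable.refl _
      · obtain ⟨w, hw, hadj⟩ := h ⟨k, hk⟩ hpos
        exact hadj.reachable.trans (ih w.val hw w.isLt)
  exact ⟨fun u v => (key u.val u.isLt).trans (key v.val v.isLt).symm⟩

theorem not_colorable_two_of_pentagon {V : Type*} {G : SimpleGraph V} {a b c d e : V}
    (hab : G.Adj a b) (hbc : G.Adj b c) (hcd : G.Adj c d) (hde : G.Adj d e) (hea : G.Adj e a) :
    ¬ G.Colorable 2 := by
  rintro ⟨C⟩
  have h1 := C.valid hab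
  have h2 := C.valid hbc
  have h3 := C.valid hcd
  have h4 := C.valid hde
  have h5 := C.valid hea
  omega

theorem cliqueFree_three_of_forall {V : Type*} {G : SimpleGraph V}
    (h : ∀ a b c, G.Adj a b → G.Adj b c → ¬ G.Adj a c) : G.CliqueFree 3 := by
  classical
  intro s hs
  obtain ⟨a, b, c, hab, hac, hbc, -⟩ := is3Clique_iff.mp hs
  exact h a b c hab hbc hac

/-! ### Two small graphs, rigid because of an injective vertex invariant -/

section Invariant

variable {V : Type*} [Fintype V] (G : SimpleGraph V) [DecidableRel G.Adj]

/-- The number of common neighbours of two vertices. -/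
def codegree (v w : V) : ℕ := ∑ x, if G.Adj v x ∧ G.Adj w x then 1 else 0

/-- The sum of the sixth powers of the codegrees of a vertex. -/
def codegreeMoment (v : V) : ℕ := ∑ w, G.codegree v w ^ 6

/-- The sum of the squared codegree moments of the neighbours of a vertex. -/
def neighborMoment (v : V) : ℕ := ∑ w, if G.Adj v w then G.codegreeMoment w ^ 2 else 0

variable {G}

theorem codegree_map (e : G ≃g G) (v w : V) : G.codegree (e v) (e w) = G.codegree v w := by
  unfold codegree
  rw [← e.toEquiv.sum_comp]
  exact Finset.sum_congr rfl fun x _ => by simp [e.map_adj_iff]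

theorem codegreeMoment_map (e : G ≃g G) (v : V) :
    G.codegreeMoment (e v) = G.codegreeMoment v := by
  unfold codegreeMoment
  rw [← e.toEquiv.sum_comp]
  exact Finset.sum_congr rfl fun x _ => by simp [codegree_map]

theorem neighborMoment_map (e : G ≃g G) (v : V) :
    G.neighborMoment (e v) = G.neighborMoment v := by
  unfold neighborMoment
  rw [← e.toEquiv.sum_comp]
  exact Finset.sum_congr rfl fun x _ => by simp [codegreeMoment_map, e.map_adj_iff]

theorem asymmetric_of_neighborMoment_injective (h : Function.Injective G.neighborMoment)
    (e : G ≃g G) (v : V) : e v = v :=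
  h (neighborMoment_map e v)

end Invariant

/-- The graph on `Fin n` in which `i` and `j` are adjacent if each is listed as a neighbour
of the other. -/
def ofNeighbors {n : ℕ} (N : Fin n → List (Fin n)) : SimpleGraph (Fin n) where
  Adj i j := i ≠ j ∧ j ∈ N i ∧ i ∈ N j
  symm := ⟨fun _ _ h => ⟨h.1.symm, h.2.2, h.2.1⟩⟩
  loopless := ⟨fun _ h => h.1 rfl⟩

instance {n : ℕ} (N : Fin n → List (Fin n)) : DecidableRel (ofNeighbors N).Adj :=
  fun i j => inferInstanceAs (Decidable (i ≠ j ∧ j ∈ N i ∧ i ∈ N j))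

theorem ncard_neighborSet_of_degree {V : Type*} [Fintype V] {G : SimpleGraph V}
    [DecidableRel G.Adj] {k : ℕ} (h : ∀ v, G.degree v = k) (v : V) :
    (G.neighborSet v).ncard = k := by
  rw [← h v, ← card_neighborSet_eq_degree, Set.ncard_eq_toFinset_card', Set.toFinset_card]

/-- A quartic triangle-free graph on 14 vertices. -/
def quartic14 : SimpleGraph (Fin 14) := ofNeighbors
  ![[1, 2, 3, 4], [0, 5, 6, 7], [0, 8, 9, 10], [0, 5, 6, 11], [0, 8, 11, 12], [1, 3, 9, 10],
    [1, 3, 8, 12], [1, 10, 11, 12], [2, 4, 6, 13], [2, 5, 11, 13], [2, 5, 7, 13], [3, 4, 7, 9],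
    [4, 6, 7, 13], [8, 9, 10, 12]]

/-- A quartic triangle-free graph on 16 vertices. -/
def quartic16 : SimpleGraph (Fin 16) := ofNeighbors
  ![[1, 2, 3, 4], [0, 5, 6, 7], [0, 8, 9, 10], [0, 10, 11, 12], [0, 6, 12, 13], [1, 10, 14, 15],
    [1, 4, 14, 15], [1, 8, 9, 13], [2, 7, 11, 14], [2, 7, 11, 12], [2, 3, 5, 13], [3, 8, 9, 15],
    [3, 4, 9, 15], [4, 7, 10, 14], [5, 6, 8, 13], [5, 6, 11, 12]]

instance : DecidableRel quartic14.Adj := inferInstanceAs (DecidableRel (ofNeighbors _).Adj)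

instance : DecidableRel quartic16.Adj := inferInstanceAs (DecidableRel (ofNeighbors _).Adj)

theorem exists_quartic_asymmetric_fourteen :
    ∃ G : SimpleGraph (Fin 14), G.Connected ∧ (∀ e : G ≃g G, ∀ v, e v = v) ∧
      (∀ v, (G.neighborSet v).ncard = 4) ∧ ¬ G.Colorable 2 ∧ G.CliqueFree 3 := by
  refine ⟨quartic14, connected_of_exists_lt_adj (by norm_num) _ (by decide +kernel),
    asymmetric_of_neighborMoment_injective (by decide +kernel),
    ncard_neighborSet_of_degree (by decide +kernel),
    not_colorable_two_of_pentagon (a := 0) (b := 1) (c := 5) (d := 9) (e := 2)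
      (by decide) (by decide) (by decide) (by decide) (by decide),
    cliqueFree_three_of_forall (by decide +kernel)⟩

theorem exists_quartic_asymmetric_sixteen :
    ∃ G : SimpleGraph (Fin 16), G.Connected ∧ (∀ e : G ≃g G, ∀ v, e v = v) ∧
      (∀ v, (G.neighborSet v).ncard = 4) ∧ ¬ G.Colorable 2 ∧ G.CliqueFree 3 := by
  refine ⟨quartic16, connected_of_exists_lt_adj (by norm_num) _ (by decide +kernel),
    asymmetric_of_neighborMoment_injective (by decide +kernel),
    ncard_neighborSet_of_degree (by decide +kernel),
    not_colorable_two_of_pentagon (a := 0) (b := 1) (c := 5) (d := 10) (e := 2)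
      (by decide) (by decide) (by decide) (by decide) (by decide),
    cliqueFree_three_of_forall (by decide +kernel)⟩

end SimpleGraph

namespace TwistedRing

/-- The forward edges of a modified circulant graph: start from the circulant graph on `n` vertices
with jumps `1` and `4`, delete the edges `3-4`, `7-8`, `8-9`, `10-11`, and insert `3-8`, `4-7`,
`8-10`, `9-11`. -/
def Edge (n i j : ℕ) : Prop :=
  (j = i + 1 ∧ i ≠ 3 ∧ i ≠ 7 ∧ i ≠ 8 ∧ i ≠ 10) ∨ j = i + 4 ∨ (i = 0 ∧ j + 1 = n) ∨
    (i < 4 ∧ j + 4 = i + n) ∨ (i = 3 ∧ j = 8) ∨ (i = 4 ∧ j = 7) ∨ (i = 8 ∧ j = 10) ∨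
    (i = 9 ∧ j = 11)

/-- Adjacency in the twisted ring. -/
def Adj (n i j : ℕ) : Prop := Edge n i j ∨ Edge n j i

theorem Adj.symm {n i j : ℕ} (h : Adj n i j) : Adj n j i := Or.symm h

theorem edge_lt {n i j : ℕ} (hn : 18 ≤ n) (h : Edge n i j) : i < j := by
  unfold Edge at h
  omega

/-- An edge that lies on no 4-cycle. -/
def Lonely (n u v : ℕ) : Prop :=
  Adj n u v ∧ ∀ x < n, ∀ y < n, Adj n u x → Adj n v y → Adj n x y → x = v ∨ y = u

theorem Lonely.symm {n u v : ℕ} (h : Lonely n u v) : Lonely n v u :=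
  ⟨h.1.symm, fun x hx y hy hux hvy hxy => (h.2 y hy x hx hvy hux hxy.symm).symm⟩

theorem adj_one {n i j : ℕ} (h : j = i + 1 ∧ i ≠ 3 ∧ i ≠ 7 ∧ i ≠ 8 ∧ i ≠ 10) : Adj n i j :=
  Or.inl (Or.inl h)

theorem adj_four {n i j : ℕ} (h : j = i + 4) : Adj n i j :=
  Or.inl (Or.inr (Or.inl h))

theorem adj_wrap {n i j : ℕ} (h : (i = 0 ∧ j + 1 = n) ∨ (i < 4 ∧ j + 4 = i + n)) : Adj n i j :=
  Or.inl (Or.inr (Or.inr (h.imp_right Or.inl)))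

theorem adj_extra {n i j : ℕ}
    (h : (i = 3 ∧ j = 8) ∨ (i = 4 ∧ j = 7) ∨ (i = 8 ∧ j = 10) ∨ (i = 9 ∧ j = 11)) :
    Adj n i j :=
  Or.inl (Or.inr (Or.inr (Or.inr (Or.inr h))))

/-- Apart from `8-10`, `8-12` and `7-11`, every edge lies on a 4-cycle. -/
theorem exists_square {n u v : ℕ} (hn : 18 ≤ n) (hv : v < n) (h : Edge n u v)
    (h1 : ¬ (u = 8 ∧ v = 10)) (h2 : ¬ (u = 8 ∧ v = 12)) (h3 : ¬ (u = 7 ∧ v = 11)) :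
    ∃ x y, x < n ∧ y < n ∧ x ≠ v ∧ y ≠ u ∧ Adj n u x ∧ Adj n v y ∧ Adj n x y := by
  unfold Edge at h
  rcases h with h | h | h | h | h | h | h | h
  · by_cases h4 : u = 4
    · refine ⟨0, 1, ?_, ?_, ?_, ?_, ?_, ?_, ?_⟩ <;>
      first | omega | grind only [adj_one, adj_four, adj_wrap, adj_extra, Adj.symm]
    by_cases h6 : u = 6
    · refine ⟨2, 3, ?_, ?_, ?_, ?_, ?_, ?_, ?_⟩ <;>
      first | omega | grind only [adj_one, adj_four, adj_wrap, adj_extra, Adj.symm]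
    rcases lt_trichotomy (u + 5) n with h5 | h5 | h5
    · refine ⟨u + 4, u + 5, ?_, ?_, ?_, ?_, ?_, ?_, ?_⟩ <;>
      first | omega | grind only [adj_one, adj_four, adj_wrap, adj_extra, Adj.symm]
    · refine ⟨u + 4, 0, ?_, ?_, ?_, ?_, ?_, ?_, ?_⟩ <;>
      first | omega | grind only [adj_one, adj_four, adj_wrap, adj_extra, Adj.symm]
    · refine ⟨u + 4 - n, u + 5 - n, ?_, ?_, ?_, ?_, ?_, ?_, ?_⟩ <;>
      first | omega | grind only [adj_one, adj_four, adj_wrap, adj_extra, Adj.symm]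
  · by_cases h4 : u = 4
    · refine ⟨7, 3, ?_, ?_, ?_, ?_, ?_, ?_, ?_⟩ <;>
      first | omega | grind only [adj_one, adj_four, adj_wrap, adj_extra, Adj.symm]
    by_cases h6 : u = 3 ∨ u = 6 ∨ u = 10
    · refine ⟨u - 1, u + 3, ?_, ?_, ?_, ?_, ?_, ?_, ?_⟩ <;>
      first | omega | grind only [adj_one, adj_four, adj_wrap, adj_extra, Adj.symm]
    by_cases h5 : u + 5 = n
    · refine ⟨u + 1, 0, ?_, ?_, ?_, ?_, ?_, ?_, ?_⟩ <;>
      first | omega | grind only [adj_one, adj_four, adj_wrap, adj_extra, Adj.symm]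
    · refine ⟨u + 1, u + 5, ?_, ?_, ?_, ?_, ?_, ?_, ?_⟩ <;>
      first | omega | grind only [adj_one, adj_four, adj_wrap, adj_extra, Adj.symm]
  · refine ⟨n - 4, n - 5, ?_, ?_, ?_, ?_, ?_, ?_, ?_⟩ <;>
    first | omega | grind only [adj_one, adj_four, adj_wrap, adj_extra, Adj.symm]
  · by_cases h3 : u = 3
    · refine ⟨2, n - 2, ?_, ?_, ?_, ?_, ?_, ?_, ?_⟩ <;>
      first | omega | grind only [adj_one, adj_four, adj_wrap, adj_extra, Adj.symm]
    · refine ⟨u + 1, v + 1, ?_, ?_, ?_, ?_, ?_, ?_, ?_⟩ <;>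
      first | omega | grind only [adj_one, adj_four, adj_wrap, adj_extra, Adj.symm]
  · refine ⟨7, 4, ?_, ?_, ?_, ?_, ?_, ?_, ?_⟩ <;>
    first | omega | grind only [adj_one, adj_four, adj_wrap, adj_extra, Adj.symm]
  · refine ⟨8, 3, ?_, ?_, ?_, ?_, ?_, ?_, ?_⟩ <;>
    first | omega | grind only [adj_one, adj_four, adj_wrap, adj_extra, Adj.symm]
  · omega
  · refine ⟨13, 12, ?_, ?_, ?_, ?_, ?_, ?_, ?_⟩ <;>
    first | omega | grind only [adj_one, adj_four, adj_wrap, adj_extra, Adj.symm]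

theorem lonely_cases {n u v : ℕ} (hn : 18 ≤ n) (hu : u < n) (hv : v < n) (h : Lonely n u v) :
    (u = 8 ∧ v = 10) ∨ (u = 8 ∧ v = 12) ∨ (u = 7 ∧ v = 11) ∨
      (u = 10 ∧ v = 8) ∨ (u = 12 ∧ v = 8) ∨ (u = 11 ∧ v = 7) := by
  by_contra hne
  rcases h.1 with h1 | h1
  · obtain ⟨x, y, hx, hy, hxv, hyu, hux, hvy, hxy⟩ :=
      exists_square hn hv h1 (by omega) (by omega) (by omega)
    exact (h.2 x hx y hy hux hvy hxy).elim hxv hyu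
  · obtain ⟨x, y, hx, hy, hxv, hyu, hux, hvy, hxy⟩ :=
      exists_square hn hu h1 (by omega) (by omega) (by omega)
    exact (h.symm.2 x hx y hy hux hvy hxy).elim hxv hyu

/-- `a, b, c, d` are exactly the neighbours of `v`. -/
def Neighbors (n v a b c d : ℕ) : Prop :=
  (a < b ∧ b < c ∧ c < d ∧ d < n) ∧ ∀ j < n, Adj n v j ↔ j = a ∨ j = b ∨ j = c ∨ j = d

theorem neighbors_of {n v a b c d : ℕ} (hlt : a < b ∧ b < c ∧ c < d ∧ d < n)
    (ha : Adj n v a) (hb : Adj n v b) (hc : Adj n v c) (hd : Adj n v d)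
    (hout : ∀ j < n, Edge n v j → j = a ∨ j = b ∨ j = c ∨ j = d)
    (hin : ∀ j < n, Edge n j v → j = a ∨ j = b ∨ j = c ∨ j = d) : Neighbors n v a b c d := by
  refine ⟨hlt, fun j hj => ⟨fun h => h.elim (hout j hj) (hin j hj), ?_⟩⟩
  rintro (rfl | rfl | rfl | rfl) <;> assumption

theorem neighbors_generic {n v : ℕ} (h12 : 12 ≤ v) (hv : v + 4 < n) :
    Neighbors n v (v - 4) (v - 1) (v + 1) (v + 4) := by
  apply neighbors_of
  all_goals first
    | omega
    | grind only [adj_one, adj_four, adj_wrap, adj_extra, Adj.symm]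
    | (intro j hj h; unfold Edge at h; omega)

/-- The neighbour lists of the vertices `0, …, 11`. -/
theorem neighbors_initial {n : ℕ} (hn : 18 ≤ n) :
    Neighbors n 0 1 4 (n - 4) (n - 1) ∧
      Neighbors n 1 0 2 5 (n - 3) ∧
      Neighbors n 2 1 3 6 (n - 2) ∧
      Neighbors n 3 2 7 8 (n - 1) ∧
      Neighbors n 4 0 5 7 8 ∧
      Neighbors n 5 1 4 6 9 ∧
      Neighbors n 6 2 5 7 10 ∧
      Neighbors n 7 3 4 6 11 ∧
      Neighbors n 8 3 4 10 12 ∧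
      Neighbors n 9 5 10 11 13 ∧
      Neighbors n 10 6 8 9 14 ∧
      Neighbors n 11 7 9 12 15 := by
  refine ⟨?_, ?_, ?_, ?_, ?_, ?_, ?_, ?_, ?_, ?_, ?_, ?_⟩ <;> apply neighbors_of
  all_goals first
    | omega
    | grind only [adj_one, adj_four, adj_wrap, adj_extra, Adj.symm]
    | (intro j hj h; unfold Edge at h; omega)

theorem neighbors_final {n v : ℕ} (hn : 18 ≤ n) (hv : v + 1 < n) (hv' : n ≤ v + 4) :
    Neighbors n v (v + 4 - n) (v - 4) (v - 1) (v + 1) := by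
  apply neighbors_of
  all_goals first
    | omega
    | grind only [adj_one, adj_four, adj_wrap, adj_extra, Adj.symm]
    | (intro j hj h; unfold Edge at h; omega)

theorem neighbors_last {n v : ℕ} (hn : 18 ≤ n) (hv : v + 1 = n) :
    Neighbors n v 0 3 (v - 4) (v - 1) := by
  apply neighbors_of
  all_goals first
    | omega
    | grind only [adj_one, adj_four, adj_wrap, adj_extra, Adj.symm]
    | (intro j hj h; unfold Edge at h; omega)

theorem exists_neighbors {n v : ℕ} (hn : 18 ≤ n) (hv : v < n) :
    ∃ a b c d, Neighbors n v a b c d := by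
  rcases lt_or_ge v 12 with h | h
  · obtain ⟨h0, h1, h2, h3, h4, h5, h6, h7, h8, h9, h10, h11⟩ := neighbors_initial hn
    interval_cases v <;> exact ⟨_, _, _, _, by assumption⟩
  · rcases lt_or_ge (v + 4) n with h' | h'
    · exact ⟨_, _, _, _, neighbors_generic h h'⟩
    · by_cases h1 : v + 1 = n
      · exact ⟨_, _, _, _, neighbors_last hn h1⟩
      · exact ⟨_, _, _, _, neighbors_final hn (by omega) h'⟩

/-- No three increasing vertices form a triangle. -/
theorem not_edge_of_edge_edge {n a b c : ℕ} (hn : 18 ≤ n) (hc : c < n) (hab : Edge n a b)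
    (hbc : Edge n b c) : ¬ Edge n a c := by
  unfold Edge at *
  rcases hab with h | h | h | h | h | h | h | h <;>
  rcases hbc with h' | h' | h' | h' | h' | h' | h' | h' <;> omega

theorem lonely_eight_ten {n : ℕ} (hn : 18 ≤ n) : Lonely n 8 10 := by
  obtain ⟨h0, h1, h2, h3, h4, h5, h6, h7, h8, h9, h10, h11⟩ := neighbors_initial hn
  refine ⟨adj_extra (by omega), fun x hx y hy hux hvy hxy => ?_⟩
  rcases (h8.2 x hx).1 hux with rfl | rfl | rfl | rfl <;>
  rcases (h10.2 y hy).1 hvy with rfl | rfl | rfl | rfl <;> unfold Adj Edge at hxy <;> omega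

theorem lonely_eight_twelve {n : ℕ} (hn : 18 ≤ n) : Lonely n 8 12 := by
  obtain ⟨h0, h1, h2, h3, h4, h5, h6, h7, h8, h9, h10, h11⟩ := neighbors_initial hn
  refine ⟨adj_four (by omega), fun x hx y hy hux hvy hxy => ?_⟩
  rcases (h8.2 x hx).1 hux with rfl | rfl | rfl | rfl <;>
  rcases ((neighbors_generic (n := n) (v := 12) le_rfl (by omega)).2 y hy).1 hvy
    with rfl | rfl | rfl | rfl <;> unfold Adj Edge at hxy <;> omega

theorem lonely_seven_eleven {n : ℕ} (hn : 18 ≤ n) : Lonely n 7 11 := by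
  obtain ⟨h0, h1, h2, h3, h4, h5, h6, h7, h8, h9, h10, h11⟩ := neighbors_initial hn
  refine ⟨adj_four (by omega), fun x hx y hy hux hvy hxy => ?_⟩
  rcases (h7.2 x hx).1 hux with rfl | rfl | rfl | rfl <;>
  rcases (h11.2 y hy).1 hvy with rfl | rfl | rfl | rfl <;> unfold Adj Edge at hxy <;> omega

/-- The function `f` restricts to an automorphism of the twisted ring on `{0, …, n - 1}`. -/
structure IsAutomorphism (n : ℕ) (f : ℕ → ℕ) : Prop where
  lt : ∀ i < n, f i < n
  inj : ∀ i < n, ∀ j < n, f i = f j → i = j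
  surj : ∀ j < n, ∃ i < n, f i = j
  adj_iff : ∀ i < n, ∀ j < n, (Adj n (f i) (f j) ↔ Adj n i j)

namespace IsAutomorphism

variable {n : ℕ} {f : ℕ → ℕ}

theorem lonely_iff (h : IsAutomorphism n f) {u v : ℕ} (hu : u < n) (hv : v < n) :
    Lonely n (f u) (f v) ↔ Lonely n u v := by
  unfold Lonely
  rw [h.adj_iff u hu v hv]
  refine and_congr_right fun _ => ⟨fun H x hx y hy hux hvy hxy => ?_,
    fun H x hx y hy hux hvy hxy => ?_⟩
  · refine (H (f x) (h.lt x hx) (f y) (h.lt y hy) ((h.adj_iff u hu x hx).2 hux)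
      ((h.adj_iff v hv y hy).2 hvy) ((h.adj_iff x hx y hy).2 hxy)).imp ?_ ?_
    · exact h.inj x hx v hv
    · exact h.inj y hy u hu
  · obtain ⟨x, hx', rfl⟩ := h.surj x hx
    obtain ⟨y, hy', rfl⟩ := h.surj y hy
    rw [h.adj_iff _ hu _ hx'] at hux
    rw [h.adj_iff _ hv _ hy'] at hvy
    rw [h.adj_iff _ hx' _ hy'] at hxy
    exact (H x hx' y hy' hux hvy hxy).imp (congrArg f) (congrArg f)

theorem fixed_of_common (h : IsAutomorphism n f) {v w x : ℕ} (hv : v < n) (hw : w < n) (hx : x < n)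
    (fv : f v = v) (fw : f w = w) (hvx : Adj n v x) (hwx : Adj n w x)
    (hy : ∀ y < n, Adj n v y → Adj n w y → y = x ∨ f y = y) : f x = x := by
  have h1 := (h.adj_iff v hv x hx).2 hvx
  have h2 := (h.adj_iff w hw x hx).2 hwx
  rw [fv] at h1
  rw [fw] at h2
  exact (hy (f x) (h.lt x hx) h1 h2).elim id (h.inj _ (h.lt x hx) _ hx)

theorem fixed_of_neighbors (h : IsAutomorphism n f) {v a b c d x : ℕ} (hv : v < n) (fv : f v = v)
    (N : Neighbors n v a b c d) (hx : x = a ∨ x = b ∨ x = c ∨ x = d) (ha : x = a ∨ f a = a)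
    (hb : x = b ∨ f b = b) (hc : x = c ∨ f c = c) (hd : x = d ∨ f d = d) : f x = x := by
  have hxn : x < n := by
    have := N.1
    omega
  have hvx := (N.2 x hxn).2 hx
  refine h.fixed_of_common hv hv hxn fv fv hvx hvx fun y hy hvy _ => ?_
  rcases (N.2 y hy).1 hvy with rfl | rfl | rfl | rfl
  · exact ha.imp_left Eq.symm
  · exact hb.imp_left Eq.symm
  · exact hc.imp_left Eq.symm
  · exact hd.imp_left Eq.symm

theorem fixed_lonely (h : IsAutomorphism n f) (hn : 18 ≤ n) : f 8 = 8 ∧ f 10 = 10 ∧ f 12 = 12 := by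
  have l10 := (h.lonely_iff (by omega) (by omega)).2 (lonely_eight_ten hn)
  have l12 := (h.lonely_iff (by omega) (by omega)).2 (lonely_eight_twelve hn)
  have l7 := (h.lonely_iff (by omega) (by omega)).2 (lonely_seven_eleven hn)
  have b7 := h.lt 7 (by omega)
  have b8 := h.lt 8 (by omega)
  have b10 := h.lt 10 (by omega)
  have b11 := h.lt 11 (by omega)
  have b12 := h.lt 12 (by omega)
  have c10 := lonely_cases hn b8 b10 l10
  have c12 := lonely_cases hn b8 b12 l12
  have c7 := lonely_cases hn b7 b11 l7
  have i1 := h.inj 10 (by omega) 12 (by omega)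
  have i2 := h.inj 11 (by omega) 8 (by omega)
  have f8 : f 8 = 8 := by omega
  have f12 : f 12 = 12 := by
    by_contra hne
    have f12 : f 12 = 10 := by omega
    have h1 : Adj n (f 12) (f 11) :=
      (h.adj_iff 12 (by omega) 11 (by omega)).2 (adj_one (by omega)).symm
    rw [f12] at h1
    obtain ⟨-, -, -, -, -, -, -, -, -, -, N, -⟩ := neighbors_initial hn
    have := (N.2 _ b11).1 h1
    omega
  exact ⟨f8, by omega, f12⟩

theorem fixed_fourteen (h : IsAutomorphism n f) (hn : 18 ≤ n) : f 14 = 14 := by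
  obtain ⟨f8, f10, f12⟩ := h.fixed_lonely hn
  obtain ⟨-, -, -, -, -, -, -, -, -, -, N, -⟩ := neighbors_initial hn
  have h1 : Adj n (f 10) (f 14) := (h.adj_iff 10 (by omega) 14 (by omega)).2 (adj_four rfl)
  rw [f10] at h1
  have no_lonely_neighbor : ∀ s < n, ∀ t < n, Lonely n s t → Adj n (f 14) s → s = 10 := by
    intro s hs t ht hst hadj
    obtain ⟨s, hs', rfl⟩ := h.surj s hs
    obtain ⟨t, ht', rfl⟩ := h.surj t ht
    rw [h.lonely_iff hs' ht'] at hst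
    rw [h.adj_iff _ (by omega) _ hs'] at hadj
    have := lonely_cases hn hs' ht' hst
    have hs10 : s = 10 := by
      unfold Adj Edge at hadj
      omega
    rw [hs10, f10]
  have l7 := lonely_seven_eleven hn
  rcases (N.2 _ (h.lt 14 (by omega))).1 h1 with h2 | h2 | h2 | h2
  · have := no_lonely_neighbor 7 (by omega) 11 (by omega) l7 (h2 ▸ adj_one (by omega))
    omega
  · have := h.inj 14 (by omega) 8 (by omega) (h2.trans f8.symm)
    omega
  · have := no_lonely_neighbor 11 (by omega) 7 (by omega) l7.symm (h2 ▸ adj_extra (by omega))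
    omega
  · exact h2

theorem fixed_of_five_le_of_le (h : IsAutomorphism n f) (hn : 18 ≤ n) {i : ℕ} (h5 : 5 ≤ i)
    (h17 : i ≤ 17) : f i = i := by
  obtain ⟨f8, f10, f12⟩ := h.fixed_lonely hn
  have f14 := h.fixed_fourteen hn
  obtain ⟨N0, N1, N2, N3, N4, N5, N6, N7, N8, N9, N10, N11⟩ := neighbors_initial hn
  have N12 := neighbors_generic (n := n) (v := 12) (by omega) (by omega)
  have N13 := neighbors_generic (n := n) (v := 13) (by omega) (by omega)
  have f13 : f 13 = 13 := by
    refine h.fixed_of_common (by omega) (by omega) (by omega) f12 f14 (adj_one (by omega))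
      (adj_one (by omega)).symm fun y hy h1 h2 => Or.inl ?_
    have := (N12.2 y hy).1 h1
    unfold Adj Edge at h2
    omega
  have f9 : f 9 = 9 := by
    refine h.fixed_of_common (by omega) (by omega) (by omega) f10 f13 (adj_one (by omega)).symm
      (adj_four (by omega)).symm fun y hy h1 h2 => ?_
    have h3 := (N10.2 y hy).1 h1
    have h4 := (N13.2 y hy).1 h2
    have h5 : y = 9 ∨ y = 14 := by omega
    exact h5.imp_right (by rintro rfl; exact f14)
  have f6 : f 6 = 6 := h.fixed_of_neighbors (by omega) f10 N10 (by simp) (by simp) (by simp [f8])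
    (by simp [f9]) (by simp [f14])
  have f17 : f 17 = 17 := h.fixed_of_neighbors (by omega) f13 N13 (by simp) (by simp [f9])
    (by simp [f12]) (by simp [f14]) (by simp)
  have f5 : f 5 = 5 := by
    refine h.fixed_of_common (by omega) (by omega) (by omega) f6 f9 (adj_one (by omega)).symm
      (adj_four (by omega)).symm fun y hy h1 h2 => ?_
    have h3 := (N6.2 y hy).1 h1
    have h4 := (N9.2 y hy).1 h2
    have h5 : y = 5 ∨ y = 10 := by omega
    exact h5.imp_right (by rintro rfl; exact f10)
  have f11 : f 11 = 11 := h.fixed_of_neighbors (by omega) f9 N9 (by simp) (by simp [f5])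
    (by simp [f10]) (by simp) (by simp [f13])
  have f7 : f 7 = 7 := by
    refine h.fixed_of_common (by omega) (by omega) (by omega) f6 f11 (adj_one (by omega))
      (adj_four (by omega)).symm fun y hy h1 h2 => ?_
    have h3 := (N6.2 y hy).1 h1
    have h4 := (N11.2 y hy).1 h2
    omega
  have f15 : f 15 = 15 := h.fixed_of_neighbors (by omega) f11 N11 (by simp) (by simp [f7])
    (by simp [f9]) (by simp [f12]) (by simp)
  have f16 : f 16 = 16 := h.fixed_of_neighbors (by omega) f12 N12 (by simp) (by simp [f8])
    (by simp [f11]) (by simp [f13]) (by simp)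
  interval_cases i <;> assumption

theorem fixed_of_five_le (h : IsAutomorphism n f) (hn : 18 ≤ n) (i : ℕ) (h5 : 5 ≤ i)
    (hi : i < n) : f i = i := by
  induction i using Nat.strong_induction_on with
  | _ i ih =>
    rcases le_or_gt i 17 with h17 | h17
    · exact h.fixed_of_five_le_of_le hn h5 h17
    · exact h.fixed_of_neighbors (v := i - 4) (by omega) (ih _ (by omega) (by omega) (by omega))
        (neighbors_generic (by omega) (by omega)) (by omega)
        (Or.inr (ih _ (by omega) (by omega) (by omega)))
        (Or.inr (ih _ (by omega) (by omega) (by omega)))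
        (Or.inr (ih _ (by omega) (by omega) (by omega))) (by omega)

theorem fixed (h : IsAutomorphism n f) (hn : 18 ≤ n) (i : ℕ) (hi : i < n) : f i = i := by
  have big := h.fixed_of_five_le hn
  obtain ⟨N0, N1, N2, N3, N4, N5, N6, N7, N8, N9, N10, N11⟩ := neighbors_initial hn
  have f0 : f 0 = 0 := h.fixed_of_neighbors (v := n - 4) (by omega)
    (big _ (by omega) (by omega)) (neighbors_final hn (by omega) (by omega)) (by omega) (by omega)
    (Or.inr (big _ (by omega) (by omega))) (Or.inr (big _ (by omega) (by omega)))
    (Or.inr (big _ (by omega) (by omega)))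
  have f1 : f 1 = 1 := h.fixed_of_neighbors (v := n - 3) (by omega)
    (big _ (by omega) (by omega)) (neighbors_final hn (by omega) (by omega)) (by omega) (by omega)
    (Or.inr (big _ (by omega) (by omega))) (Or.inr (big _ (by omega) (by omega)))
    (Or.inr (big _ (by omega) (by omega)))
  have f2 : f 2 = 2 := h.fixed_of_neighbors (by omega) (big 6 (by omega) (by omega)) N6 (by omega)
    (by omega) (Or.inr (big _ (by omega) (by omega))) (Or.inr (big _ (by omega) (by omega)))
    (Or.inr (big _ (by omega) (by omega)))
  have f3 : f 3 = 3 := h.fixed_of_neighbors (v := n - 1) (by omega)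
    (big _ (by omega) (by omega)) (neighbors_last hn (by omega)) (by omega) (Or.inr f0) (by omega)
    (Or.inr (big _ (by omega) (by omega))) (Or.inr (big _ (by omega) (by omega)))
  have f4 : f 4 = 4 := h.fixed_of_neighbors (by omega) f0 N0 (by omega) (Or.inr f1) (by omega)
    (Or.inr (big _ (by omega) (by omega))) (Or.inr (big _ (by omega) (by omega)))
  rcases lt_or_ge i 5 with h5 | h5
  · interval_cases i <;> assumption
  · exact big i h5 hi

end IsAutomorphism

/-- The twisted ring as a graph on `Fin n`. -/
def graph (n : ℕ) (hn : 18 ≤ n) : SimpleGraph (Fin n) where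
  Adj i j := Adj n i j
  symm := ⟨fun _ _ h => Adj.symm h⟩
  loopless := ⟨fun _ h => h.elim (fun h => (edge_lt hn h).ne rfl) fun h => (edge_lt hn h).ne rfl⟩

theorem graph_asymmetric {n : ℕ} (hn : 18 ≤ n) (e : graph n hn ≃g graph n hn) (v : Fin n) :
    e v = v := by
  let f : ℕ → ℕ := fun i => if h : i < n then (e ⟨i, h⟩).val else i
  have f_eq : ∀ i (h : i < n), f i = (e ⟨i, h⟩).val := fun i h => dif_pos h
  have hf : IsAutomorphism n f := by
    refine ⟨fun i hi => ?_, fun i hi j hj hij => ?_, fun j hj => ?_, fun i hi j hj => ?_⟩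
    · rw [f_eq i hi]
      exact (e ⟨i, hi⟩).isLt
    · rw [f_eq i hi, f_eq j hj] at hij
      exact congrArg Fin.val (e.injective (Fin.ext hij))
    · refine ⟨(e.symm ⟨j, hj⟩).val, (e.symm ⟨j, hj⟩).isLt, ?_⟩
      rw [f_eq _ (e.symm ⟨j, hj⟩).isLt]
      simp
    · rw [f_eq i hi, f_eq j hj]
      exact e.map_adj_iff (v := ⟨i, hi⟩) (w := ⟨j, hj⟩)
  have := hf.fixed hn v.val v.isLt
  rw [f_eq _ v.isLt] at this
  exact Fin.ext this

theorem graph_connected {n : ℕ} (hn : 18 ≤ n) : (graph n hn).Connected := by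
  refine SimpleGraph.connected_of_exists_lt_adj (by omega) _ fun v hv => ?_
  have hvn := v.isLt
  by_cases h4 : v.val < 4
  · refine ⟨⟨v.val - 1, by omega⟩, Fin.lt_def.2 (by simp; omega), Adj.symm (adj_one ?_)⟩
    simp only
    omega
  · refine ⟨⟨v.val - 4, by omega⟩, Fin.lt_def.2 (by simp; omega), Adj.symm (adj_four ?_)⟩
    simp only
    omega

theorem graph_ncard_neighborSet {n : ℕ} (hn : 18 ≤ n) (v : Fin n) :
    ((graph n hn).neighborSet v).ncard = 4 := by
  obtain ⟨a, b, c, d, ⟨hab, hbc, hcd, hdn⟩, hN⟩ := exists_neighbors hn v.isLt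
  have hset : (graph n hn).neighborSet v =
      ↑({⟨a, by omega⟩, ⟨b, by omega⟩, ⟨c, by omega⟩, ⟨d, hdn⟩} : Finset (Fin n)) := by
    ext w
    have adj_iff : (graph n hn).Adj v w ↔ Adj n v w := Iff.rfl
    simpa [Fin.ext_iff, adj_iff] using hN w.val w.isLt
  rw [hset, Set.ncard_coe_finset]
  repeat rw [Finset.card_insert_of_notMem (by simp [Fin.ext_iff]; omega)]
  simp

theorem graph_not_colorable {n : ℕ} (hn : 18 ≤ n) : ¬ (graph n hn).Colorable 2 :=
  SimpleGraph.not_colorable_two_of_pentagon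
    (a := ⟨11, by omega⟩) (b := ⟨12, by omega⟩) (c := ⟨13, by omega⟩) (d := ⟨14, by omega⟩)
    (e := ⟨15, by omega⟩) (adj_one (by simp)) (adj_one (by simp)) (adj_one (by simp))
    (adj_one (by simp)) (Adj.symm (adj_four (by simp)))

theorem graph_cliqueFree {n : ℕ} (hn : 18 ≤ n) : (graph n hn).CliqueFree 3 := by
  refine SimpleGraph.cliqueFree_three_of_forall fun a b c hab hbc hac => ?_
  have key := fun x y z : Fin n => not_edge_of_edge_edge (a := x.val) (b := y) (c := z) hn z.isLt
  rcases hab with h1 | h1 <;> rcases hbc with h2 | h2 <;> rcases hac with h3 | h3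
  · exact key _ _ _ h1 h2 h3
  · exact absurd (edge_lt hn h1) (by have := edge_lt hn h2; have := edge_lt hn h3; omega)
  · exact key _ _ _ h3 h2 h1
  · exact key _ _ _ h3 h1 h2
  · exact key _ _ _ h1 h3 h2
  · exact key _ _ _ h2 h3 h1
  · exact absurd (edge_lt hn h1) (by have := edge_lt hn h2; have := edge_lt hn h3; omega)
  · exact key _ _ _ h2 h1 h3

end TwistedRing

/-- For every even `n ≥ 14` there exists a connected, asymmetric, 4-regular,
non-bipartite, triangle-free graph on `n` vertices. -/
theorem exists_quartic_asymmetric (n : ℕ) (hn : 14 ≤ n) (heven : Even n) :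
    ∃ G : SimpleGraph (Fin n),
      G.Connected ∧
      (∀ e : G ≃g G, ∀ v, e v = v) ∧
      (∀ v, (G.neighborSet v).ncard = 4) ∧
      ¬ G.Colorable 2 ∧
      G.CliqueFree 3 := by
  rcases lt_or_ge n 18 with h18 | h18
  · obtain rfl | rfl : n = 14 ∨ n = 16 := by
      obtain ⟨k, rfl⟩ := heven
      omega
    · exact SimpleGraph.exists_quartic_asymmetric_fourteen
    · exact SimpleGraph.exists_quartic_asymmetric_sixteen
  · exact ⟨TwistedRing.graph n h18, TwistedRing.graph_connected h18,
      TwistedRing.graph_asymmetric h18, TwistedRing.graph_ncard_neighborSet h18,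
      TwistedRing.graph_not_colorable h18, TwistedRing.graph_cliqueFree h18⟩
end

section
/- For every d ≥ 3 and every odd integer g ≥ 7, there exist infinitely many pairwise non-isomorphic d-regular graphs of odd girth g that are mutually rigid: each graph is rigid, and there is no graph homomorphism between any two distinct members of the family. -/
/-- `G` has odd girth exactly `g`: there is an (odd) cycle of length `g`,
and every odd cycle has length at least `g`. -/
def OddGirthEq {V : Type} (G : SimpleGraph V) (g : ℕ) : Prop :=
  (∃ (v : V) (w : G.Walk v v), w.IsCycle ∧ w.length = g) ∧
  ∀ (v : V) (w : G.Walk v v), w.IsCycle → Odd w.length → g ≤ w.length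

namespace RigidRegular

open SimpleGraph

/-- The circulant graph on `ZMod (m * D + 2)` whose steps are `1, 1 + m, …, 1 + D * m`;
a circular clique of degree `D + 1`. -/
def stepGraph (m D : ℕ) : SimpleGraph (ZMod (m * D + 2)) where
  Adj x y := ∃ j ≤ D, y = x + ((1 + j * m : ℕ) : ZMod (m * D + 2))
  symm := ⟨by
    rintro x y ⟨j, hj, rfl⟩
    refine ⟨D - j, Nat.sub_le _ _, ?_⟩
    obtain ⟨k, rfl⟩ := Nat.exists_eq_add_of_le hj
    have h : ((m * (j + k) + 2 : ℕ) : ZMod (m * (j + k) + 2)) = 0 := ZMod.natCast_self _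
    rw [Nat.add_sub_cancel_left]
    push_cast at h ⊢
    linear_combination -h⟩
  loopless := ⟨by
    rintro x ⟨j, hj, h⟩
    have h0 : ((1 + j * m : ℕ) : ZMod (m * D + 2)) = 0 := by linear_combination -h
    rw [ZMod.natCast_eq_zero_iff] at h0
    have := Nat.le_of_dvd (by omega) h0
    nlinarith⟩

/-- The two edges `{0, m + 1}` and `{2, m + 3}`, as a relation on ordered pairs. -/
def IsCut (m D : ℕ) (x y : ZMod (m * D + 2)) : Prop :=
  (x = 0 ∧ y = m + 1) ∨ (x = m + 1 ∧ y = 0) ∨ (x = 2 ∧ y = m + 3) ∨ (x = m + 3 ∧ y = 2)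

variable {m D : ℕ}

theorem IsCut.symm {x y : ZMod (m * D + 2)} (h : IsCut m D x y) : IsCut m D y x := by
  unfold IsCut at *; tauto

/-- `stepGraph m D` without the two edges of `IsCut`. -/
def cutGraph (m D : ℕ) : SimpleGraph (ZMod (m * D + 2)) where
  Adj x y := (stepGraph m D).Adj x y ∧ ¬ IsCut m D x y
  symm := ⟨fun _ _ h => ⟨h.1.symm, fun h' => h.2 h'.symm⟩⟩
  loopless := ⟨fun _ h => h.1.ne rfl⟩

theorem natCast_ne_zero {n : ℕ} (h0 : 0 < n) (h : n < m * D + 2) :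
    (n : ZMod (m * D + 2)) ≠ 0 := by
  rw [Ne, ZMod.natCast_eq_zero_iff]
  exact Nat.not_dvd_of_pos_of_lt h0 h

theorem natCast_modulus : (m : ZMod (m * D + 2)) * D + 2 = 0 := by
  exact_mod_cast ZMod.natCast_self (m * D + 2)

theorem adj_add_natCast_iff (hm : 2 ≤ m) (x : ZMod (m * D + 2)) {n : ℕ} (hn : n < m * D + 2) :
    (stepGraph m D).Adj x (x + n) ↔ n % m = 1 := by
  constructor
  · rintro ⟨j, hj, h⟩
    have h' := add_left_cancel h
    rw [ZMod.natCast_eq_natCast_iff', Nat.mod_eq_of_lt hn, Nat.mod_eq_of_lt (by nlinarith)] at h'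
    rw [h', Nat.add_mul_mod_self_right, Nat.mod_eq_of_lt (by omega)]
  · intro h
    refine ⟨n / m, ?_, ?_⟩
    · have := Nat.div_add_mod n m
      by_contra! hlt
      have := Nat.mul_le_mul_left m (Nat.succ_le_of_lt hlt)
      rw [Nat.mul_succ] at this
      omega
    · congr 2
      have := Nat.div_add_mod n m
      rw [mul_comm (n / m)]
      omega

theorem adj_add_one (x : ZMod (m * D + 2)) : (stepGraph m D).Adj x (x + 1) :=
  ⟨0, Nat.zero_le _, by simp⟩

theorem adj_add_chord (hD : 1 ≤ D) (x : ZMod (m * D + 2)) : (stepGraph m D).Adj x (x + (m + 1)) :=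
  ⟨1, hD, by push_cast; ring⟩

theorem IsCut.adj (hD : 1 ≤ D) {x y : ZMod (m * D + 2)} (h : IsCut m D x y) :
    (stepGraph m D).Adj x y := by
  have h0 := adj_add_chord (m := m) hD 0
  have h2 := adj_add_chord (m := m) hD 2
  rw [zero_add] at h0
  rw [show (2 : ZMod (m * D + 2)) + (m + 1) = m + 3 by ring] at h2
  rcases h with ⟨rfl, rfl⟩ | ⟨rfl, rfl⟩ | ⟨rfl, rfl⟩ | ⟨rfl, rfl⟩
  exacts [h0, h0.symm, h2, h2.symm]

theorem IsCut.sub_eq {x y : ZMod (m * D + 2)} (h : IsCut m D x y) :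
    y = x + (m + 1) ∨ x = y + (m + 1) := by
  rcases h with ⟨rfl, rfl⟩ | ⟨rfl, rfl⟩ | ⟨rfl, rfl⟩ | ⟨rfl, rfl⟩
  · left; ring
  · right; ring
  · left; ring
  · right; ring

theorem modulus_le (hD : 2 ≤ D) : 2 * m + 2 ≤ m * D + 2 := by nlinarith

theorem not_isCut_add_one (hm : 5 ≤ m) (hD : 2 ≤ D) (x : ZMod (m * D + 2)) :
    ¬ IsCut m D x (x + 1) := by
  intro h
  have := modulus_le (m := m) hD
  rcases h.sub_eq with h | h
  · refine natCast_ne_zero (m := m) (D := D) (n := m) (by omega) (by omega) ?_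
    linear_combination -h
  · refine natCast_ne_zero (m := m) (D := D) (n := m + 2) (by omega) (by omega) ?_
    push_cast
    linear_combination -h

theorem IsCut.not_isCut_succ (hm : 5 ≤ m) (hD : 2 ≤ D) {x y : ZMod (m * D + 2)}
    (h : IsCut m D x y) : ¬ IsCut m D (x + 1) (y + 1) := by
  have hp := modulus_le (m := m) hD
  have hne : ∀ n : ℕ, 0 < n → n < 2 * m + 2 → (n : ZMod (m * D + 2)) ≠ 0 :=
    fun n h0 h => natCast_ne_zero h0 (by omega)
  have h1 := hne 1 (by omega) (by omega)
  have h3 := hne 3 (by omega) (by omega)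
  have h4 := hne m (by omega) (by omega)
  have h5 := hne (m + 2) (by omega) (by omega)
  have h6 := hne (m + 4) (by omega) (by omega)
  push_cast at h1 h3 h5 h6
  rcases h with ⟨rfl, rfl⟩ | ⟨rfl, rfl⟩ | ⟨rfl, rfl⟩ | ⟨rfl, rfl⟩ <;>
    rintro (⟨h, h'⟩ | ⟨h, h'⟩ | ⟨h, h'⟩ | ⟨h, h'⟩)
  · exact h1 (by linear_combination h)
  · exact h4 (by linear_combination -h)
  · exact h1 (by linear_combination -h)
  · exact h5 (by linear_combination -h)
  · exact h5 (by linear_combination h)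
  · exact h1 (by linear_combination h)
  · exact h4 (by linear_combination h)
  · exact h1 (by linear_combination -h)
  · exact h3 (by linear_combination h)
  · exact h6 (by linear_combination h')
  · exact h1 (by linear_combination h)
  · exact h4 (by linear_combination -h)
  · exact h6 (by linear_combination h)
  · exact h3 (by linear_combination h')
  · exact h5 (by linear_combination h)
  · exact h1 (by linear_combination h)

theorem cutGraph_adj_add_one (hm : 5 ≤ m) (hD : 2 ≤ D) (x : ZMod (m * D + 2)) :
    (cutGraph m D).Adj x (x + 1) :=
  ⟨adj_add_one x, not_isCut_add_one hm hD x⟩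

theorem exists_rim_walk (hm : 5 ≤ m) (hD : 2 ≤ D) (x : ZMod (m * D + 2)) (k : ℕ) :
    ∃ w : (cutGraph m D).Walk x (x + k), w.length = k := by
  induction k with
  | zero => exact ⟨Walk.nil.copy rfl (by simp), by simp⟩
  | succ k ih =>
    obtain ⟨w, hw⟩ := ih
    exact ⟨(w.concat (cutGraph_adj_add_one hm hD _)).copy rfl (by push_cast; ring), by simp [hw]⟩

/-- Every translate class of odd index is reached by a short odd walk. -/
theorem exists_odd_walk_of_step (hm : 5 ≤ m) (hD : 2 ≤ D) (x : ZMod (m * D + 2))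
    {a b : ℕ} (ha : a ≤ D) (hb : Odd b) (hbm : b ≤ m) :
    ∃ w : (cutGraph m D).Walk x (x + (a * m + b : ℕ)), Odd w.length ∧ w.length ≤ m := by
  have hadj : ∀ y : ZMod (m * D + 2), (stepGraph m D).Adj y (y + (1 + a * m : ℕ)) :=
    fun y => ⟨a, ha, rfl⟩
  obtain ⟨c, rfl⟩ := hb
  by_cases h0 : IsCut m D x (x + (1 + a * m : ℕ))
  · have h1 := h0.not_isCut_succ hm hD
    rw [add_right_comm] at h1
    have hj : (cutGraph m D).Adj (x + 1) (x + 1 + (1 + a * m : ℕ)) := ⟨hadj _, h1⟩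
    rcases c with _ | c
    · refine ⟨((Walk.nil.concat (cutGraph_adj_add_one hm hD x)).concat hj |>.concat
        (v := x + 1 + (1 + a * m : ℕ)) (w := x + (1 + a * m : ℕ)) ?_).copy rfl ?_, ?_, ?_⟩
      · have := (cutGraph_adj_add_one hm hD (x + (1 + a * m : ℕ))).symm
        rwa [add_right_comm] at this
      · push_cast; ring
      · simp; decide
      · simp; omega
    · obtain ⟨w, hw⟩ := exists_rim_walk hm hD (x + 1 + (1 + a * m : ℕ)) (2 * c + 1)
      refine ⟨(((Walk.nil.concat (cutGraph_adj_add_one hm hD x)).concat hj).append w).copy rfl ?_,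
        ?_, ?_⟩
      · push_cast; ring
      · simp [hw]; exact ⟨c + 1, by ring⟩
      · simp [hw]; omega
  · obtain ⟨w, hw⟩ := exists_rim_walk hm hD (x + (1 + a * m : ℕ)) (2 * c)
    have hj : (cutGraph m D).Adj x (x + (1 + a * m : ℕ)) := ⟨hadj _, h0⟩
    refine ⟨(Walk.cons hj w).copy rfl ?_, ?_, ?_⟩
    · push_cast; ring
    · simp [hw]
    · simp [hw]; omega

theorem exists_odd_walk (hm : 5 ≤ m) (hodd : Odd m) (hD : 2 ≤ D) {x y : ZMod (m * D + 2)}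
    (hxy : x ≠ y) : ∃ w : (cutGraph m D).Walk x y, Odd w.length ∧ w.length ≤ m := by
  have hn : (y - x).val < m * D + 2 := ZMod.val_lt _
  have hyx : y = x + ((y - x).val : ZMod (m * D + 2)) := by simp
  have hpos : 0 < (y - x).val := by
    rw [Nat.pos_iff_ne_zero, Ne, ZMod.val_eq_zero, sub_eq_zero]
    exact hxy.symm
  generalize (y - x).val = n at hn hyx hpos
  have hdiv := Nat.div_add_mod (n - 1) m
  have hlt := Nat.mod_lt (n - 1) (show 0 < m by omega)
  obtain ⟨a, b, rfl, hb⟩ : ∃ a b, n = a * m + (b + 1) ∧ b < m :=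
    ⟨(n - 1) / m, (n - 1) % m, by rw [mul_comm]; omega, hlt⟩
  have ha : a ≤ D := by
    by_contra! h
    have := Nat.mul_le_mul_right m h
    nlinarith
  rcases Nat.even_or_odd b with hb2 | hb2
  · rw [hyx]
    exact exists_odd_walk_of_step hm hD x ha hb2.add_one hb
  · have ha' : a + 1 ≤ D := by
      rcases ha.lt_or_eq with h | rfl
      · exact h
      · have : b = 0 := by nlinarith
        subst this
        simp at hb2
    obtain ⟨a', hD'⟩ := Nat.exists_eq_add_of_le ha'
    obtain ⟨b', hm'⟩ := Nat.exists_eq_add_of_le hb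
    have hodd' : Odd (b' + 2) := by
      rw [Nat.odd_iff] at *
      omega
    obtain ⟨w, hw, hw'⟩ := exists_odd_walk_of_step (a := a') (b := b' + 2) hm hD y (by omega)
      hodd' (by rw [Nat.odd_iff] at *; omega)
    suffices hyx' : y + (a' * m + (b' + 2) : ℕ) = x from
      ⟨(w.copy rfl hyx').reverse, by simpa using hw, by simpa using hw'⟩
    have h := natCast_modulus (m := m) (D := D)
    have h1 : (m : ZMod (m * D + 2)) = (b.succ + b' : ℕ) := congrArg _ hm'
    have h2 : (D : ZMod (m * D + 2)) = (a + 1 + a' : ℕ) := congrArg _ hD'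
    rw [hyx]
    push_cast at h h1 h2 ⊢
    linear_combination h - h1 - m * h2

/-- Lengths of walks are congruent modulo `m` to the total displacement. -/
theorem exists_displacement {x y : ZMod (m * D + 2)} (w : (stepGraph m D).Walk x y) :
    ∃ J : ℕ, J ≤ w.length * D ∧ y = x + (w.length + J * m : ℕ) := by
  induction w with
  | nil => exact ⟨0, by simp⟩
  | cons h w ih =>
    obtain ⟨J, hJ, h'⟩ := ih
    obtain ⟨j, hj, hv⟩ := id h
    refine ⟨J + j, ?_, ?_⟩
    · rw [Walk.length_cons, Nat.succ_mul]
      omega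
    · rw [Walk.length_cons]
      push_cast at h' hv ⊢
      linear_combination h' + hv

theorem lt_length_of_odd {x : ZMod (m * D + 2)} (w : (stepGraph m D).Walk x x)
    (hw : Odd w.length) : m < w.length := by
  by_contra! hle
  obtain ⟨J, hJ, h⟩ := exists_displacement w
  have h0 : ((w.length + J * m : ℕ) : ZMod (m * D + 2)) = 0 := by linear_combination -h
  rw [ZMod.natCast_eq_zero_iff] at h0
  obtain ⟨c, hc⟩ := h0
  have hl : 0 < w.length := hw.pos
  generalize w.length = l at *
  have hc0 : 0 < c := by
    rcases Nat.eq_zero_or_pos c with rfl | h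
    · omega
    · exact h
  have hcl : c < l := by
    by_contra! h
    have h1 := Nat.mul_le_mul_right m hJ
    have h2 := Nat.mul_le_mul_left (m * D + 2) h
    nlinarith
  have hdvd : (m : ℤ) ∣ 2 * c - l := ⟨J - D * c, by
    have : (l : ℤ) + J * m = (m * D + 2) * c := by exact_mod_cast hc
    linear_combination -this⟩
  have hne : (2 * c - l : ℤ) ≠ 0 := by
    obtain ⟨k, rfl⟩ := hw
    omega
  have := Int.le_of_dvd (abs_pos.2 hne) ((dvd_abs _ _).2 hdvd)
  have habs : |(2 * c - l : ℤ)| < l := by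
    rw [abs_lt]
    constructor <;> omega
  omega
theorem ncard_neighborSet (hm : 1 ≤ m) (x : ZMod (m * D + 2)) :
    ((stepGraph m D).neighborSet x).ncard = D + 1 := by
  have h : (stepGraph m D).neighborSet x =
      ((Finset.range (D + 1)).image fun j : ℕ => x + ((1 + j * m : ℕ) : ZMod (m * D + 2))) := by
    ext y
    simp only [mem_neighborSet, Finset.coe_image, Set.mem_image, Finset.mem_coe, Finset.mem_range,
      Nat.lt_succ_iff]
    exact ⟨fun ⟨j, hj, h⟩ => ⟨j, hj, h.symm⟩, fun ⟨j, hj, h⟩ => ⟨j, hj, h.symm⟩⟩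
  rw [h, Set.ncard_coe_finset, Finset.card_image_of_injOn, Finset.card_range]
  intro i hi j hj hij
  simp only [Finset.coe_range, Set.mem_Iio, Nat.lt_succ_iff] at hi hj
  have h' := add_left_cancel hij
  rw [ZMod.natCast_eq_natCast_iff', Nat.mod_eq_of_lt (by nlinarith),
    Nat.mod_eq_of_lt (by nlinarith)] at h'
  exact Nat.eq_of_mul_eq_mul_right hm (by omega)

theorem injective_of_hom (hm : 5 ≤ m) (hodd : Odd m) (hD : 2 ≤ D)
    (f : cutGraph m D →g stepGraph m D) : Function.Injective f := by
  intro x y hxy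
  by_contra hne
  obtain ⟨w, hw, hw'⟩ := exists_odd_walk hm hodd hD hne
  have := lt_length_of_odd ((w.map f).copy rfl hxy.symm) (by simpa using hw)
  simp at this
  omega

theorem image_neighborSet_eq (hm : 1 ≤ m) {f : ZMod (m * D + 2) → ZMod (m * D + 2)}
    (hf : Function.Injective f) {x : ZMod (m * D + 2)}
    (h : ∀ y, (stepGraph m D).Adj x y → (stepGraph m D).Adj (f x) (f y)) :
    f '' (stepGraph m D).neighborSet x = (stepGraph m D).neighborSet (f x) := by
  refine Set.eq_of_subset_of_ncard_le ?_ ?_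
  · rintro _ ⟨y, hy, rfl⟩
    exact h y hy
  · rw [Set.ncard_image_of_injective _ hf, ncard_neighborSet hm, ncard_neighborSet hm]

/-- A homomorphism defined on `cutGraph` preserves a removed edge, provided that its first
end is joined by short even walks to the ends of the other removed edge. -/
theorem adj_map_of_isCut (hm : 5 ≤ m) (hodd : Odd m) (hD : 2 ≤ D)
    (f : cutGraph m D →g stepGraph m D) {x y : ZMod (m * D + 2)} (hxy : IsCut m D x y)
    (hwalk : ∀ z z', IsCut m D z z' → z ≠ x → z ≠ y →
      ∃ w : (cutGraph m D).Walk x z, Even w.length ∧ w.length < m) :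
    (stepGraph m D).Adj (f x) (f y) := by
  have hinj := injective_of_hom hm hodd hD f
  have hsurj : Function.Surjective f := Finite.surjective_of_injective hinj
  have hadj : (stepGraph m D).Adj x y := hxy.adj (by omega)
  by_contra hnot
  have hcard : (f '' ((stepGraph m D).neighborSet x \ {y})).ncard <
      ((stepGraph m D).neighborSet (f x)).ncard := by
    rw [Set.ncard_image_of_injective _ hinj, ncard_neighborSet (by omega),
      Set.ncard_sdiff_singleton_of_mem ((mem_neighborSet _ _ _).2 hadj),
      ncard_neighborSet (by omega)]
    omega
  obtain ⟨v, hz, hz'⟩ := Set.exists_mem_notMem_of_ncard_lt_ncard hcard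
  obtain ⟨z, rfl⟩ := hsurj v
  rw [mem_neighborSet] at hz
  have hzx : z ≠ x := by rintro rfl; exact hz.ne rfl
  have hzy : z ≠ y := by rintro rfl; exact hnot hz
  by_cases hcut : ∃ z', IsCut m D z z'
  · obtain ⟨z', hcut⟩ := hcut
    obtain ⟨w, hw, hw'⟩ := hwalk z z' hcut hzx hzy
    have := lt_length_of_odd ((w.map f).concat hz.symm) (by simpa using hw.add_one)
    simp at this
    omega
  · push Not at hcut
    have him := image_neighborSet_eq (by omega) hinj (x := z)
      fun y' hy' => f.map_adj ⟨hy', hcut y'⟩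
    have hmem : f x ∈ f '' (stepGraph m D).neighborSet z := him ▸ hz.symm
    rw [hinj.mem_set_image, mem_neighborSet] at hmem
    exact hz' ⟨z, ⟨hmem.symm, hzy⟩, rfl⟩

theorem adj_map (hm : 5 ≤ m) (hodd : Odd m) (hD : 2 ≤ D)
    (f : cutGraph m D →g stepGraph m D) {x y : ZMod (m * D + 2)}
    (hxy : (stepGraph m D).Adj x y) : (stepGraph m D).Adj (f x) (f y) := by
  have hrim : ∀ {x y : ZMod (m * D + 2)} (k : ℕ), y = x + k → Even k → k < m →
      ∃ w : (cutGraph m D).Walk x y, Even w.length ∧ w.length < m := by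
    rintro x _ k rfl hk hkm
    obtain ⟨w, hw⟩ := exists_rim_walk hm hD x k
    exact ⟨w, hw.symm ▸ hk, hw.symm ▸ hkm⟩
  have hrev : ∀ {x y : ZMod (m * D + 2)},
      (∃ w : (cutGraph m D).Walk x y, Even w.length ∧ w.length < m) →
      ∃ w : (cutGraph m D).Walk y x, Even w.length ∧ w.length < m :=
    fun ⟨w, hw⟩ => ⟨w.reverse, by simpa using hw⟩
  have hlong : ∃ w : (cutGraph m D).Walk 2 (m + 1), Even w.length ∧ w.length < m := by
    obtain ⟨k, rfl⟩ := hodd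
    refine hrim (2 * k) ?_ (by simp) (by omega)
    push_cast
    ring
  have h0 : (stepGraph m D).Adj (f (m + 1)) (f 0) := by
    refine adj_map_of_isCut hm hodd hD f (by unfold IsCut; tauto) ?_
    rintro z z' (⟨rfl, -⟩ | ⟨rfl, -⟩ | ⟨rfl, -⟩ | ⟨rfl, -⟩) h1 h2
    · exact absurd rfl h2
    · exact absurd rfl h1
    · exact hrev hlong
    · exact hrim 2 (by push_cast; ring) (by decide) (by omega)
  have h2 : (stepGraph m D).Adj (f 2) (f (m + 3)) := by
    refine adj_map_of_isCut hm hodd hD f (by unfold IsCut; tauto) ?_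
    rintro z z' (⟨rfl, -⟩ | ⟨rfl, -⟩ | ⟨rfl, -⟩ | ⟨rfl, -⟩) h1 h2
    · exact hrev (hrim 2 (by push_cast; ring) (by decide) (by omega))
    · exact hlong
    · exact absurd rfl h1
    · exact absurd rfl h2
  by_cases hcut : IsCut m D x y
  · rcases hcut with ⟨rfl, rfl⟩ | ⟨rfl, rfl⟩ | ⟨rfl, rfl⟩ | ⟨rfl, rfl⟩
    exacts [h0.symm, h0, h2, h2.symm]
  · exact f.map_adj ⟨hxy, hcut⟩

/-- Two vertices sharing all but one of their neighbours differ by `m`. -/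
theorem eq_add_or_eq_sub_of_neighbors (hm : 5 ≤ m) (hD : 2 ≤ D) {u v : ZMod (m * D + 2)}
    (huv : u ≠ v) (h : ∀ s t, (stepGraph m D).Adj u s → ¬ (stepGraph m D).Adj v s →
      (stepGraph m D).Adj u t → ¬ (stepGraph m D).Adj v t → s = t) :
    v = u + m ∨ v = u - m := by
  have hp := modulus_le (m := m) hD
  have hm0 : (m : ZMod (m * D + 2)) ≠ 0 := natCast_ne_zero (by omega) (by omega)
  have hmod := natCast_modulus (m := m) (D := D)
  obtain ⟨E, hE⟩ : ∃ E, D = E + 1 := ⟨D - 1, by omega⟩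
  have hEc : (D : ZMod (m * D + 2)) = E + 1 := by exact_mod_cast congrArg _ hE
  by_cases h1 : (stepGraph m D).Adj v (u + 1)
  · obtain ⟨k, hk, hv⟩ := h1
    push_cast at hv
    rcases k with _ | _ | k
    · exact absurd (by push_cast at hv; linear_combination hv) huv
    · right
      push_cast at hv
      linear_combination -hv
    · exfalso
      have hbound : (k + 1) * m ≤ D * m := Nat.mul_le_mul_right m (by omega)
      have hbound' : k * m ≤ D * m := Nat.mul_le_mul_right m (by omega)
      rw [mul_comm D] at hbound hbound'
      refine hm0 ?_
      have h2 := h (u + (1 + D * m : ℕ)) (u + (1 + E * m : ℕ)) ⟨D, le_rfl, rfl⟩ ?_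
        ⟨E, by omega, rfl⟩ ?_
      · push_cast at h2
        linear_combination h2 - m * hEc
      · have : u + ((1 + D * m : ℕ) : ZMod (m * D + 2)) = v + ((k + 1) * m + (m - 1) : ℕ) := by
          push_cast [show 1 ≤ m by omega] at hv ⊢
          linear_combination hv + hmod
        rw [this, adj_add_natCast_iff (by omega) _ (by
          nlinarith [Nat.sub_add_cancel (show 1 ≤ m by omega), Nat.mul_le_mul_right m hk]),
          Nat.mul_add_mod_self_right, Nat.mod_eq_of_lt (by omega)]
        omega
      · have : u + ((1 + E * m : ℕ) : ZMod (m * D + 2)) = v + (k * m + (m - 1) : ℕ) := by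
          push_cast [show 1 ≤ m by omega] at hv ⊢
          linear_combination hv + hmod - m * hEc
        rw [this, adj_add_natCast_iff (by omega) _ (by
          nlinarith [Nat.sub_add_cancel (show 1 ≤ m by omega), Nat.mul_le_mul_right m hk]),
          Nat.mul_add_mod_self_right, Nat.mod_eq_of_lt (by omega)]
        omega
  · have hmem : (stepGraph m D).Adj v (u + (1 + D * m : ℕ)) := by
      by_contra h2
      have h3 := h (u + 1) (u + (1 + D * m : ℕ)) (adj_add_one u) h1 ⟨D, le_rfl, rfl⟩ h2
      refine natCast_ne_zero (m := m) (D := D) (n := 2) (by omega) (by omega) ?_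
      push_cast at h3 ⊢
      linear_combination h3 + hmod
    obtain ⟨j, hj, hv⟩ := hmem
    obtain ⟨k, hk⟩ := Nat.exists_eq_add_of_le hj
    have hkc : (D : ZMod (m * D + 2)) = j + k := by exact_mod_cast congrArg _ hk
    push_cast at hv
    rcases k with _ | _ | k
    · exact absurd (by push_cast at hkc; linear_combination hv - m * hkc) huv
    · left
      push_cast at hkc
      linear_combination -hv + m * hkc
    · exfalso
      refine h1 ?_
      have h2 : ¬ (stepGraph m D).Adj v (u + (1 + 1 * m : ℕ)) := by
        have : u + ((1 + 1 * m : ℕ) : ZMod (m * D + 2)) = v + ((j + 1) * m + 3 : ℕ) := by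
          push_cast
          linear_combination hv - hmod
        have hb := Nat.mul_le_mul_left m (show j + 2 ≤ D by omega)
        rw [this, adj_add_natCast_iff (by omega) _ (by nlinarith), Nat.mul_add_mod_self_right,
          Nat.mod_eq_of_lt (by omega)]
        omega
      by_contra h3
      have h4 := h (u + 1) (u + (1 + 1 * m : ℕ)) (adj_add_one u) h3 ⟨1, by omega, rfl⟩ h2
      refine hm0 ?_
      push_cast at h4
      linear_combination -h4

theorem map_add_eq (hm : 5 ≤ m) (hodd : Odd m) (hD : 2 ≤ D)
    (f : cutGraph m D →g stepGraph m D) (x : ZMod (m * D + 2)) :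
    f (x + m) = f x + m ∨ f (x + m) = f x - m := by
  have hinj := injective_of_hom hm hodd hD f
  have hp := modulus_le (m := m) hD
  have hm0 : (m : ZMod (m * D + 2)) ≠ 0 := natCast_ne_zero (by omega) (by omega)
  refine eq_add_or_eq_sub_of_neighbors hm hD (fun h => hm0 ?_) ?_
  · linear_combination -(hinj h)
  have key : ∀ s, (stepGraph m D).Adj (f x) s → ¬ (stepGraph m D).Adj (f (x + m)) s →
      s = f (x + 1) := by
    intro s hs hs'
    have him := image_neighborSet_eq (by omega) hinj (x := x) fun y => adj_map hm hodd hD f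
    obtain ⟨a, ⟨j, hj, rfl⟩, rfl⟩ : s ∈ f '' (stepGraph m D).neighborSet x := him ▸ hs
    rcases j with _ | j
    · simp
    · refine absurd (adj_map hm hodd hD f ⟨j, by omega, ?_⟩) hs'
      push_cast
      ring
  intro s t hs hs' ht ht'
  rw [key s hs hs', key t ht ht']

/-- Every homomorphism from `cutGraph` to `stepGraph` is a dihedral symmetry. -/
theorem exists_affine (hm : 5 ≤ m) (hodd : Odd m) (hD : 2 ≤ D)
    (f : cutGraph m D →g stepGraph m D) :
    ∃ c e, (e = 1 ∨ e = -1) ∧ ∀ x, f x = c + e * x := by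
  have hinj := injective_of_hom hm hodd hD f
  have hp := modulus_le (m := m) hD
  obtain ⟨e, he, hfe⟩ : ∃ e : ZMod (m * D + 2), (e = 1 ∨ e = -1) ∧ f m = f 0 + e * m := by
    have := map_add_eq hm hodd hD f 0
    rw [zero_add] at this
    rcases this with h | h
    · exact ⟨1, Or.inl rfl, by rw [h]; ring⟩
    · exact ⟨-1, Or.inr rfl, by rw [h]; ring⟩
  have key : ∀ k : ℕ, f (k * m) = f 0 + e * (k * m) ∧
      f ((k + 1) * m) = f 0 + e * ((k + 1) * m) := by
    intro k
    induction k with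
    | zero => simpa using hfe
    | succ k ih =>
      refine ⟨by exact_mod_cast ih.2, ?_⟩
      have hstep := map_add_eq hm hodd hD f ((k + 1) * m)
      have hback : f ((k + 1) * m + m) ≠ f (k * m) := by
        intro h
        refine natCast_ne_zero (m := m) (D := D) (n := 2 * m) (by omega) (by omega) ?_
        push_cast
        linear_combination hinj h
      rw [show ((k : ZMod (m * D + 2)) + 1) * m + m = ((k + 1 : ℕ) + 1) * m by push_cast; ring]
        at hstep hback
      rw [ih.1] at hback
      rw [ih.2] at hstep
      push_cast at hstep hback ⊢
      rcases he with rfl | rfl <;> rcases hstep with h | h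
      · linear_combination h
      · exact absurd (by linear_combination h) hback
      · exact absurd (by linear_combination h) hback
      · linear_combination h
  refine ⟨f 0, e, he, fun x => ?_⟩
  have hu : IsUnit (m : ZMod (m * D + 2)) := by
    rw [ZMod.isUnit_iff_coprime, add_comm, Nat.coprime_add_mul_left_right]
    exact hodd.coprime_two_right
  obtain ⟨u, hu⟩ := hu
  have hx : x = ((x * ↑u⁻¹).val : ZMod (m * D + 2)) * m := by
    rw [ZMod.natCast_zmod_val, ← hu, mul_assoc, Units.inv_mul, mul_one]
  rw [hx]
  exact (key _).1
/-- A fixed-point-free involution of `ℕ` preserving every interval `[0, 2 * n)` with `3 ≤ n`. -/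
def swapNat : ℕ → ℕ
  | 0 => 2
  | 1 => 5
  | 2 => 0
  | 3 => 4
  | 4 => 3
  | 5 => 1
  | k + 6 => if k % 2 = 0 then k + 7 else k + 5

theorem swapNat_swapNat (k : ℕ) : swapNat (swapNat k) = k := by
  match k with
  | 0 | 1 | 2 | 3 | 4 | 5 => rfl
  | k + 6 =>
    rcases Nat.mod_two_eq_zero_or_one k with h | h
    · simp [swapNat, h, show (k + 1) % 2 = 1 by omega]
    · obtain ⟨l, rfl⟩ : ∃ l, k = l + 1 := ⟨k - 1, by omega⟩
      simp [swapNat, h, show l % 2 = 0 by omega]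

theorem swapNat_lt {n k : ℕ} (h : k < 2 * n + 10) : swapNat k < 2 * n + 10 := by
  match k with
  | 0 | 1 | 2 | 3 | 4 | 5 => simp only [swapNat]; omega
  | k + 6 => simp only [swapNat]; split_ifs <;> omega

theorem swapNat_ne (k : ℕ) : swapNat k ≠ k := by
  match k with
  | 0 | 1 | 2 | 3 | 4 | 5 => simp [swapNat]
  | k + 6 => simp only [swapNat]; split_ifs <;> omega

theorem natCast_inj_of_lt {N a b : ℕ} (ha : a < N) (hb : b < N) (h : (a : ZMod N) = b) :
    a = b := by
  rwa [ZMod.natCast_eq_natCast_iff', Nat.mod_eq_of_lt ha, Nat.mod_eq_of_lt hb] at h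

/-- The involution of `ZMod (2 * n + 10)` induced by `swapNat`. -/
def swapPerm (n : ℕ) : Equiv.Perm (ZMod (2 * n + 10)) :=
  Function.Involutive.toPerm (fun x => (swapNat x.val : ZMod (2 * n + 10))) fun x => by
    beta_reduce
    rw [ZMod.val_natCast_of_lt (swapNat_lt (ZMod.val_lt x)), swapNat_swapNat,
      ZMod.natCast_zmod_val]

theorem swapPerm_apply (n : ℕ) (x : ZMod (2 * n + 10)) : swapPerm n x = swapNat x.val := rfl

theorem swapPerm_swapPerm (n : ℕ) (x : ZMod (2 * n + 10)) : swapPerm n (swapPerm n x) = x :=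
  (swapPerm n).left_inv x

theorem swapPerm_natCast {n k : ℕ} (h : k < 2 * n + 10) :
    swapPerm n (k : ZMod (2 * n + 10)) = swapNat k := by
  rw [swapPerm_apply, ZMod.val_natCast_of_lt h]

theorem swapPerm_ne (n : ℕ) (x : ZMod (2 * n + 10)) : swapPerm n x ≠ x := by
  intro h
  rw [swapPerm_apply] at h
  nth_rw 2 [← ZMod.natCast_zmod_val x] at h
  exact swapNat_ne _ (natCast_inj_of_lt (swapNat_lt (ZMod.val_lt x)) (ZMod.val_lt x) h)

theorem eq_of_swapPerm_eq {n : ℕ} {x e : ZMod (2 * n + 10)} (he : e = 1 ∨ e = -1)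
    (h : swapPerm n x = x + 4 * e) : (x = 1 ∧ e = 1) ∨ (x = 5 ∧ e = -1) := by
  have hx : ((x.val : ℕ) : ZMod (2 * n + 10)) = x := ZMod.natCast_zmod_val x
  rw [swapPerm_apply] at h
  generalize x.val = v at h hx
  have hsmall : ∀ z : ℤ, (z : ZMod (2 * n + 10)) = 0 → |z| < 10 → z = 0 := by
    intro z hz hlt
    rw [ZMod.intCast_zmod_eq_zero_iff_dvd] at hz
    exact Int.eq_zero_of_abs_lt_dvd hz (by push_cast; omega)
  rcases he with rfl | rfl
  · have h0 := hsmall (swapNat v - v - 4) (by push_cast; rw [h, hx]; ring)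
    have hv : v = 1 := by
      match v with
      | 0 | 1 | 2 | 3 | 4 | 5 => simp [swapNat] at h0 ⊢
      | k + 6 => simp only [swapNat] at h0; rw [abs_lt] at h0; split_ifs at h0 <;> omega
    subst hv
    exact Or.inl ⟨by rw [← hx]; simp, rfl⟩
  · have h0 := hsmall (swapNat v - v + 4) (by push_cast; rw [h, hx]; ring)
    have hv : v = 5 := by
      match v with
      | 0 | 1 | 2 | 3 | 4 | 5 => simp [swapNat] at h0 ⊢
      | k + 6 => simp only [swapNat] at h0; rw [abs_lt] at h0; split_ifs at h0 <;> omega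
    subst hv
    exact Or.inr ⟨by rw [← hx]; simp, rfl⟩

/-- Maps intertwining the rotations, up to inversion, and the involutions are trivial. -/
theorem eq_of_intertwining {n n' : ℕ} {φ : ZMod (2 * n + 10) → ZMod (2 * n' + 10)}
    {e : ZMod (2 * n' + 10)} (he : e = 1 ∨ e = -1) (hshift : ∀ i, φ (i + 1) = φ i + e)
    (hswap : ∀ i, φ (swapPerm n i) = swapPerm n' (φ i)) :
    e = 1 ∧ n = n' ∧ ∀ k : ℕ, φ k = k := by
  have hφ : ∀ k : ℕ, φ k = φ 0 + e * k := by
    intro k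
    induction k with
    | zero => simp
    | succ k ih =>
      push_cast
      rw [hshift, ih]
      ring
  have hswap' : ∀ k < 2 * n + 10, swapPerm n' (φ 0 + e * k) = φ 0 + e * swapNat k := by
    intro k hk
    rw [← hφ, ← hswap, swapPerm_natCast hk, hφ]
  have h1 := hswap' 1 (by omega)
  have h0 := hswap' 0 (by omega)
  simp only [swapNat, Nat.cast_one, Nat.cast_zero, Nat.cast_ofNat, mul_one, mul_zero,
    add_zero] at h0 h1
  rcases eq_of_swapPerm_eq (x := φ 0 + e) he (by rw [h1]; ring) with ⟨hx, rfl⟩ | ⟨hx, rfl⟩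
  · have hc : φ 0 = 0 := by linear_combination hx
    simp only [hc, zero_add, one_mul] at hφ hswap'
    refine ⟨rfl, ?_, hφ⟩
    have hdvd : 2 * n' + 10 ∣ 2 * n + 10 := by
      rw [← ZMod.natCast_eq_zero_iff, ← hφ, ZMod.natCast_self, hc]
    by_contra hne
    have hlt : 2 * n' + 11 < 2 * n + 10 := by
      have := Nat.le_of_dvd (by omega) hdvd
      omega
    have h2 := hswap' (2 * n' + 11) hlt
    have h3 : ((2 * n' + 11 : ℕ) : ZMod (2 * n' + 10)) = (1 : ℕ) := by
      rw [show 2 * n' + 11 = (2 * n' + 10) + 1 by ring, Nat.cast_add, ZMod.natCast_self, zero_add]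
    have h4 : swapNat (2 * n' + 11) = 2 * n' + 10 := by
      simp [swapNat, show (2 * n' + 5) % 2 = 1 by omega]
    rw [h3, h4, swapPerm_natCast (by omega), ZMod.natCast_self] at h2
    have h5 := natCast_inj_of_lt (N := 2 * n' + 10) (a := 5) (b := 0) (by omega) (by omega)
      (by simpa [swapNat] using h2)
    omega
  · exfalso
    have hc : φ 0 = (6 : ℕ) := by push_cast; linear_combination hx
    rw [hc, swapPerm_natCast (by omega)] at h0
    have h5 := natCast_inj_of_lt (N := 2 * n' + 10) (a := 7) (b := 4) (by omega) (by omega)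
      (by simp only [swapNat] at h0; push_cast at h0 ⊢; simp at h0; rw [h0]; ring)
    omega

theorem not_intertwining_exchange {n n' : ℕ} {φ : ZMod (2 * n + 10) → ZMod (2 * n' + 10)}
    (hshift : ∀ i, φ (i + 1) = swapPerm n' (φ i))
    (hswap : ∀ i, φ (swapPerm n i) = φ i + 1 ∨ φ i = φ (swapPerm n i) + 1) : False := by
  have h2 : φ 2 = φ 0 := by
    have h0 := hshift 0
    have h1 := hshift 1
    rw [one_add_one_eq_two] at h1
    rw [h1, ← zero_add (1 : ZMod (2 * n + 10)), h0, swapPerm_swapPerm]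
  have h3 := hswap 0
  have h4 : swapPerm n 0 = 2 := by
    have := swapPerm_natCast (n := n) (k := 0) (by omega)
    simpa [swapNat] using this
  rw [h4, h2, or_self] at h3
  have h5 := natCast_inj_of_lt (N := 2 * n' + 10) (a := 1) (b := 0) (by omega) (by omega)
    (by push_cast; linear_combination -h3)
  omega

theorem two_ne_zero_of_ten_le {N : ℕ} (hN : 10 ≤ N) : (2 : ZMod N) ≠ 0 := fun h => by
  have := natCast_inj_of_lt (N := N) (a := 2) (b := 0) (by omega) (by omega) (by exact_mod_cast h)
  omega

/-- The permutation voltage lift of `stepGraph m D` in which the edge `{0, m + 1}` carries the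
rotation, the edge `{2, m + 3}` carries `swapPerm n`, and all other edges carry the identity. -/
def liftGraph (m D n : ℕ) : SimpleGraph (ZMod (m * D + 2) × ZMod (2 * n + 10)) where
  Adj u v := (stepGraph m D).Adj u.1 v.1 ∧ (¬ IsCut m D u.1 v.1 → v.2 = u.2) ∧
    (u.1 = 0 → v.1 = m + 1 → v.2 = u.2 + 1) ∧ (u.1 = m + 1 → v.1 = 0 → u.2 = v.2 + 1) ∧
    (u.1 = 2 → v.1 = m + 3 → v.2 = swapPerm n u.2) ∧
    (u.1 = m + 3 → v.1 = 2 → u.2 = swapPerm n v.2)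
  symm := ⟨fun _ _ ⟨h, h', h1, h2, h3, h4⟩ =>
    ⟨h.symm, fun hc => (h' fun hc' => hc hc'.symm).symm, fun a b => h2 b a, fun a b => h1 b a,
      fun a b => h4 b a, fun a b => h3 b a⟩⟩
  loopless := ⟨fun _ h => h.1.ne rfl⟩

theorem liftGraph_adj_of_cutGraph_adj {n : ℕ} {x y : ZMod (m * D + 2)} (h : (cutGraph m D).Adj x y)
    (i : ZMod (2 * n + 10)) : (liftGraph m D n).Adj (x, i) (y, i) :=
  ⟨h.1, fun _ => rfl, fun a b => absurd (Or.inl ⟨a, b⟩) h.2,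
    fun a b => absurd (Or.inr (Or.inl ⟨a, b⟩)) h.2,
    fun a b => absurd (Or.inr (Or.inr (Or.inl ⟨a, b⟩))) h.2,
    fun a b => absurd (Or.inr (Or.inr (Or.inr ⟨a, b⟩))) h.2⟩

/-- The four ends of the edges of `IsCut` are distinct. -/
theorem ports_ne (hm : 5 ≤ m) (hD : 2 ≤ D) :
    (0 : ZMod (m * D + 2)) ≠ 2 ∧ (0 : ZMod (m * D + 2)) ≠ m + 1 ∧ (0 : ZMod (m * D + 2)) ≠ m + 3 ∧
    (2 : ZMod (m * D + 2)) ≠ m + 1 ∧ (2 : ZMod (m * D + 2)) ≠ m + 3 ∧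
    (m + 1 : ZMod (m * D + 2)) ≠ m + 3 := by
  have hp := modulus_le (m := m) hD
  have key : ∀ a b : ℕ, a < b → b < 2 * m + 2 → (a : ZMod (m * D + 2)) ≠ b :=
    fun a b hab hb h => hab.ne (natCast_inj_of_lt (by omega) (by omega) h)
  have h1 := key 0 2 (by omega) (by omega)
  have h2 := key 0 (m + 1) (by omega) (by omega)
  have h3 := key 0 (m + 3) (by omega) (by omega)
  have h4 := key 2 (m + 1) (by omega) (by omega)
  have h5 := key 2 (m + 3) (by omega) (by omega)
  have h6 := key (m + 1) (m + 3) (by omega) (by omega)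
  push_cast at h1 h2 h3 h4 h5 h6
  exact ⟨h1, h2, h3, h4, h5, h6⟩

theorem liftGraph_adj_rotation (hm : 5 ≤ m) (hD : 2 ≤ D) {n : ℕ} (i : ZMod (2 * n + 10)) :
    (liftGraph m D n).Adj (0, i) (m + 1, i + 1) := by
  obtain ⟨h1, h2, h3, -⟩ := ports_ne hm hD
  have hc : IsCut m D 0 (m + 1) := Or.inl ⟨rfl, rfl⟩
  exact ⟨hc.adj (by omega), fun h => absurd hc h, fun _ _ => rfl, fun h => absurd h h2,
    fun h => absurd h h1, fun h => absurd h h3⟩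

theorem liftGraph_adj_swap (hm : 5 ≤ m) (hD : 2 ≤ D) {n : ℕ} (i : ZMod (2 * n + 10)) :
    (liftGraph m D n).Adj (2, i) (m + 3, swapPerm n i) := by
  obtain ⟨h1, -, -, h4, h5, -⟩ := ports_ne hm hD
  have hc : IsCut m D 2 (m + 3) := Or.inr (Or.inr (Or.inl ⟨rfl, rfl⟩))
  exact ⟨hc.adj (by omega), fun h => absurd hc h, fun h => absurd h.symm h1,
    fun h => absurd h h4, fun _ _ => rfl, fun h => absurd h h5⟩

theorem exists_liftGraph_adj (hm : 5 ≤ m) (hD : 2 ≤ D) {n : ℕ} {x y : ZMod (m * D + 2)}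
    (h : (stepGraph m D).Adj x y) (i : ZMod (2 * n + 10)) :
    ∃ j, (liftGraph m D n).Adj (x, i) (y, j) := by
  by_cases hc : IsCut m D x y
  · rcases hc with ⟨rfl, rfl⟩ | ⟨rfl, rfl⟩ | ⟨rfl, rfl⟩ | ⟨rfl, rfl⟩
    · exact ⟨_, liftGraph_adj_rotation hm hD i⟩
    · exact ⟨i - 1, by
        have := (liftGraph_adj_rotation (n := n) hm hD (i - 1)).symm
        rwa [sub_add_cancel] at this⟩
    · exact ⟨_, liftGraph_adj_swap hm hD i⟩
    · exact ⟨swapPerm n i, by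
        have := (liftGraph_adj_swap (n := n) hm hD (swapPerm n i)).symm
        rwa [swapPerm_swapPerm] at this⟩
  · exact ⟨i, liftGraph_adj_of_cutGraph_adj ⟨h, hc⟩ i⟩

theorem liftGraph_adj_unique {n : ℕ} {u v w : ZMod (m * D + 2) × ZMod (2 * n + 10)}
    (hv : (liftGraph m D n).Adj u v) (hw : (liftGraph m D n).Adj u w) (h : v.1 = w.1) : v = w := by
  refine Prod.ext h ?_
  obtain ⟨-, hv, hv1, hv2, hv3, hv4⟩ := hv
  obtain ⟨-, hw, hw1, hw2, hw3, hw4⟩ := hw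
  rw [← h] at hw hw1 hw2 hw3 hw4
  by_cases hc : IsCut m D u.1 v.1
  · rcases hc with ⟨a, b⟩ | ⟨a, b⟩ | ⟨a, b⟩ | ⟨a, b⟩
    · rw [hv1 a b, hw1 a b]
    · exact add_right_cancel ((hv2 a b).symm.trans (hw2 a b))
    · rw [hv3 a b, hw3 a b]
    · exact (swapPerm n).injective ((hv4 a b).symm.trans (hw4 a b))
  · rw [hv hc, hw hc]

theorem snd_ne_of_isCut {n : ℕ} {u v : ZMod (m * D + 2) × ZMod (2 * n + 10)}
    (h : (liftGraph m D n).Adj u v) (hc : IsCut m D u.1 v.1) : v.2 ≠ u.2 := by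
  obtain ⟨-, -, h1, h2, h3, h4⟩ := h
  have hone : (1 : ZMod (2 * n + 10)) ≠ 0 := fun h =>
    two_ne_zero_of_ten_le (N := 2 * n + 10) (by omega) (by linear_combination 2 * h)
  intro he
  rcases hc with ⟨a, b⟩ | ⟨a, b⟩ | ⟨a, b⟩ | ⟨a, b⟩
  · exact hone (by linear_combination he - h1 a b)
  · exact hone (by linear_combination -he - h2 a b)
  · exact swapPerm_ne n _ ((h3 a b).symm.trans he)
  · exact swapPerm_ne n _ ((h4 a b).symm.trans he.symm)

theorem ncard_neighborSet_liftGraph (hm : 5 ≤ m) (hD : 2 ≤ D) {n : ℕ}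
    (u : ZMod (m * D + 2) × ZMod (2 * n + 10)) :
    ((liftGraph m D n).neighborSet u).ncard = D + 1 := by
  have himage : Prod.fst '' (liftGraph m D n).neighborSet u = (stepGraph m D).neighborSet u.1 := by
    ext y
    constructor
    · rintro ⟨v, hv, rfl⟩
      exact hv.1
    · intro hy
      obtain ⟨j, hj⟩ := exists_liftGraph_adj (n := n) hm hD hy u.2
      exact ⟨(y, j), hj, rfl⟩
  rw [← ncard_neighborSet (by omega) u.1, ← himage, Set.InjOn.ncard_image]
  exact fun v hv w hw h => liftGraph_adj_unique hv hw h

theorem le_length_of_odd_liftGraph (hodd : Odd m) {n : ℕ}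
    {u : ZMod (m * D + 2) × ZMod (2 * n + 10)} (w : (liftGraph m D n).Walk u u)
    (hw : Odd w.length) : m + 2 ≤ w.length := by
  let π : liftGraph m D n →g stepGraph m D := ⟨Prod.fst, fun h => h.1⟩
  have := lt_length_of_odd (w.map π) (by simpa using hw)
  rw [Walk.length_map] at this
  obtain ⟨a, rfl⟩ := hodd
  obtain ⟨b, hb⟩ := hw
  omega

theorem exists_isCycle_liftGraph (hm : 5 ≤ m) (hD : 2 ≤ D) (n : ℕ) :
    ∃ (u : _) (w : (liftGraph m D n).Walk u u), w.IsCycle ∧ w.length = m + 2 := by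
  have hp := modulus_le (m := m) hD
  rw [← cycleGraph_isContained_iff (by omega)]
  have hstep : ∀ a b : Fin (m + 2), (a - b).val = 1 →
      (liftGraph m D n).Adj (1 + (a.val : ZMod (m * D + 2)), 0) (1 + b.val, 0) := by
    intro a b h
    apply liftGraph_adj_of_cutGraph_adj
    rw [Fin.sub_def] at h
    simp only at h
    have ha := a.isLt
    have hb := b.isLt
    rcases Nat.lt_or_ge a.val b.val with hlt | hle
    · rw [Nat.mod_eq_of_lt (by omega)] at h
      have hb' : b.val = m + 1 := by omega
      have ha' : a.val = 0 := by omega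
      rw [ha', hb']
      have hadj := adj_add_chord (m := m) (D := D) (by omega) 1
      have hne : ∀ n : ℕ, 0 < n → n < 2 * m + 2 → (n : ZMod (m * D + 2)) ≠ 0 :=
        fun n h0 h => natCast_ne_zero h0 (by omega)
      have h1 := hne 1 (by omega) (by omega)
      have hm0 := hne m (by omega) (by omega)
      have hm2 := hne (m + 2) (by omega) (by omega)
      push_cast at h1 hm2 ⊢
      refine ⟨by simpa using hadj, ?_⟩
      rintro (⟨h, -⟩ | ⟨h, -⟩ | ⟨h, -⟩ | ⟨h, -⟩)
      · exact h1 (by linear_combination h)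
      · exact hm0 (by linear_combination -h)
      · exact h1 (by linear_combination -h)
      · exact hm2 (by linear_combination -h)
    · have hab : a.val = b.val + 1 := by
        rw [show m + 2 - b.val + a.val = (a.val - b.val) + (m + 2) by omega, Nat.add_mod_right,
          Nat.mod_eq_of_lt (by omega)] at h
        omega
      rw [hab]
      have := (cutGraph_adj_add_one hm hD (1 + b.val : ZMod (m * D + 2))).symm
      push_cast
      rwa [← add_assoc]
  refine ⟨⟨⟨fun a => (1 + a.val, 0), fun {a b} h => ?_⟩, fun a b h => ?_⟩⟩
  · rcases cycleGraph_adj'.1 h with h | h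
    · exact hstep a b h
    · exact (hstep b a h).symm
  · have h' := add_left_cancel (congrArg Prod.fst h)
    have ha := a.isLt
    have hb := b.isLt
    exact Fin.ext (natCast_inj_of_lt (by omega) (by omega) h')

theorem IsCut.right_unique (hm : 5 ≤ m) (hD : 2 ≤ D) {x y z : ZMod (m * D + 2)}
    (hy : IsCut m D x y) (hz : IsCut m D x z) : y = z := by
  obtain ⟨h1, h2, h3, h4, h5, h6⟩ := ports_ne (m := m) (D := D) hm hD
  rcases hy with ⟨rfl, rfl⟩ | ⟨rfl, rfl⟩ | ⟨rfl, rfl⟩ | ⟨rfl, rfl⟩ <;>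
    rcases hz with ⟨h, rfl⟩ | ⟨h, rfl⟩ | ⟨h, rfl⟩ | ⟨h, rfl⟩ <;>
    first
    | rfl
    | exact absurd h ‹_›
    | exact absurd h.symm ‹_›

theorem isCut_of_adj (hm : 5 ≤ m) (hD : 2 ≤ D) {x x' y y' : ZMod (m * D + 2)}
    (hx : IsCut m D x x') (hy : IsCut m D y y') (h : (stepGraph m D).Adj x y) :
    IsCut m D x y := by
  have hp := modulus_le (m := m) hD
  have key : ∀ (a : ZMod (m * D + 2)) (k : ℕ), k < 2 * m → k % m ≠ 1 →
      ¬ (stepGraph m D).Adj a (a + k) := fun a k hk hne hadj =>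
    hne ((adj_add_natCast_iff (by omega) a (by omega)).1 hadj)
  have h02 : ¬ (stepGraph m D).Adj 0 2 := by
    simpa using key 0 2 (by omega) (by rw [Nat.mod_eq_of_lt (by omega)]; omega)
  have h03 : ¬ (stepGraph m D).Adj 0 (m + 3) := by
    simpa using key 0 (m + 3) (by omega)
      (by rw [Nat.add_mod_left, Nat.mod_eq_of_lt (by omega)]; omega)
  have h21 : ¬ (stepGraph m D).Adj 2 (m + 1) := by
    have := key 2 (m - 1) (by omega) (by rw [Nat.mod_eq_of_lt (by omega)]; omega)
    rwa [Nat.cast_sub (by omega), Nat.cast_one,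
      show (2 : ZMod (m * D + 2)) + (m - 1) = m + 1 by ring] at this
  have h13 : ¬ (stepGraph m D).Adj (m + 1) (m + 3) := by
    have := key (m + 1) 2 (by omega) (by rw [Nat.mod_eq_of_lt (by omega)]; omega)
    rwa [Nat.cast_ofNat, show (m : ZMod (m * D + 2)) + 1 + 2 = m + 3 by ring] at this
  rcases hx with ⟨rfl, -⟩ | ⟨rfl, -⟩ | ⟨rfl, -⟩ | ⟨rfl, -⟩ <;>
    rcases hy with ⟨rfl, -⟩ | ⟨rfl, -⟩ | ⟨rfl, -⟩ | ⟨rfl, -⟩ <;>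
    first
    | exact absurd rfl h.ne
    | exact absurd h h02
    | exact absurd h h03
    | exact absurd h h21
    | exact absurd h h13
    | exact absurd h.symm h02
    | exact absurd h.symm h03
    | exact absurd h.symm h21
    | exact absurd h.symm h13
    | simp [IsCut]

theorem affine_cases (hm : 5 ≤ m) (hD : 2 ≤ D) {c e y z : ZMod (m * D + 2)} (he : e = 1 ∨ e = -1)
    (hy : IsCut m D c y) (hz : IsCut m D (c + e * 2) z) :
    (c = 0 ∧ e = 1) ∨ (c = m + 1 ∧ e = 1) ∨ (c = 2 ∧ e = -1) ∨ (c = m + 3 ∧ e = -1) := by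
  have hp := modulus_le (m := m) hD
  have hne : ∀ n : ℕ, 0 < n → n < 2 * m + 2 → (n : ZMod (m * D + 2)) ≠ 0 :=
    fun n h0 h => natCast_ne_zero h0 (by omega)
  have h2 := hne 2 (by omega) (by omega)
  have h4 := hne 4 (by omega) (by omega)
  have h5 := hne (m - 1) (by omega) (by omega)
  have h6 := hne (m - 3) (by omega) (by omega)
  have h7 := hne (m + 3) (by omega) (by omega)
  have h8 := hne (m + 5) (by omega) (by omega)
  rw [Nat.cast_sub (by omega)] at h5 h6
  push_cast at h2 h4 h5 h6 h7 h8
  rcases hy with ⟨rfl, -⟩ | ⟨rfl, -⟩ | ⟨rfl, -⟩ | ⟨rfl, -⟩ <;> rcases he with rfl | rfl <;>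
    first
    | exact Or.inl ⟨rfl, rfl⟩
    | exact Or.inr (Or.inl ⟨rfl, rfl⟩)
    | exact Or.inr (Or.inr (Or.inl ⟨rfl, rfl⟩))
    | exact Or.inr (Or.inr (Or.inr ⟨rfl, rfl⟩))
    | skip
  all_goals exfalso; rcases hz with ⟨h, -⟩ | ⟨h, -⟩ | ⟨h, -⟩ | ⟨h, -⟩
  · exact h2 (by linear_combination -h)
  · exact h7 (by linear_combination -h)
  · exact h4 (by linear_combination -h)
  · exact h8 (by linear_combination -h)
  · exact h5 (by linear_combination h)
  · exact h2 (by linear_combination -h)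
  · exact h6 (by linear_combination h)
  · exact h4 (by linear_combination -h)
  · exact h4 (by linear_combination h)
  · exact h6 (by linear_combination -h)
  · exact h2 (by linear_combination h)
  · exact h5 (by linear_combination -h)
  · exact h8 (by linear_combination h)
  · exact h4 (by linear_combination h)
  · exact h7 (by linear_combination h)
  · exact h2 (by linear_combination h)

theorem adj_of_adj_affine {c e x y : ZMod (m * D + 2)} (he : e = 1 ∨ e = -1)
    (h : (stepGraph m D).Adj (c + e * x) (c + e * y)) : (stepGraph m D).Adj x y := by
  rcases he with rfl | rfl
  · obtain ⟨j, hj, h⟩ := h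
    exact ⟨j, hj, by linear_combination h⟩
  · obtain ⟨j, hj, h⟩ := h.symm
    exact ⟨j, hj, by linear_combination h⟩

/-- An affine map reflecting the two edges of `IsCut` permutes them. -/
theorem IsCut.affine (hD : 2 ≤ D) {c e : ZMod (m * D + 2)} (he : e = 1 ∨ e = -1)
    (h : ∀ x y, (stepGraph m D).Adj x y → IsCut m D (c + e * x) (c + e * y) → IsCut m D x y)
    {x y : ZMod (m * D + 2)} (hxy : IsCut m D x y) : IsCut m D (c + e * x) (c + e * y) := by
  have hee : e * e = 1 := by rcases he with rfl | rfl <;> ring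
  let g : ZMod (m * D + 2) × ZMod (m * D + 2) → ZMod (m * D + 2) × ZMod (m * D + 2) :=
    fun q => (c + e * q.1, c + e * q.2)
  let S : Set (ZMod (m * D + 2) × ZMod (m * D + 2)) := {q | IsCut m D q.1 q.2}
  have hsub : S ⊆ g '' S := by
    intro q hq
    have h1 : ∀ z, c + e * (e * (z - c)) = z := fun z => by linear_combination (z - c) * hee
    have hq' : IsCut m D (c + e * (e * (q.1 - c))) (c + e * (e * (q.2 - c))) := by
      rwa [h1, h1]
    exact ⟨(e * (q.1 - c), e * (q.2 - c)),
      h _ _ (adj_of_adj_affine he (hq'.adj (by omega))) hq', Prod.ext (h1 _) (h1 _)⟩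
  have hS : S = g '' S :=
    Set.eq_of_subset_of_ncard_le hsub (Set.ncard_image_le S.toFinite) (Set.toFinite _)
  have hmem : g (x, y) ∈ S := hS ▸ Set.mem_image_of_mem g hxy
  exact hmem

theorem exists_affine_liftGraph (hm : 5 ≤ m) (hodd : Odd m) (hD : 2 ≤ D) {n n' : ℕ}
    (f : liftGraph m D n →g liftGraph m D n') (i : ZMod (2 * n + 10)) :
    ∃ e, (e = 1 ∨ e = -1) ∧ (∀ x, f (x, i) = ((f (0, i)).1 + e * x, (f (0, i)).2)) ∧
      ∀ x y, IsCut m D x y → IsCut m D ((f (0, i)).1 + e * x) ((f (0, i)).1 + e * y) := by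
  have hlift : ∀ {x y}, (cutGraph m D).Adj x y → (liftGraph m D n').Adj (f (x, i)) (f (y, i)) :=
    fun h => f.map_adj (liftGraph_adj_of_cutGraph_adj h i)
  obtain ⟨c, e, he, hf⟩ := exists_affine hm hodd hD ⟨fun x => (f (x, i)).1, fun h => (hlift h).1⟩
  replace hf : ∀ x, (f (x, i)).1 = c + e * x := hf
  have hc : (f (0, i)).1 = c := by simpa using hf 0
  have hrim : ∀ z, ¬ IsCut m D (c + e * z) (c + e * (z + 1)) := by
    intro z
    rcases he with rfl | rfl
    · rw [show c + 1 * (z + 1) = c + 1 * z + 1 by ring]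
      exact not_isCut_add_one hm hD _
    · rw [show c + -1 * z = c + -1 * (z + 1) + 1 by ring]
      exact fun h => not_isCut_add_one hm hD _ h.symm
  have hsheet : ∀ k : ℕ, (f ((k : ZMod (m * D + 2)), i)).2 = (f (0, i)).2 := by
    intro k
    induction k with
    | zero => simp
    | succ k ih =>
      rw [← ih, Nat.cast_add, Nat.cast_one]
      refine (hlift (cutGraph_adj_add_one hm hD _)).2.1 ?_
      rw [hf, hf]
      exact hrim _
  have hsheet' : ∀ x, (f (x, i)).2 = (f (0, i)).2 := fun x => by
    simpa using hsheet x.val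
  rw [hc]
  refine ⟨e, he, fun x => Prod.ext (hf x) (hsheet' x), fun x y hxy => ?_⟩
  refine hxy.affine hD he fun x y hadj hcut => ?_
  by_contra hne
  refine snd_ne_of_isCut (hlift ⟨hadj, hne⟩) ?_ ((hsheet' y).trans (hsheet' x).symm)
  rwa [hf, hf]

theorem liftGraph_rigid (hm : 5 ≤ m) (hodd : Odd m) (hD : 2 ≤ D) {n n' : ℕ}
    (f : liftGraph m D n →g liftGraph m D n') :
    n = n' ∧ ∀ x (k : ℕ), f (x, k) = (x, (k : ZMod (2 * n' + 10))) := by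
  choose e he hf hcut using exists_affine_liftGraph hm hodd hD f
  have hcut1 : IsCut m D 0 (m + 1) := Or.inl ⟨rfl, rfl⟩
  have hcut2 : IsCut m D 2 (m + 3) := Or.inr (Or.inr (Or.inl ⟨rfl, rfl⟩))
  have hrot : ∀ i, (liftGraph m D n').Adj (f (0, i)) (f (m + 1, i + 1)) :=
    fun i => f.map_adj (liftGraph_adj_rotation hm hD i)
  have hswap : ∀ i, (liftGraph m D n').Adj (f (2, i)) (f (m + 3, swapPerm n i)) :=
    fun i => f.map_adj (liftGraph_adj_swap hm hD i)
  have hzero : ∀ i, IsCut m D (f (0, i)).1 ((f (0, i)).1 + e i * (m + 1)) := fun i => by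
    simpa using hcut i _ _ hcut1
  have hcases := fun i => affine_cases hm hD (he i) (hzero i) (hcut i _ _ hcut2)
  have hsucc : ∀ i, (f (0, i + 1)).1 = (f (0, i)).1 := by
    intro i
    have hadj := (hrot i).1
    have h1 := (hzero (i + 1)).symm
    rw [hf (i + 1)] at hadj
    have h2 := isCut_of_adj hm hD (hzero i) h1 hadj
    exact h1.right_unique hm hD h2.symm
  have hconst : ∀ i, (f (0, i)).1 = (f (0, 0)).1 := by
    have : ∀ k : ℕ, (f (0, (k : ZMod (2 * n + 10)))).1 = (f (0, 0)).1 := by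
      intro k
      induction k with
      | zero => simp
      | succ k ih => rw [Nat.cast_add, Nat.cast_one, hsucc, ih]
    intro i
    simpa using this i.val
  obtain ⟨h02, h01, h03, h21, h23, h13⟩ := ports_ne (m := m) (D := D) hm hD
  have heconst : ∀ i, e i = e 0 := by
    intro i
    have h1 := hcases i
    have h2 := hcases 0
    rw [hconst] at h1
    rcases h1 with ⟨h, h'⟩ | ⟨h, h'⟩ | ⟨h, h'⟩ | ⟨h, h'⟩ <;>
      rcases h2 with ⟨k, k'⟩ | ⟨k, k'⟩ | ⟨k, k'⟩ | ⟨k, k'⟩ <;>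
      first
      | exact h'.trans k'.symm
      | exact absurd (h.symm.trans k) ‹_›
      | exact absurd (k.symm.trans h) ‹_›
  have hφ : ∀ x i, f (x, i) = ((f (0, 0)).1 + e 0 * x, (f (0, i)).2) := fun x i => by
    rw [hf, hconst, heconst]
  set c := (f (0, 0)).1 with hc
  let φ := fun i => (f (0, i)).2
  replace hφ : ∀ x i, f (x, i) = (c + e 0 * x, φ i) := hφ
  have hlink1 : IsCut m D c (c + e 0 * (m + 1)) := hzero 0
  have hlink2 : IsCut m D (c + e 0 * 2) (c + e 0 * (m + 3)) := hcut 0 _ _ hcut2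
  simp only [hφ, mul_zero, add_zero] at hrot hswap
  rcases hcases 0 with ⟨h, h'⟩ | ⟨h, h'⟩ | ⟨h, h'⟩ | ⟨h, h'⟩ <;>
    rw [← hc] at h <;> rw [h, h'] at hlink1 hlink2 hrot hswap hφ
  · have := eq_of_intertwining (φ := φ) (e := 1) (Or.inl rfl)
      (fun i => (hrot i).2.2.1 rfl (by ring))
      (fun i => (hswap i).2.2.2.2.1 (by ring) (by ring))
    refine ⟨this.2.1, fun x k => ?_⟩
    rw [hφ, this.2.2]
    simp
  · exfalso
    have h1 := hlink1.right_unique hm hD hcut1.symm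
    have h2 : (m + 1 + 1 * (m + 3) : ZMod (m * D + 2)) = 2 := by linear_combination h1
    have := eq_of_intertwining (φ := φ) (e := -1) (Or.inr rfl)
      (fun i => by linear_combination -(hrot i).2.2.2.1 rfl h1)
      (fun i => (swapPerm_swapPerm n' _).symm.trans
        (congrArg _ ((hswap i).2.2.2.2.2 (by ring) h2).symm))
    exact two_ne_zero_of_ten_le (N := 2 * n' + 10) (by omega) (by linear_combination -this.1)
  · exfalso
    have h1 := hlink1.right_unique hm hD hcut2
    have h2 : (2 + -1 * (m + 3) : ZMod (m * D + 2)) = m + 1 := by linear_combination h1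
    exact not_intertwining_exchange (φ := φ) (fun i => (hrot i).2.2.2.2.1 rfl h1)
      fun i => Or.inl ((hswap i).2.2.1 (by ring) h2)
  · exfalso
    have h1 : (m + 3 + -1 * (m + 1) : ZMod (m * D + 2)) = 2 := by ring
    exact not_intertwining_exchange (φ := φ)
      (fun i => (swapPerm_swapPerm n' _).symm.trans
        (congrArg _ ((hrot i).2.2.2.2.2 rfl h1).symm))
      fun i => Or.inr ((hswap i).2.2.2.1 (by ring) (by ring))

theorem liftGraph_hom_apply (hm : 5 ≤ m) (hodd : Odd m) (hD : 2 ≤ D) {n : ℕ}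
    (f : liftGraph m D n →g liftGraph m D n) (v : ZMod (m * D + 2) × ZMod (2 * n + 10)) :
    f v = v := by
  simpa using (liftGraph_rigid hm hodd hD f).2 v.1 v.2.val

end RigidRegular

/-- For every `d ≥ 3` and odd `g ≥ 7` there exist infinitely many (here: of strictly
increasing orders, hence pairwise non-isomorphic) mutually rigid `d`-regular graphs of
odd girth `g`: each is rigid and there are no homomorphisms between distinct members. -/
theorem infinitely_many_mutually_rigid_regular (d g : ℕ) (hd : 3 ≤ d) (hg : 7 ≤ g)
    (hodd : Odd g) :
    ∃ (V : ℕ → Type) (inst : ∀ i, Fintype (V i)) (G : ∀ i, SimpleGraph (V i)),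
      (∀ i j, i < j → @Fintype.card (V i) (inst i) < @Fintype.card (V j) (inst j)) ∧
      (∀ i, ∀ f : G i →g G i, ∀ v, f v = v) ∧
      (∀ i v, ((G i).neighborSet v).ncard = d) ∧
      (∀ i, OddGirthEq (G i) g) ∧
      (∀ i j, i ≠ j → IsEmpty (G i →g G j)) := by
  obtain ⟨m, rfl⟩ := Nat.exists_eq_add_of_le' (show 2 ≤ g by omega)
  obtain ⟨D, rfl⟩ := Nat.exists_eq_add_of_le' (show 1 ≤ d by omega)
  have hm : 5 ≤ m := by omega
  have hD : 2 ≤ D := by omega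
  have hodd' : Odd m := by
    rw [Nat.odd_iff] at *
    omega
  refine ⟨fun i => ZMod (m * D + 2) × ZMod (2 * i + 10), fun i => inferInstance,
    fun i => RigidRegular.liftGraph m D i, fun i j hij => ?_,
    fun i f v => RigidRegular.liftGraph_hom_apply hm hodd' hD f v,
    fun i v => RigidRegular.ncard_neighborSet_liftGraph hm hD v,
    fun i => ⟨RigidRegular.exists_isCycle_liftGraph hm hD i,
      fun v w _ hw => RigidRegular.le_length_of_odd_liftGraph hodd' w hw⟩,
    fun i j hij => ⟨fun f => hij (RigidRegular.liftGraph_rigid hm hodd' hD f).1⟩⟩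
  simp only [Fintype.card_prod, ZMod.card]
  exact Nat.mul_lt_mul_of_pos_left (by omega) (by omega)
end

section
/- For every finite monoid M and every odd integer g ≥ 7, there exists a regular finite simple graph G of odd girth g whose endomorphism monoid is isomorphic to M. -/
namespace RegularEnd

section Theta

/-- The starting points of the chords added to a cycle of length `3 * g - 2`. -/
def Anchor (g : ℕ) (u : ZMod (3 * g - 2)) : Prop :=
  ∃ i : ℕ, (i = 0 ∨ i = g - 2 ∨ i = 2 * g - 4 ∨ i = 3 * g - 7 ∨ i = 3 * g - 4) ∧ u = i

/-- A cycle of length `3 * g - 2` with five chords, each closing a cycle of length `g`. -/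
def theta (g : ℕ) : SimpleGraph (ZMod (3 * g - 2)) :=
  SimpleGraph.fromRel fun u v => v = u + 1 ∨ (Anchor g u ∧ v = u + (g - 1 : ℕ))

variable {g : ℕ}

lemma natCast_eq_iff {a b : ℕ} (ha : a < 3 * g - 2) (hb : b < 3 * g - 2) :
    (a : ZMod (3 * g - 2)) = b ↔ a = b := by
  rw [ZMod.natCast_eq_natCast_iff']
  rw [Nat.mod_eq_of_lt ha, Nat.mod_eq_of_lt hb]

lemma anchor_natCast (hg : 7 ≤ g) {a : ℕ} (ha : a < 3 * g - 2) :
    Anchor g a ↔ (a = 0 ∨ a = g - 2 ∨ a = 2 * g - 4 ∨ a = 3 * g - 7 ∨ a = 3 * g - 4) := by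
  constructor
  · rintro ⟨i, hi, h⟩
    rw [natCast_eq_iff ha (by omega)] at h
    omega
  · exact fun h => ⟨a, h, rfl⟩

lemma exists_natCast (hg : 7 ≤ g) (u : ZMod (3 * g - 2)) : ∃ a : ℕ, a < 3 * g - 2 ∧ u = a := by
  have : NeZero (3 * g - 2) := ⟨by omega⟩
  exact ⟨u.val, u.val_lt, by simp⟩

lemma intCast_eq_zero_cases (hg : 7 ≤ g) {z : ℤ} (h : (z : ZMod (3 * g - 2)) = 0)
    (h1 : -(9 * g - 6) < z) (h2 : z < 9 * g - 6) :
    z = 0 ∨ z = 3 * g - 2 ∨ z = -(3 * g - 2) ∨ z = 2 * (3 * g - 2) ∨ z = -(2 * (3 * g - 2)) := by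
  rw [ZMod.intCast_zmod_eq_zero_iff_dvd _ (3 * g - 2)] at h
  obtain ⟨k, hk⟩ := h
  have hn : ((3 * g - 2 : ℕ) : ℤ) = 3 * g - 2 := by omega
  rw [hn] at hk
  have hk1 : -3 < k := by by_contra! hc; nlinarith
  have hk2 : k < 3 := by by_contra! hc; nlinarith
  interval_cases k <;> omega

lemma natCast_eq_cases (hg : 7 ≤ g) {a b : ℕ} (h : (a : ZMod (3 * g - 2)) = b)
    (ha : a < 9 * g - 6) (hb : b < 9 * g - 6) :
    a = b ∨ a = b + (3 * g - 2) ∨ b = a + (3 * g - 2) ∨ a = b + 2 * (3 * g - 2) ∨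
      b = a + 2 * (3 * g - 2) := by
  have := intCast_eq_zero_cases hg (z := (a : ℤ) - b) (by push_cast; rw [h, sub_self])
    (by omega) (by omega)
  omega

lemma three_mul_cancel (hg : 7 ≤ g) {x y : ZMod (3 * g - 2)} (h : 3 * x = 3 * y) : x = y := by
  have h0 : ((3 * g - 2 : ℕ) : ZMod (3 * g - 2)) = 0 := ZMod.natCast_self _
  rw [Nat.cast_sub (by omega)] at h0
  push_cast at h0
  linear_combination (1 - (g : ZMod (3 * g - 2))) * h + (x - y) * h0

lemma theta_adj (hg : 7 ≤ g) {u v : ZMod (3 * g - 2)} :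
    (theta g).Adj u v ↔ v = u + 1 ∨ u = v + 1 ∨ (Anchor g u ∧ v = u + (g - 1 : ℕ)) ∨
      (Anchor g v ∧ u = v + (g - 1 : ℕ)) := by
  have h1 : ((1 : ℕ) : ZMod (3 * g - 2)) ≠ (0 : ℕ) := by
    rw [Ne, natCast_eq_iff] <;> omega
  have h2 : ((g - 1 : ℕ) : ZMod (3 * g - 2)) ≠ (0 : ℕ) := by
    rw [Ne, natCast_eq_iff] <;> omega
  simp only [Nat.cast_one, Nat.cast_zero] at h1 h2
  rw [theta, SimpleGraph.fromRel_adj]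
  constructor
  · tauto
  · intro h
    refine ⟨?_, by tauto⟩
    rintro rfl
    rcases h with h | h | h | h
    · exact h1 (by simpa using h)
    · exact h1 (by simpa using h)
    · exact h2 (by simpa using h.2)
    · exact h2 (by simpa using h.2)

lemma three_mul_chord (hg : 7 ≤ g) : (3 : ZMod (3 * g - 2)) * (g - 1 : ℕ) = -1 := by
  have h0 : ((3 * g - 2 : ℕ) : ZMod (3 * g - 2)) = 0 := ZMod.natCast_self _
  rw [Nat.cast_sub (by omega)] at h0
  push_cast [Nat.cast_sub (show 1 ≤ g by omega)] at h0 ⊢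
  linear_combination h0

lemma theta_adj_label (hg : 7 ≤ g) {u v : ZMod (3 * g - 2)} (h : (theta g).Adj u v) :
    ∃ δ : ℤ, (δ : ZMod (3 * g - 2)) = 3 * (v - u) ∧
      (δ = 1 ∨ δ = -1 ∨ δ = 3 ∨ δ = -3) := by
  have := three_mul_chord hg
  rcases (theta_adj hg).1 h with rfl | rfl | ⟨-, rfl⟩ | ⟨-, rfl⟩
  · exact ⟨3, by push_cast; ring, by simp⟩
  · exact ⟨-3, by push_cast; ring, by simp⟩
  · exact ⟨-1, by push_cast; linear_combination -this, by simp⟩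
  · exact ⟨1, by push_cast; linear_combination this, by simp⟩

end Theta

section Linked

/-- Copies of `Θ` indexed by `C`, whose fibres over `t : T` are joined according to `L t`. -/
def linked {C T : Type*} (Θ : SimpleGraph T) (L : T → SimpleGraph C) : SimpleGraph (C × T) where
  Adj p q := (p.1 = q.1 ∧ Θ.Adj p.2 q.2) ∨ (p.2 = q.2 ∧ (L p.2).Adj p.1 q.1)
  symm := ⟨by
    rintro ⟨c, t⟩ ⟨c', t'⟩ (⟨h, h'⟩ | ⟨h, h'⟩)
    · exact Or.inl ⟨h.symm, h'.symm⟩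
    · simp only at h
      subst h
      exact Or.inr ⟨rfl, h'.symm⟩⟩
  loopless := ⟨by
    rintro ⟨c, t⟩ (⟨-, h⟩ | ⟨-, h⟩)
    · exact h.ne rfl
    · exact h.ne rfl⟩

variable {g : ℕ} {C : Type*} {L : ZMod (3 * g - 2) → SimpleGraph C} {side : C → ℤ}

lemma linked_adj_label (hg : 7 ≤ g) (hL : ∀ t c c', (L t).Adj c c' → (side c' - side c) % 2 = 1)
    {p q : C × ZMod (3 * g - 2)} (h : (linked (theta g) L).Adj p q) :
    ∃ δ : ℤ, (δ : ZMod (3 * g - 2)) = 3 * (q.2 - p.2) ∧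
      ((δ = 0 ∧ (side q.1 - side p.1) % 2 = 1) ∨
        (p.1 = q.1 ∧ (δ = 1 ∨ δ = -1 ∨ δ = 3 ∨ δ = -3))) := by
  rcases h with ⟨h, h'⟩ | ⟨h, h'⟩
  · obtain ⟨δ, h1, h2⟩ := theta_adj_label hg h'
    exact ⟨δ, h1, Or.inr ⟨h, h2⟩⟩
  · exact ⟨0, by simp [h], Or.inl ⟨rfl, hL _ _ _ h'⟩⟩

lemma linked_walk_label (hg : 7 ≤ g) (hL : ∀ t c c', (L t).Adj c c' → (side c' - side c) % 2 = 1)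
    {p q : C × ZMod (3 * g - 2)} (w : (linked (theta g) L).Walk p q) :
    ∃ D : ℤ, (D : ZMod (3 * g - 2)) = 3 * (q.2 - p.2) ∧ -(3 * w.length) ≤ D ∧ D ≤ 3 * w.length ∧
      (D + w.length + side q.1 - side p.1) % 2 = 0 := by
  induction w with
  | nil => exact ⟨0, by simp⟩
  | cons h w ih =>
    obtain ⟨D, h1, h2, h3, h4⟩ := ih
    obtain ⟨δ, h5, h6⟩ := linked_adj_label hg hL h
    refine ⟨δ + D, by push_cast; rw [h1, h5]; ring, ?_⟩
    rw [SimpleGraph.Walk.length_cons]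
    push_cast
    rcases h6 with h6 | ⟨h6, h7⟩
    · omega
    · rw [h6]
      omega

lemma le_length_of_odd_closed_walk (hg : 7 ≤ g)
    (hL : ∀ t c c', (L t).Adj c c' → (side c' - side c) % 2 = 1)
    {p : C × ZMod (3 * g - 2)} (w : (linked (theta g) L).Walk p p) (hw : Odd w.length) :
    g ≤ w.length := by
  obtain ⟨D, h1, h2, h3, h4⟩ := linked_walk_label hg hL w
  by_contra! hc
  obtain ⟨m, hm⟩ := hw
  have := intCast_eq_zero_cases hg (z := D) (by simpa using h1) (by omega) (by omega)
  omega

lemma exists_isCycle_linked (hg : 7 ≤ g) (c : C) :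
    ∃ (v : C × ZMod (3 * g - 2)) (w : (linked (theta g) L).Walk v v),
      w.IsCycle ∧ w.length = g := by
  rw [← SimpleGraph.cycleGraph_isContained_iff (by omega)]
  refine ⟨⟨⟨fun i => (c, (i.val : ZMod (3 * g - 2))), ?_⟩, ?_⟩⟩
  · intro i j hij
    refine Or.inl ⟨rfl, ?_⟩
    rw [theta_adj hg]
    have key : j.val = i.val + 1 ∨ i.val = j.val + 1 ∨ (i.val = 0 ∧ j.val = g - 1) ∨
        (j.val = 0 ∧ i.val = g - 1) := by
      rw [SimpleGraph.cycleGraph_adj'] at hij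
      have hi := i.isLt
      have hj := j.isLt
      rw [Fin.sub_def, Fin.sub_def] at hij
      simp only at hij
      rcases hij with h | h
      · rcases le_or_gt j.val i.val with h' | h'
        · rw [show g - j.val + i.val = i.val - j.val + g by omega, Nat.add_mod_right,
            Nat.mod_eq_of_lt (by omega)] at h
          omega
        · rw [Nat.mod_eq_of_lt (by omega)] at h
          omega
      · rcases le_or_gt i.val j.val with h' | h'
        · rw [show g - i.val + j.val = j.val - i.val + g by omega, Nat.add_mod_right,
            Nat.mod_eq_of_lt (by omega)] at h
          omega
        · rw [Nat.mod_eq_of_lt (by omega)] at h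
          omega
    rcases key with h | h | ⟨h, h'⟩ | ⟨h, h'⟩
    · left; simp [h]
    · right; left; simp [h]
    · right; right; left
      simp only [h, h']
      exact ⟨⟨0, by simp⟩, by simp⟩
    · right; right; right
      simp only [h, h']
      exact ⟨⟨0, by simp⟩, by simp⟩
  · intro i j hij
    have hi := i.isLt
    have hj := j.isLt
    have : (i.val : ZMod (3 * g - 2)) = j.val := congrArg Prod.snd hij
    rw [natCast_eq_iff (by omega) (by omega)] at this
    exact Fin.ext this

end Linked

section HomTheta

variable {g : ℕ} {C : Type*} {L : ZMod (3 * g - 2) → SimpleGraph C} {side : C → ℤ}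

lemma sum_path_label (F : theta g →g linked (theta g) L) {δ : ZMod (3 * g - 2) → ℤ}
    (hδ : ∀ t, (δ t : ZMod (3 * g - 2)) = 3 * ((F (t + 1)).2 - (F t).2))
    (hpar : ∀ t, (δ t + 1 + side (F (t + 1)).1 - side (F t).1) % 2 = 0)
    (s : ZMod (3 * g - 2)) (m : ℕ) :
    ((∑ i ∈ Finset.range m, δ (s + i) : ℤ) : ZMod (3 * g - 2)) =
        3 * ((F (s + m)).2 - (F s).2) ∧
      ((∑ i ∈ Finset.range m, δ (s + i)) + m + side (F (s + m)).1 - side (F s).1) % 2 = 0 := by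
  induction m with
  | zero => simp
  | succ m ih =>
    have e : s + ((m + 1 : ℕ) : ZMod (3 * g - 2)) = s + m + 1 := by push_cast; ring
    rw [Finset.sum_range_succ, e]
    have h1 := hpar (s + m)
    refine ⟨by rw [Int.cast_add, ih.1, hδ]; ring, ?_⟩
    push_cast
    omega

/-- Along the `g`-cycle closed by the chord at an anchor, a homomorphism to a graph of odd girth
`g` runs once around the base, up to a total deficit of `2`. -/
lemma window_label (hg : 7 ≤ g) (hodd : Odd g)
    (hL : ∀ t c c', (L t).Adj c c' → (side c' - side c) % 2 = 1)
    (F : theta g →g linked (theta g) L) {δ : ZMod (3 * g - 2) → ℤ}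
    (hδ : ∀ t, (δ t : ZMod (3 * g - 2)) = 3 * ((F (t + 1)).2 - (F t).2))
    (hpar : ∀ t, (δ t + 1 + side (F (t + 1)).1 - side (F t).1) % 2 = 0)
    (hbd : ∀ t, -3 ≤ δ t ∧ δ t ≤ 3) {s : ZMod (3 * g - 2)} (hs : Anchor g s) :
    ∃ ε : ℤ, (ε = 1 ∨ ε = -1) ∧ (∀ i : ℕ, i < g - 1 → 1 ≤ ε * δ (s + i)) ∧
      ∑ i ∈ Finset.range (g - 1), (3 - ε * δ (s + i)) ≤ 2 := by
  obtain ⟨h1, h2⟩ := sum_path_label F hδ hpar s (g - 1)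
  have hadj : (theta g).Adj (s + (g - 1 : ℕ)) s := (theta_adj hg).2 (by tauto)
  obtain ⟨γ, h3, h4⟩ := linked_adj_label hg hL (F.map_adj hadj)
  set S := ∑ i ∈ Finset.range (g - 1), δ (s + i) with hS
  have h5 : ((S + γ : ℤ) : ZMod (3 * g - 2)) = 0 := by
    push_cast
    rw [h3]
    rw [h1]
    ring
  have hγ : -3 ≤ γ ∧ γ ≤ 3 := by omega
  have hγp : (γ + 1 + side (F s).1 - side (F (s + (g - 1 : ℕ))).1) % 2 = 0 := by
    rcases h4 with h4 | ⟨h4, h4'⟩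
    · omega
    · rw [h4]; omega
  have hub : S ≤ 3 * (g - 1 : ℕ) := by
    have := Finset.sum_le_card_nsmul (Finset.range (g - 1)) (fun i => δ (s + i)) 3
      (fun i _ => (hbd _).2)
    simpa [mul_comm] using this
  have hlb : -(3 * (g - 1 : ℕ)) ≤ S := by
    have := Finset.card_nsmul_le_sum (Finset.range (g - 1)) (fun i => δ (s + i)) (-3)
      (fun i _ => (hbd _).1)
    simpa [mul_comm] using this
  have hcases := intCast_eq_zero_cases hg h5 (by omega) (by omega)
  obtain ⟨k, hk⟩ := hodd
  have key : ∃ ε : ℤ, (ε = 1 ∨ ε = -1) ∧ ε * (S + γ) = 3 * g - 2 := by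
    have : S + γ = 3 * g - 2 ∨ S + γ = -(3 * g - 2) := by omega
    rcases this with h | h
    · exact ⟨1, by simp, by omega⟩
    · exact ⟨-1, by simp, by omega⟩
  obtain ⟨ε, hε, hsum⟩ := key
  have hnn : ∀ i ∈ Finset.range (g - 1), 0 ≤ 3 - ε * δ (s + i) := by
    intro i _
    have := hbd (s + i)
    rcases hε with rfl | rfl <;> omega
  have hle : ∑ i ∈ Finset.range (g - 1), (3 - ε * δ (s + i)) ≤ 2 := by
    rw [Finset.sum_sub_distrib, ← Finset.mul_sum, ← hS, Finset.sum_const, Finset.card_range,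
      nsmul_eq_mul]
    have : ε * γ ≤ 3 := by rcases hε with rfl | rfl <;> omega
    rw [mul_add] at hsum
    omega
  refine ⟨ε, hε, fun i hi => ?_, hle⟩
  have := (Finset.single_le_sum hnn (Finset.mem_range.2 hi)).trans hle
  omega

lemma label_eq_three (hg : 7 ≤ g) (hodd : Odd g)
    (hL : ∀ t c c', (L t).Adj c c' → (side c' - side c) % 2 = 1)
    (F : theta g →g linked (theta g) L) {δ : ZMod (3 * g - 2) → ℤ}
    (hδ : ∀ t, (δ t : ZMod (3 * g - 2)) = 3 * ((F (t + 1)).2 - (F t).2))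
    (hlab : ∀ t, (δ t = 0 ∧ (side (F (t + 1)).1 - side (F t).1) % 2 = 1) ∨
        ((F t).1 = (F (t + 1)).1 ∧ (δ t = 1 ∨ δ t = -1 ∨ δ t = 3 ∨ δ t = -3))) :
    ∃ ε : ℤ, (ε = 1 ∨ ε = -1) ∧ ∀ t, δ t = 3 * ε := by
  have : NeZero (3 * g - 2) := ⟨by omega⟩
  have hpar : ∀ t, (δ t + 1 + side (F (t + 1)).1 - side (F t).1) % 2 = 0 := by
    intro t
    rcases hlab t with h | ⟨h, h'⟩
    · omega
    · rw [h]; omega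
  have hbd : ∀ t, -3 ≤ δ t ∧ δ t ≤ 3 := fun t => by have := hlab t; omega
  have win := fun (b : ℕ)
    (hb : b = 0 ∨ b = g - 2 ∨ b = 2 * g - 4 ∨ b = 3 * g - 7 ∨ b = 3 * g - 4) =>
    window_label hg hodd hL F hδ hpar hbd (s := b) ⟨b, hb, rfl⟩
  obtain ⟨ε, hε, hpos, hsum⟩ := win 0 (by simp)
  obtain ⟨ε₁, hε₁, hpos₁, -⟩ := win (g - 2) (by simp)
  obtain ⟨ε₂, hε₂, hpos₂, -⟩ := win (2 * g - 4) (by simp)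
  obtain ⟨ε₃, hε₃, hpos₃, -⟩ := win (3 * g - 7) (by simp)
  have sgn : ∀ {a b d : ℤ}, (a = 1 ∨ a = -1) → (b = 1 ∨ b = -1) → 1 ≤ a * d → 1 ≤ b * d →
      a = b := by
    rintro a b d (rfl | rfl) (rfl | rfl) h h' <;> omega
  have e₁ : ε = ε₁ := by
    have h := hpos (g - 2) (by omega)
    have h' := hpos₁ 0 (by omega)
    simp only [Nat.cast_zero, zero_add, add_zero] at h h'
    exact sgn hε hε₁ h h'
  have e₂ : ε = ε₂ := by
    have h := hpos₁ (g - 2) (by omega)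
    have h' := hpos₂ 0 (by omega)
    rw [← Nat.cast_add, show g - 2 + (g - 2) = 2 * g - 4 by omega] at h
    simp only [Nat.cast_zero, add_zero] at h'
    rw [e₁]
    exact sgn hε₁ hε₂ h h'
  have e₃ : ε = ε₃ := by
    have h := hpos₂ (g - 3) (by omega)
    have h' := hpos₃ 0 (by omega)
    rw [← Nat.cast_add, show 2 * g - 4 + (g - 3) = 3 * g - 7 by omega] at h
    simp only [Nat.cast_zero, add_zero] at h'
    rw [e₂]
    exact sgn hε₂ hε₃ h h'
  subst e₁ e₂ e₃
  have hall : ∀ t, ε * δ t = 1 ∨ ε * δ t = 3 := by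
    intro t
    obtain ⟨a, ha, rfl⟩ := exists_natCast hg t
    have h1 : 1 ≤ ε * δ a := by
      have shift : ∀ b : ℕ, b ≤ a → (∀ i : ℕ, i < g - 1 →
          1 ≤ ε * δ ((b : ZMod (3 * g - 2)) + i)) → a < b + (g - 1) → 1 ≤ ε * δ a := by
        intro b hb h hab
        have := h (a - b) (by omega)
        rwa [← Nat.cast_add, show b + (a - b) = a by omega] at this
      by_cases h1 : a < g - 1
      · exact shift 0 (by omega) hpos (by omega)
      by_cases h2 : a < 2 * g - 4
      · exact shift (g - 2) (by omega) hpos₁ (by omega)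
      by_cases h3 : a < 3 * g - 7
      · exact shift (2 * g - 4) (by omega) hpos₂ (by omega)
      · exact shift (3 * g - 7) (by omega) hpos₃ (by omega)
    have h2 := hlab a
    rcases hε with rfl | rfl <;> omega
  have hzero : ((∑ t, δ t : ℤ) : ZMod (3 * g - 2)) = 0 := by
    push_cast
    simp only [hδ]
    rw [← Finset.mul_sum, Finset.sum_sub_distrib]
    rw [Fintype.sum_equiv (Equiv.addRight (1 : ZMod (3 * g - 2))) (fun t => (F (t + 1)).2)
      (fun t => (F t).2) (fun t => rfl), sub_self, mul_zero]
  have hdef0 : (((∑ t, (3 - ε * δ t) : ℤ)) : ZMod (3 * g - 2)) = 0 := by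
    rw [Finset.sum_sub_distrib, ← Finset.mul_sum]
    push_cast at hzero ⊢
    rw [hzero]
    simp
  have hnn : ∀ t ∈ Finset.univ, 0 ≤ 3 - ε * δ t := fun t _ => by have := hall t; omega
  have hle2 : ∀ t ∈ Finset.univ, 3 - ε * δ t ≤ 2 := fun t _ => by have := hall t; omega
  have hcard : (Finset.univ : Finset (ZMod (3 * g - 2))).card = 3 * g - 2 := by
    rw [Finset.card_univ, ZMod.card]
  have hub : ∑ t, (3 - ε * δ t) ≤ (3 * g - 2 : ℕ) * 2 := by
    have := Finset.sum_le_card_nsmul _ _ _ hle2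
    rwa [hcard, nsmul_eq_mul] at this
  have hlb := Finset.sum_nonneg hnn
  have heven : (2 : ℤ) ∣ ∑ t, (3 - ε * δ t) :=
    Finset.dvd_sum fun t _ => by have := hall t; omega
  have hs : ∑ t, (3 - ε * δ t) = 0 := by
    have := intCast_eq_zero_cases hg hdef0 (by omega) (by omega)
    obtain ⟨k, hk⟩ := hodd
    by_contra hne
    have htop : ∑ t, (3 - ε * δ t) = ∑ t : ZMod (3 * g - 2), (2 : ℤ) := by
      rw [Finset.sum_const, hcard, nsmul_eq_mul]
      omega
    have h2 := (Finset.sum_eq_sum_iff_of_le hle2).1 htop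
    have : ∑ i ∈ Finset.range (g - 1), (3 - ε * δ (((0 : ℕ) : ZMod (3 * g - 2)) + i)) =
        ∑ i ∈ Finset.range (g - 1), 2 := Finset.sum_congr rfl fun i _ => h2 _ (Finset.mem_univ _)
    rw [this, Finset.sum_const, Finset.card_range, nsmul_eq_mul] at hsum
    omega
  refine ⟨ε, hε, fun t => ?_⟩
  have := (Finset.sum_eq_zero_iff_of_nonneg hnn).1 hs t (Finset.mem_univ _)
  rcases hε with rfl | rfl <;> omega

lemma theta_adj_natCast (hg : 7 ≤ g) {a b : ℕ} (h : (b : ZMod (3 * g - 2)) = a + (g - 1 : ℕ))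
    (hadj : (theta g).Adj a b) : Anchor g a := by
  have aux : ∀ {c d : ℕ}, c < 9 * g - 6 → d < 9 * g - 6 → ((c : ZMod (3 * g - 2)) = d) →
    (c : ℤ) = d ∨ (c : ℤ) = d + (3 * g - 2) ∨ (d : ℤ) = c + (3 * g - 2) ∨
      (c : ℤ) = d + 2 * (3 * g - 2) ∨ (d : ℤ) = c + 2 * (3 * g - 2) := by
    intro c d hc hd h
    have := natCast_eq_cases hg h hc hd
    omega
  rcases (theta_adj hg).1 hadj with h1 | h1 | h1 | h1
  · rw [h] at h1
    have : ((g - 1 : ℕ) : ZMod (3 * g - 2)) = (1 : ℕ) := by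
      push_cast
      exact add_left_cancel h1
    have := aux (by omega) (by omega) this
    omega
  · rw [h] at h1
    have : ((0 : ℕ) : ZMod (3 * g - 2)) = (g - 1 + 1 : ℕ) := by
      push_cast
      exact add_left_cancel (a := (a : ZMod (3 * g - 2))) (by rw [← add_assoc]; simpa using h1)
    have := aux (by omega) (by omega) this
    omega
  · exact h1.1
  · rw [h] at h1
    have : ((0 : ℕ) : ZMod (3 * g - 2)) = (g - 1 + (g - 1) : ℕ) := by
      push_cast
      exact add_left_cancel (a := (a : ZMod (3 * g - 2)))
        (by rw [← add_assoc]; simpa using h1.2)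
    have := aux (by omega) (by omega) this
    omega

/-- The graph `theta g` has a unique homomorphism into each fibre-preserving product with it. -/
lemma hom_theta_linked (hg : 7 ≤ g) (hodd : Odd g)
    (hL : ∀ t c c', (L t).Adj c c' → (side c' - side c) % 2 = 1)
    (F : theta g →g linked (theta g) L) (t : ZMod (3 * g - 2)) : F t = ((F 0).1, t) := by
  have hadj1 : ∀ t, (theta g).Adj t (t + 1) := fun t => (theta_adj hg).2 (by simp)
  choose δ hδ hlab using fun t => linked_adj_label hg hL (F.map_adj (hadj1 t))
  obtain ⟨ε, hε, h3⟩ := label_eq_three hg hodd hL F hδ hlab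
  have hstep : ∀ t, (F (t + 1)).1 = (F t).1 ∧ (F (t + 1)).2 = (F t).2 + ε := by
    intro t
    have h := hδ t
    have h' := hlab t
    have h'' := h3 t
    refine ⟨by rcases h' with h' | h'
               · omega
               · exact h'.1.symm, ?_⟩
    rw [h''] at h
    push_cast at h
    linear_combination -(three_mul_cancel hg h)
  have hF : ∀ a : ℕ, (F a).1 = (F 0).1 ∧ (F a).2 = (F 0).2 + ε * a := by
    intro a
    induction a with
    | zero => simp
    | succ a ih =>
      have := hstep a
      push_cast
      rw [this.1, this.2, ih.1, ih.2]
      exact ⟨rfl, by ring⟩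
  obtain ⟨c₀, hc₀, hc₀'⟩ := exists_natCast hg (F 0).2
  have hchord : ∀ b : ℕ, (b = 0 ∨ b = g - 2 ∨ b = 2 * g - 4 ∨ b = 3 * g - 7 ∨ b = 3 * g - 4) →
      (theta g).Adj ((F 0).2 + ε * b) ((F 0).2 + ε * (b + (g - 1 : ℕ) : ℕ)) := by
    intro b hb
    have hadj : (theta g).Adj (b : ZMod (3 * g - 2)) ((b + (g - 1 : ℕ) : ℕ)) := by
      refine (theta_adj hg).2 (Or.inr (Or.inr (Or.inl ⟨⟨b, hb, rfl⟩, by push_cast; ring⟩)))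
    rcases F.map_adj hadj with h | h
    · rw [(hF _).2, (hF _).2] at h
      exact h.2
    · exact absurd (h.2.ne (by rw [(hF _).1, (hF _).1])) (by simp)
  have hmain : ε = 1 ∧ c₀ = 0 := by
    have anc : ∀ {a : ℕ}, a < 3 * g - 2 → Anchor g a → (a = 0 ∨ a = g - 2 ∨ a = 2 * g - 4 ∨
        a = 3 * g - 7 ∨ a = 3 * g - 4) := fun ha h => (anchor_natCast hg ha).1 h
    have hn : ((3 * g - 2 : ℕ) : ZMod (3 * g - 2)) = 0 := ZMod.natCast_self _
    rcases hε with rfl | rfl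
    · have key : ∀ b : ℕ, (b = 0 ∨ b = g - 2 ∨ b = 2 * g - 4 ∨ b = 3 * g - 7 ∨ b = 3 * g - 4) →
          Anchor g ((c₀ + b : ℕ) : ZMod (3 * g - 2)) := by
        intro b hb
        have := hchord b hb
        rw [hc₀'] at this
        refine theta_adj_natCast (b := c₀ + b + (g - 1)) hg (by push_cast; ring) ?_
        convert this using 1 <;> push_cast <;> ring
      have wrap : ∀ {a : ℕ}, 3 * g - 2 ≤ a → a < 2 * (3 * g - 2) → Anchor g a →
          (a - (3 * g - 2) = 0 ∨ a - (3 * g - 2) = g - 2 ∨ a - (3 * g - 2) = 2 * g - 4 ∨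
        a - (3 * g - 2) = 3 * g - 7 ∨ a - (3 * g - 2) = 3 * g - 4) := by
        intro a h1 h2 h
        refine anc (by omega) ?_
        rwa [Nat.cast_sub h1, hn, sub_zero]
      have k0 := anc (by omega) (key 0 (by simp))
      have k1 := key (g - 2) (by simp)
      have k2 := key (3 * g - 4) (by simp)
      refine ⟨rfl, ?_⟩
      rcases k0 with k0 | k0 | k0 | k0 | k0
      · omega
      · have := wrap (by omega) (by omega) k2
        omega
      · have := anc (by omega) k1
        omega
      · have := wrap (by omega) (by omega) k2
        omega
      · have := wrap (by omega) (by omega) k1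
        omega
    · exfalso
      obtain ⟨c₁, hc₁, hc₁'⟩ := exists_natCast hg ((F 0).2 - (g - 1 : ℕ))
      have key : ∀ b : ℕ, (b = 0 ∨ b = g - 2 ∨ b = 2 * g - 4 ∨ b = 3 * g - 7 ∨ b = 3 * g - 4) →
          Anchor g ((c₁ + (3 * g - 2 - b) : ℕ) : ZMod (3 * g - 2)) := by
        intro b hb
        have := (hchord b hb).symm
        have e : (F 0).2 = c₁ + (g - 1 : ℕ) := by rw [← hc₁']; ring
        rw [e] at this
        refine theta_adj_natCast (b := c₁ + (3 * g - 2 - b) + (g - 1)) hg (by push_cast; ring) ?_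
        convert this using 1
        · rw [Nat.cast_add, Nat.cast_sub (by omega), hn]
          push_cast
          ring
        · rw [Nat.cast_add, Nat.cast_add, Nat.cast_sub (by omega), hn]
          push_cast
          ring
      have wrap : ∀ {a : ℕ}, 3 * g - 2 ≤ a → a < 2 * (3 * g - 2) → Anchor g a →
          (a - (3 * g - 2) = 0 ∨ a - (3 * g - 2) = g - 2 ∨ a - (3 * g - 2) = 2 * g - 4 ∨
        a - (3 * g - 2) = 3 * g - 7 ∨ a - (3 * g - 2) = 3 * g - 4) := by
        intro a h1 h2 h
        refine anc (by omega) ?_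
        rwa [Nat.cast_sub h1, hn, sub_zero]
      have k0 := wrap (by omega) (by omega) (key 0 (by simp))
      have k1 := key (g - 2) (by simp)
      have k2 := key (3 * g - 4) (by simp)
      rcases k0 with k0 | k0 | k0 | k0 | k0
      · have := anc (by omega) k2
        omega
      · have := anc (by omega) k2
        omega
      · have := anc (by omega) k2
        omega
      · have := anc (by omega) k2
        omega
      · have := wrap (by omega) (by omega) k1
        omega
  obtain ⟨a, ha, rfl⟩ := exists_natCast hg t
  have := hF a
  refine Prod.ext this.1 ?_
  rw [this.2, hc₀', hmain.1, hmain.2]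
  simp

/-- Every endomorphism of `linked (theta g) L` acts on the index of the copies only. -/
lemma end_linked (hg : 7 ≤ g) (hodd : Odd g)
    (hL : ∀ t c c', (L t).Adj c c' → (side c' - side c) % 2 = 1)
    (f : linked (theta g) L →g linked (theta g) L) :
    ∃ φ : C → C, (∀ c t, f (c, t) = (φ c, t)) ∧
      ∀ t c c', (L t).Adj c c' → (L t).Adj (φ c) (φ c') := by
  have h : ∀ c t, f (c, t) = ((f (c, 0)).1, t) := by
    intro c t
    let F : theta g →g linked (theta g) L :=
      ⟨fun t => f (c, t), fun {u v} huv => f.map_adj (Or.inl ⟨rfl, huv⟩)⟩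
    exact hom_theta_linked hg hodd hL F t
  refine ⟨fun c => (f (c, 0)).1, h, fun t c c' hcc => ?_⟩
  have hadj : (linked (theta g) L).Adj (c, t) (c', t) := Or.inr ⟨rfl, hcc⟩
  have := f.map_adj hadj
  rw [h, h c'] at this
  rcases this with h' | h'
  · exact absurd h'.2 (SimpleGraph.irrefl _)
  · exact h'.2

end HomTheta

section Degree

lemma ncard_neighborSet_linked {C T : Type*} [Finite C] [Finite T] (Θ : SimpleGraph T)
    (L : T → SimpleGraph C) (c : C) (t : T) :
    ((linked Θ L).neighborSet (c, t)).ncard =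
      (Θ.neighborSet t).ncard + ((L t).neighborSet c).ncard := by
  have h : (linked Θ L).neighborSet (c, t) =
      (fun t' => (c, t')) '' Θ.neighborSet t ∪ (fun c' => (c', t)) '' (L t).neighborSet c := by
    ext ⟨c', t'⟩
    simp only [SimpleGraph.mem_neighborSet, linked, Set.mem_union, Set.mem_image, Prod.mk.injEq]
    constructor
    · rintro (⟨h, h'⟩ | ⟨h, h'⟩)
      · exact Or.inl ⟨t', h', h, rfl⟩
      · exact Or.inr ⟨c', h', rfl, h⟩
    · rintro (⟨t', h', rfl, rfl⟩ | ⟨c', h', rfl, rfl⟩)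
      · exact Or.inl ⟨rfl, h'⟩
      · exact Or.inr ⟨rfl, h'⟩
  rw [h, Set.ncard_union_eq, Set.ncard_image_of_injective, Set.ncard_image_of_injective]
  · exact Prod.mk_left_injective t
  · exact Prod.mk_right_injective c
  · rw [Set.disjoint_left]
    rintro _ ⟨t', h', rfl⟩ ⟨c', h'', h'''⟩
    simp only [Prod.mk.injEq] at h'''
    exact h''.ne h'''.1.symm

/-- The bipartite double graph of a relation. -/
def bip {A : Type*} (ρ : A → A → Prop) : SimpleGraph (A × Bool) where
  Adj p q := (p.2 = false ∧ q.2 = true ∧ ρ p.1 q.1) ∨ (p.2 = true ∧ q.2 = false ∧ ρ q.1 p.1)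
  symm := ⟨fun p q h => by tauto⟩
  loopless := ⟨fun p h => by
    rcases h with ⟨h, h', -⟩ | ⟨h, h', -⟩
    · exact absurd (h.symm.trans h') (by decide)
    · exact absurd (h.symm.trans h') (by decide)⟩

lemma bip_adj_false_true {A : Type*} {ρ : A → A → Prop} {a b : A} :
    (bip ρ).Adj (a, false) (b, true) ↔ ρ a b := by
  simp [bip]

lemma ncard_neighborSet_bip {A : Type*} {ρ : A → A → Prop} {m : ℕ}
    (h₁ : ∀ a, {b | ρ a b}.ncard = m) (h₂ : ∀ a, {b | ρ b a}.ncard = m) (p : A × Bool) :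
    ((bip ρ).neighborSet p).ncard = m := by
  obtain ⟨a, s⟩ := p
  cases s
  · refine Eq.trans (congrArg Set.ncard ?_)
      ((Set.ncard_image_of_injective _ (Prod.mk_left_injective true)).trans (h₁ a))
    ext ⟨b, s⟩
    cases s <;> simp [bip]
  · refine Eq.trans (congrArg Set.ncard ?_)
      ((Set.ncard_image_of_injective _ (Prod.mk_left_injective false)).trans (h₂ a))
    ext ⟨b, s⟩
    cases s <;> simp [bip]

lemma bip_side {A : Type*} {ρ : A → A → Prop} {p q : A × Bool} (h : (bip ρ).Adj p q) :
    ((if q.2 then 1 else 0 : ℤ) - (if p.2 then 1 else 0)) % 2 = 1 := by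
  rcases h with ⟨h, h', -⟩ | ⟨h, h', -⟩ <;> simp [h, h']

lemma bip_map {A : Type*} {ρ : A → A → Prop} {f : A → A} (hf : ∀ a b, ρ a b → ρ (f a) (f b))
    {p q : A × Bool} (h : (bip ρ).Adj p q) : (bip ρ).Adj (f p.1, p.2) (f q.1, q.2) := by
  rcases h with ⟨h, h', h''⟩ | ⟨h, h', h''⟩
  · exact Or.inl ⟨h, h', hf _ _ h''⟩
  · exact Or.inr ⟨h, h', hf _ _ h''⟩

end Degree

section Frame

/-- The kinds of relations on `P × ZMod k × ZMod k` placed over the vertices of `theta g`. -/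
inductive Kind
  | const | shift | swap | diag | codiag | main | fill (m : ℕ)

variable {P : Type*} {k : ℕ}

/-- The relation on `P × ZMod k × ZMod k` of a given kind. -/
def frameRel (τ : ZMod k → P → P → Prop) (pdeg : P → ℕ) :
    Kind → P × ZMod k × ZMod k → P × ZMod k × ZMod k → Prop
  | .const, (x, j, _), (x', j', _) => x' = x ∧ j' = j
  | .shift, (x, j, _), (x', j', _) => x' = x ∧ j' = j + 1
  | .swap, (x, j, _), (x', j', _) => x' = x ∧ j' = Equiv.swap 0 1 j
  | .diag, (x, _, a), (x', j', _) => x' = x ∧ j' = a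
  | .codiag, (x, j, _), (x', _, a') => x' = x ∧ a' = j
  | .main, (x, j, a), (x', j', a') => (a' = a ∧ τ (j' - j) x x') ∨
      (a' = a + 1 ∧ x' = x ∧ (j' - j).val < k - pdeg x)
  | .fill m, (x, j, a), (x', j', a') => x' = x ∧ j' = j ∧ (a' - a).val < m

/-- The common in- and out-degree of the relations `frameRel`. -/
def Kind.deg (k : ℕ) : Kind → ℕ
  | .fill m => m
  | _ => k

lemma ncard_val_lt [NeZero k] {m : ℕ} (hm : m ≤ k) : {δ : ZMod k | δ.val < m}.ncard = m := by
  have : {δ : ZMod k | δ.val < m} = (fun i : ℕ => (i : ZMod k)) '' Set.Iio m := by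
    ext δ
    simp only [Set.mem_ofPred_eq, Set.mem_image, Set.mem_Iio]
    constructor
    · exact fun h => ⟨δ.val, h, by simp⟩
    · rintro ⟨i, hi, rfl⟩
      rwa [ZMod.val_natCast_of_lt (by omega)]
  rw [this, Set.InjOn.ncard_image, Set.ncard_Iio_nat]
  intro i hi j hj h
  simp only [Set.mem_Iio] at hi hj
  have := congrArg ZMod.val h
  rwa [ZMod.val_natCast_of_lt (by omega), ZMod.val_natCast_of_lt (by omega)] at this

lemma ncard_eq_of_param {A : Type*} [NeZero k] {S : Set A} (f : ZMod k → A)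
    (hf : Function.Injective f) (hS : ∀ b, b ∈ S ↔ ∃ i, f i = b) : S.ncard = k := by
  have : S = f '' Set.univ := by
    ext b
    simp [hS]
  rw [this, Set.ncard_image_of_injective _ hf, Set.ncard_univ, Nat.card_zmod]

lemma ncard_main_aux [Finite P] [NeZero k] {U : Set (ZMod k × P)} {d : ℕ} (hd : d ≤ k)
    (hU : U.ncard = d) (F : ZMod k × P → P × ZMod k × ZMod k)
    (hF : Function.Injective F) (G : ZMod k → P × ZMod k × ZMod k) (hG : Function.Injective G)
    (hFG : ∀ u v, F u ≠ G v) :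
    (F '' U ∪ G '' {δ | δ.val < k - d}).ncard = k := by
  rw [Set.ncard_union_eq, Set.ncard_image_of_injective _ hF, Set.ncard_image_of_injective _ hG,
    hU, ncard_val_lt (by omega)]
  · omega
  · rw [Set.disjoint_left]
    rintro _ ⟨u, -, rfl⟩ ⟨v, -, h⟩
    exact hFG u v h.symm

lemma ncard_frameRel_out [Finite P] (hk : 3 ≤ k) {τ : ZMod k → P → P → Prop} {pdeg : P → ℕ}
    (hp : ∀ x, pdeg x ≤ k) (hτ : ∀ x, {q : ZMod k × P | τ q.1 x q.2}.ncard = pdeg x)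
    (κ : Kind) (hκ : κ.deg k ≤ k) (p : P × ZMod k × ZMod k) :
    {q | frameRel τ pdeg κ p q}.ncard = κ.deg k := by
  have : NeZero k := ⟨by omega⟩
  have : Fact (1 < k) := ⟨by omega⟩
  obtain ⟨x, j, a⟩ := p
  cases κ with
  | const =>
    change Set.ncard _ = k
    refine ncard_eq_of_param (fun i => (x, j, i)) (fun i i' h => by simpa using h) ?_
    rintro ⟨x', j', a'⟩
    simp [frameRel, eq_comm]
  | shift =>
    change Set.ncard _ = k
    refine ncard_eq_of_param (fun i => (x, j + 1, i)) (fun i i' h => by simpa using h) ?_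
    rintro ⟨x', j', a'⟩
    simp [frameRel, eq_comm]
  | swap =>
    change Set.ncard _ = k
    refine ncard_eq_of_param (fun i => (x, Equiv.swap 0 1 j, i))
      (fun i i' h => by simpa using h) ?_
    rintro ⟨x', j', a'⟩
    simp [frameRel, eq_comm]
  | diag =>
    change Set.ncard _ = k
    refine ncard_eq_of_param (fun i => (x, a, i)) (fun i i' h => by simpa using h) ?_
    rintro ⟨x', j', a'⟩
    simp [frameRel, eq_comm]
  | codiag =>
    change Set.ncard _ = k
    refine ncard_eq_of_param (fun i => (x, i, j)) (fun i i' h => by simpa using h) ?_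
    rintro ⟨x', j', a'⟩
    simp [frameRel, eq_comm]
  | main =>
    have := ncard_main_aux (hp x) (hτ x) (fun q => (q.2, q.1 + j, a))
      (fun q q' h => by
        simp only [Prod.mk.injEq, add_left_inj, and_true] at h
        exact Prod.ext h.2 h.1) (fun δ => (x, δ + j, a + 1))
      (fun δ δ' h => by simpa using h) (fun u v h => by simp at h)
    refine Eq.trans ?_ this
    congr 1
    ext ⟨x', j', a'⟩
    simp only [frameRel, Set.mem_ofPred_eq, Set.mem_union, Set.mem_image, Prod.mk.injEq,
      Prod.exists]
    constructor
    · rintro (⟨rfl, h⟩ | ⟨rfl, rfl, h⟩)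
      · exact Or.inl ⟨j' - j, x', h, rfl, by ring, rfl⟩
      · exact Or.inr ⟨j' - j, h, rfl, by ring, rfl⟩
    · rintro (⟨δ, y, h, rfl, rfl, rfl⟩ | ⟨δ, h, rfl, rfl, rfl⟩)
      · exact Or.inl ⟨rfl, by simpa using h⟩
      · exact Or.inr ⟨rfl, rfl, by simpa using h⟩
  | fill m =>
    have hm : m ≤ k := hκ
    have hinj : Function.Injective fun δ : ZMod k => (x, j, δ + a) :=
      fun δ δ' h => by simpa using h
    refine Eq.trans ?_ ((Set.ncard_image_of_injective _ hinj).trans (ncard_val_lt hm))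
    congr 1
    ext ⟨x', j', a'⟩
    simp only [frameRel, Set.mem_ofPred_eq, Set.mem_image, Prod.mk.injEq]
    constructor
    · rintro ⟨rfl, rfl, h⟩
      exact ⟨a' - a, h, rfl, rfl, by ring⟩
    · rintro ⟨δ, h, rfl, rfl, rfl⟩
      refine ⟨rfl, rfl, ?_⟩
      have h' : δ.val < m := h
      simpa using h'

lemma ncard_frameRel_in [Finite P] (hk : 3 ≤ k) {τ : ZMod k → P → P → Prop} {pdeg : P → ℕ}
    (hp : ∀ x, pdeg x ≤ k) (hτ : ∀ x, {q : ZMod k × P | τ q.1 q.2 x}.ncard = pdeg x)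
    (κ : Kind) (hκ : κ.deg k ≤ k) (p : P × ZMod k × ZMod k) :
    {q | frameRel τ pdeg κ q p}.ncard = κ.deg k := by
  have : NeZero k := ⟨by omega⟩
  have : Fact (1 < k) := ⟨by omega⟩
  obtain ⟨x, j, a⟩ := p
  cases κ with
  | const =>
    change Set.ncard _ = k
    refine ncard_eq_of_param (fun i => (x, j, i)) (fun i i' h => by simpa using h) ?_
    rintro ⟨x', j', a'⟩
    simp [frameRel]
  | shift =>
    change Set.ncard _ = k
    refine ncard_eq_of_param (fun i => (x, j - 1, i)) (fun i i' h => by simpa using h) ?_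
    rintro ⟨x', j', a'⟩
    simp [frameRel, sub_eq_iff_eq_add]
  | swap =>
    change Set.ncard _ = k
    refine ncard_eq_of_param (fun i => (x, Equiv.swap 0 1 j, i))
      (fun i i' h => by simpa using h) ?_
    rintro ⟨x', j', a'⟩
    simp only [frameRel, Set.mem_ofPred_eq, Prod.mk.injEq, exists_eq_right_right]
    rw [Equiv.swap_apply_eq_iff]
  | diag =>
    change Set.ncard _ = k
    refine ncard_eq_of_param (fun i => (x, i, j)) (fun i i' h => by simpa using h) ?_
    rintro ⟨x', j', a'⟩
    simp [frameRel]
  | codiag =>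
    change Set.ncard _ = k
    refine ncard_eq_of_param (fun i => (x, a, i)) (fun i i' h => by simpa using h) ?_
    rintro ⟨x', j', a'⟩
    simp [frameRel]
  | main =>
    have := ncard_main_aux (hp x) (hτ x) (fun q => (q.2, j - q.1, a))
      (fun q q' h => by
        simp only [Prod.mk.injEq, sub_right_inj, and_true] at h
        exact Prod.ext h.2 h.1) (fun δ => (x, j - δ, a - 1))
      (fun δ δ' h => by simpa using h) (fun u v h => by
        have h' : a = a - 1 := congrArg (fun q => q.2.2) h
        exact one_ne_zero (sub_eq_self.1 h'.symm))
    refine Eq.trans ?_ this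
    congr 1
    ext ⟨x', j', a'⟩
    simp only [frameRel, Set.mem_ofPred_eq, Set.mem_union, Set.mem_image, Prod.mk.injEq,
      Prod.exists]
    constructor
    · rintro (⟨rfl, h⟩ | ⟨rfl, rfl, h⟩)
      · exact Or.inl ⟨j - j', x', h, rfl, by ring, rfl⟩
      · exact Or.inr ⟨j - j', h, rfl, by ring, by ring⟩
    · rintro (⟨δ, y, h, rfl, rfl, rfl⟩ | ⟨δ, h, rfl, rfl, rfl⟩)
      · exact Or.inl ⟨rfl, by simpa using h⟩
      · exact Or.inr ⟨by ring, rfl, by simpa using h⟩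
  | fill m =>
    have hm : m ≤ k := hκ
    have hinj : Function.Injective fun δ : ZMod k => (x, j, a - δ) :=
      fun δ δ' h => by simpa using h
    refine Eq.trans ?_ ((Set.ncard_image_of_injective _ hinj).trans (ncard_val_lt hm))
    congr 1
    ext ⟨x', j', a'⟩
    simp only [frameRel, Set.mem_ofPred_eq, Set.mem_image, Prod.mk.injEq]
    constructor
    · rintro ⟨rfl, rfl, h⟩
      exact ⟨a - a', h, rfl, rfl, by ring⟩
    · rintro ⟨δ, h, rfl, rfl, rfl⟩
      refine ⟨rfl, rfl, ?_⟩
      have h' : δ.val < m := h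
      simpa using h'

lemma frameRel_map {τ : ZMod k → P → P → Prop} {pdeg : P → ℕ} {f : P → P}
    (hf : ∀ δ x x', τ δ x x' → τ δ (f x) (f x')) (hd : ∀ x, pdeg (f x) = pdeg x) (κ : Kind)
    (p q : P × ZMod k × ZMod k) (h : frameRel τ pdeg κ p q) :
    frameRel τ pdeg κ (f p.1, p.2) (f q.1, q.2) := by
  obtain ⟨x, j, a⟩ := p
  obtain ⟨x', j', a'⟩ := q
  cases κ with
  | main =>
    rcases h with ⟨h, h'⟩ | ⟨h, h', h''⟩
    · exact Or.inl ⟨h, hf _ _ _ h'⟩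
    · exact Or.inr ⟨h, by rw [h'], by rwa [hd]⟩
  | _ => exact ⟨by rw [h.1], h.2⟩

lemma frame_rigid_fibre (hk : 3 ≤ k) {τ : ZMod k → P → P → Prop} {pdeg : P → ℕ}
    {φ : (P × ZMod k × ZMod k) × Bool → (P × ZMod k × ZMod k) × Bool}
    (hφ : ∀ κ, (∀ m, κ ≠ .fill m) → ∀ p q, (bip (frameRel τ pdeg κ)).Adj p q →
      (bip (frameRel τ pdeg κ)).Adj (φ p) (φ q)) (x : P) :
    ∃ y, ∀ j a s, φ ((x, j, a), s) = ((y, j, a), s) := by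
  have : NeZero k := ⟨by omega⟩
  have : Fact (1 < k) := ⟨by omega⟩
  have edge : ∀ (κ : Kind), (∀ m, κ ≠ .fill m) → ∀ j a j' a',
      frameRel τ pdeg κ (x, j, a) (x, j', a') →
      (bip (frameRel τ pdeg κ)).Adj (φ ((x, j, a), false)) (φ ((x, j', a'), true)) :=
    fun κ hκ j a j' a' h => hφ κ hκ _ _ (bip_adj_false_true.2 h)
  have hconst := fun j a a' => edge .const (by simp) j a j a' ⟨rfl, rfl⟩
  have hshift := fun j a a' => edge .shift (by simp) j a (j + 1) a' ⟨rfl, rfl⟩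
  have hswap := fun j a a' => edge .swap (by simp) j a (Equiv.swap 0 1 j) a' ⟨rfl, rfl⟩
  have hdiag := fun j a b => edge .diag (by simp) j a a b ⟨rfl, rfl⟩
  have hcodiag := fun j a j' => edge .codiag (by simp) j a j' j ⟨rfl, rfl⟩
  simp only [bip, frameRel] at hconst hshift hswap hdiag hcodiag
  have hc : ∀ j a a', (φ ((x, j, a'), true)).2 = !(φ ((x, j, a), false)).2 ∧
      (φ ((x, j, a'), true)).1.1 = (φ ((x, j, a), false)).1.1 ∧
      (φ ((x, j, a'), true)).1.2.1 = (φ ((x, j, a), false)).1.2.1 := by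
    intro j a a'
    rcases hconst j a a' with ⟨h, h', h''⟩ | ⟨h, h', h''⟩
    · exact ⟨by rw [h, h']; rfl, h''⟩
    · exact ⟨by rw [h, h']; rfl, h''.1.symm, h''.2.symm⟩
  have hd : ∀ j a b, (φ ((x, a, b), true)).2 = !(φ ((x, j, a), false)).2 ∧
      (φ ((x, a, b), true)).1.1 = (φ ((x, j, a), false)).1.1 := by
    intro j a b
    rcases hdiag j a b with ⟨h, h', h''⟩ | ⟨h, h', h''⟩
    · exact ⟨by rw [h, h']; rfl, h''.1⟩
    · exact ⟨by rw [h, h']; rfl, h''.1.symm⟩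
  have hS : ∀ j a, (φ ((x, j, a), false)).2 = (φ ((x, 0, 0), false)).2 ∧
      (φ ((x, j, a), true)).2 = !(φ ((x, 0, 0), false)).2 ∧
      (φ ((x, j, a), false)).1.1 = (φ ((x, 0, 0), false)).1.1 ∧
      (φ ((x, j, a), true)).1.1 = (φ ((x, 0, 0), false)).1.1 ∧
      (φ ((x, j, a), false)).1.2.1 = (φ ((x, j, 0), false)).1.2.1 ∧
      (φ ((x, j, a), true)).1.2.1 = (φ ((x, j, 0), false)).1.2.1 := by
    intro j a
    have e : ∀ j a, (φ ((x, j, a), false)).2 = (φ ((x, j, 0), false)).2 ∧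
        (φ ((x, j, a), false)).1.1 = (φ ((x, j, 0), false)).1.1 := by
      intro j a
      obtain ⟨h1, h2, -⟩ := hc j a 0
      obtain ⟨h3, h4, -⟩ := hc j 0 0
      exact ⟨Bool.not_inj (h1.symm.trans h3), h2.symm.trans h4⟩
    have e' : (φ ((x, j, 0), false)).2 = (φ ((x, 0, 0), false)).2 ∧
        (φ ((x, j, 0), false)).1.1 = (φ ((x, 0, 0), false)).1.1 := by
      obtain ⟨h1, h2, -⟩ := hc j 0 0
      obtain ⟨h3, h4⟩ := hd 0 j 0
      exact ⟨(Bool.not_inj (h1.symm.trans h3)).trans (e 0 j).1,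
        (h2.symm.trans h4).trans (e 0 j).2⟩
    obtain ⟨h1, h2, h3⟩ := hc j 0 a
    obtain ⟨h4, h5, h6⟩ := hc j a 0
    obtain ⟨h7, h8, h9⟩ := hc j 0 0
    exact ⟨(e j a).1.trans e'.1, by rw [h1, e'.1], (e j a).2.trans e'.2, h2.trans e'.2,
      h6.symm.trans h9, h3⟩
  have hstep : (1 : ZMod k) ≠ 0 := one_ne_zero
  set α : ZMod k → ZMod k := fun j => (φ ((x, j, 0), false)).1.2.1 with hα
  have hF : ∀ j a, (φ ((x, j, a), false)).1.2.1 = α j := fun j a => (hS j a).2.2.2.2.1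
  have hT : ∀ j a, (φ ((x, j, a), true)).1.2.1 = α j := fun j a => (hS j a).2.2.2.2.2
  cases hσ : (φ ((x, 0, 0), false)).2 with
  | true =>
    exfalso
    have h1 := hdiag 0 0 0
    have h2 := hdiag 1 0 0
    have h3 := hshift 0 0 0
    simp only [(hS _ _).1, (hS _ _).2.1, hσ, hF, hT] at h1 h2 h3
    simp at h1 h2 h3
    have h := h3.2
    rw [h1.2, h2.2] at h
    exact hstep (by simpa using h.symm)
  | false =>
    have hα1 : ∀ j, α (j + 1) = α j + 1 := by
      intro j
      have h3 := hshift j 0 0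
      simp only [(hS _ _).1, (hS _ _).2.1, hσ, hF, hT] at h3
      simp at h3
      exact h3.2
    have hα2 : ∀ j, α (Equiv.swap 0 1 j) = Equiv.swap 0 1 (α j) := by
      intro j
      have h3 := hswap j 0 0
      simp only [(hS _ _).1, (hS _ _).2.1, hσ, hF, hT] at h3
      simp at h3
      exact h3.2
    have hα0 : α 0 = 0 := by
      have h1 := hα2 0
      have h2 := hα1 0
      rw [Equiv.swap_apply_left] at h1
      rw [zero_add, h1] at h2
      have two : (1 + 1 : ZMod k) ≠ 0 := by
        intro h
        have := congrArg ZMod.val (show ((2 : ℕ) : ZMod k) = 0 by push_cast; rw [← h]; ring)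
        rw [ZMod.val_natCast_of_lt (by omega), ZMod.val_zero] at this
        omega
      rw [Equiv.swap_apply_def] at h2
      split_ifs at h2 with h3 h4
      · exact h3
      · rw [h4] at h2
        exact absurd h2.symm two
      · simp at h2
    have hαid : ∀ j, α j = j := by
      intro j
      obtain ⟨i, rfl⟩ : ∃ i : ℕ, (i : ZMod k) = j := ⟨j.val, by simp⟩
      induction i with
      | zero => simpa using hα0
      | succ i ih => push_cast; rw [hα1, ih]
    refine ⟨(φ ((x, 0, 0), false)).1.1, fun j a s => ?_⟩
    cases s with
    | false =>
      have h := hdiag j a 0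
      simp only [(hS _ _).1, (hS _ _).2.1, hσ, hF, hT, hαid] at h
      simp at h
      refine Prod.ext (Prod.ext (hS j a).2.2.1 (Prod.ext ((hF j a).trans (hαid j)) h.2.symm)) ?_
      rw [(hS j a).1, hσ]
    | true =>
      have h := hcodiag a 0 j
      simp only [(hS _ _).1, (hS _ _).2.1, hσ, hF, hT, hαid] at h
      simp at h
      refine Prod.ext (Prod.ext (hS j a).2.2.2.1 (Prod.ext ((hT j a).trans (hαid j)) h.2)) ?_
      rw [(hS j a).2.1, hσ]
      rfl

lemma frame_rigid (hk : 3 ≤ k) {τ : ZMod k → P → P → Prop} {pdeg : P → ℕ}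
    {φ : (P × ZMod k × ZMod k) × Bool → (P × ZMod k × ZMod k) × Bool}
    (hφ : ∀ κ, (∀ m, κ ≠ .fill m) → ∀ p q, (bip (frameRel τ pdeg κ)).Adj p q →
      (bip (frameRel τ pdeg κ)).Adj (φ p) (φ q)) :
    ∃ f : P → P, (∀ p s, φ (p, s) = ((f p.1, p.2), s)) ∧
      ∀ δ x x', τ δ x x' → τ δ (f x) (f x') := by
  have : Fact (1 < k) := ⟨by omega⟩
  choose f hf using frame_rigid_fibre hk hφ
  refine ⟨f, fun p s => hf p.1 p.2.1 p.2.2 s, fun δ x x' h => ?_⟩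
  have hadj : (bip (frameRel τ pdeg .main)).Adj ((x, 0, 0), false) ((x', δ, 0), true) :=
    bip_adj_false_true.2 (Or.inl ⟨rfl, by simpa using h⟩)
  have := hφ .main (by simp) _ _ hadj
  rw [hf, hf, bip_adj_false_true] at this
  rcases this with h | h
  · simpa using h.2
  · exact absurd h.1 (by simp)

end Frame

section Action

variable (M : Type*) [Monoid M]

/-- Labelled midpoints subdividing the left Cayley structure on `M × M`: there is one midpoint
over `(y, v)` for the letter `m` if `v = y * m`, and there are two otherwise. -/
abbrev Mid := {q : M × M × M × Bool // q.2.2.1 = q.2.1 * q.1 → q.2.2.2 = false}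

/-- The points of the labelled digraph whose endomorphism monoid is `M`. -/
abbrev Pt := (M × M) ⊕ Mid M

/-- The labels of the arcs. -/
abbrev ArcLabel := (M × Bool) ⊕ Bool

variable {M}

open Classical in
/-- The midpoint over a pair with the given letter. -/
noncomputable def mid (m : M) (c : Bool) (e : M × M) : Mid M :=
  ⟨(m, e.1, e.2, if e.2 = e.1 * m then false else c), fun h => if_pos h⟩

/-- The arcs of the labelled digraph. -/
def arc : ArcLabel M → Pt M → Pt M → Prop
  | .inl l, .inl e, .inr x => mid l.1 l.2 e = x
  | .inl l, .inr x, .inl e => mid l.1 l.2 e = x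
  | .inr false, .inl e, .inl e' => e'.1 = e.2
  | .inr true, .inr x, .inr x' => x'.1.1 = x.1.1 ∧ x'.1.2.1 = x.1.2.1 ∧ x'.1.2.2.1 = x.1.2.2.1
  | _, _, _ => False

/-- The common in- and out-degree of a point. -/
noncomputable def Pt.deg : Pt M → ℕ
  | .inl _ => 3 * Nat.card M
  | .inr _ => 3

/-- The left translation action on points. -/
noncomputable def act (z : M) : Pt M → Pt M
  | .inl e => .inl (z * e.1, z * e.2)
  | .inr x => .inr (mid x.1.1 x.1.2.2.2 (z * x.1.2.1, z * x.1.2.2.1))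

lemma mid_eta (x : Mid M) : mid x.1.1 x.1.2.2.2 (x.1.2.1, x.1.2.2.1) = x := by
  obtain ⟨⟨m, y, v, c⟩, h⟩ := x
  refine Subtype.ext ?_
  simp only [mid, Prod.mk.injEq, true_and]
  split_ifs with h'
  · exact (h h').symm
  · rfl

lemma act_mid (z m : M) (c : Bool) (e : M × M) :
    act z (.inr (mid m c e)) = .inr (mid m c (z * e.1, z * e.2)) := by
  simp only [act, mid, Sum.inr.injEq, Subtype.mk.injEq, Prod.mk.injEq, true_and]
  by_cases h : e.2 = e.1 * m
  · simp [h, mul_assoc]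
  · rw [if_neg h]
    rfl

lemma act_deg (z : M) (x : Pt M) : (act z x).deg = x.deg := by
  cases x <;> rfl

lemma act_arc (z : M) (l : ArcLabel M) (x y : Pt M) (h : arc l x y) :
    arc l (act z x) (act z y) := by
  rcases l with ⟨m, c⟩ | l
  · rcases x with e | x <;> rcases y with e' | y
    · exact h.elim
    · change mid m c e = y at h
      rw [← h, act_mid]
      exact rfl
    · change mid m c e' = x at h
      rw [← h, act_mid]
      exact rfl
    · exact h.elim
  · cases l <;> rcases x with e | x <;> rcases y with e' | y
    · change e'.1 = e.2 at h
      change z * e'.1 = z * e.2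
      rw [h]
    · exact h.elim
    · exact h.elim
    · exact h.elim
    · exact h.elim
    · exact h.elim
    · exact h.elim
    · obtain ⟨h₁, h₂, h₃⟩ := h
      refine ⟨h₁, ?_, ?_⟩
      · change z * y.1.2.1 = z * x.1.2.1
        rw [h₂]
      · change z * y.1.2.2.1 = z * x.1.2.2.1
        rw [h₃]

lemma act_one (x : Pt M) : act 1 x = x := by
  rcases x with e | x
  · simp [act]
  · simp [act, mid_eta]

lemma act_mul (z w : M) (x : Pt M) : act (z * w) x = act z (act w x) := by
  rcases x with e | x
  · simp [act, mul_assoc]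
  · rw [← mid_eta x, act_mid, act_mid, act_mid]
    simp [mul_assoc]

lemma act_injective {z w : M} (h : ∀ x : Pt M, act z x = act w x) : z = w := by
  have := h (.inl (1, 1))
  simpa [act] using this

lemma mid_eq_mid_iff (m : M) (e : M × M) : mid m false e = mid m true e ↔ e.2 = e.1 * m := by
  simp [mid]

lemma exists_act {f : Pt M → Pt M} (hf : ∀ l x y, arc l x y → arc l (f x) (f y)) :
    ∃ z, f = act z := by
  have hE : ∀ e, ∃ e', f (.inl e) = .inl e' := by
    intro e
    have h : arc (.inr false) (.inl e : Pt M) (.inl (e.2, 1)) := rfl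
    have := hf _ _ _ h
    generalize f (.inl e) = p at this
    generalize f (.inl (e.2, 1)) = q at this
    rcases p with p | p
    · exact ⟨p, rfl⟩
    · rcases q with q | q <;> exact this.elim
  have hX : ∀ x, ∃ x', f (.inr x) = .inr x' := by
    intro x
    have h : arc (.inr true) (.inr x : Pt M) (.inr x) := ⟨rfl, rfl, rfl⟩
    have := hf _ _ _ h
    generalize f (.inr x) = p at this
    rcases p with p | p
    · exact this.elim
    · exact ⟨p, rfl⟩
  choose F hF using hE
  choose G hG using hX
  have hD : ∀ e e' : M × M, e'.1 = e.2 → (F e').1 = (F e).2 := by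
    intro e e' h
    have := hf (.inr false) (.inl e) (.inl e') h
    rwa [hF, hF] at this
  have hG' : ∀ m c e, G (mid m c e) = mid m c (F e) := by
    intro m c e
    have h := hf (.inl (m, c)) (.inl e) (.inr (mid m c e)) rfl
    rw [hF, hG] at h
    exact h.symm
  set α : M → M := fun v => (F (1, v)).2 with hα
  have hF' : ∀ e, F e = (α e.1, α e.2) := by
    intro e
    have h1 := hD (1, e.1) e rfl
    have h2 := hD e (e.2, 1) rfl
    have h3 := hD (1, e.2) (e.2, 1) rfl
    exact Prod.ext h1 (h2.symm.trans h3)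
  have hmul : ∀ m, α m = α 1 * m := by
    intro m
    have h := (mid_eq_mid_iff m ((1 : M), m)).2 (by simp)
    have h' := congrArg G h
    rw [hG', hG', mid_eq_mid_iff, hF'] at h'
    exact h'
  refine ⟨α 1, funext fun x => ?_⟩
  rcases x with e | x
  · rw [hF, hF', hmul e.1, hmul e.2]
    rfl
  · rw [← mid_eta x, hG, hG', act_mid, hF', hmul x.1.2.1, hmul x.1.2.2.1]

lemma card_arcLabel (M : Type*) [Finite M] : Nat.card (ArcLabel M) = 2 * Nat.card M + 2 := by
  simp [ArcLabel, mul_comm]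

lemma ncard_arcs_pair [Finite M] {S : Set (ArcLabel M × Pt M)} (e : M × M) (F : M → M × M)
    (hF : Function.Injective F)
    (hS : ∀ q, q ∈ S ↔ (∃ l : M × Bool, (.inl l, .inr (mid l.1 l.2 e)) = q) ∨
      ∃ w : M, (.inr false, .inl (F w)) = q) : S.ncard = 3 * Nat.card M := by
  let H : (M × Bool) ⊕ M → ArcLabel M × Pt M :=
    Sum.elim (fun l => (.inl l, .inr (mid l.1 l.2 e))) fun w => (.inr false, .inl (F w))
  have hH : Function.Injective H := by
    rintro (l | w) (l' | w') h
    · simp only [H, Sum.elim_inl, Prod.mk.injEq, Sum.inl.injEq] at h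
      rw [h.1]
    · simp [H] at h
    · simp [H] at h
    · simp only [H, Sum.elim_inr, Prod.mk.injEq, Sum.inl.injEq, true_and] at h
      rw [hF h]
  have : S = H '' Set.univ := by
    ext q
    simp [hS, H]
  rw [this, Set.ncard_image_of_injective _ hH, Set.ncard_univ]
  simp
  ring

lemma ncard_arcs_mid {S : Set (ArcLabel M × Pt M)} (x : Mid M)
    (hS : ∀ q, q ∈ S ↔ (∃ l e, (.inl l, .inl e) = q ∧ mid l.1 l.2 e = x) ∨
      ∃ x' : Mid M, (.inr true, .inr x') = q ∧ x'.1.1 = x.1.1 ∧ x'.1.2.1 = x.1.2.1 ∧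
        x'.1.2.2.1 = x.1.2.2.1) : S.ncard = 3 := by
  obtain ⟨⟨m, y, v, c⟩, hx⟩ := x
  simp only at hx hS
  rw [Set.ncard_eq_three]
  by_cases h : v = y * m
  · refine ⟨(.inl (m, false), .inl (y, v)), (.inl (m, true), .inl (y, v)),
      (.inr true, .inr ⟨(m, y, v, c), hx⟩), by simp, by simp, by simp, ?_⟩
    have hc := hx h
    subst hc
    ext q
    rw [hS]
    constructor
    · rintro (⟨⟨m', c'⟩, ⟨y', v'⟩, rfl, h'⟩ | ⟨⟨⟨m', y', v', c'⟩, h''⟩, rfl, rfl, rfl, rfl⟩)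
      · simp only [mid, Subtype.mk.injEq, Prod.mk.injEq] at h'
        obtain ⟨rfl, rfl, rfl, -⟩ := h'
        cases c' <;> simp
      · have := h'' h
        simp only at this
        subst this
        simp
    · rintro (rfl | rfl | rfl)
      · exact Or.inl ⟨_, _, rfl, by simp [mid]⟩
      · exact Or.inl ⟨_, _, rfl, by simp [mid, h]⟩
      · exact Or.inr ⟨_, rfl, rfl, rfl, rfl⟩
  · refine ⟨(.inl (m, c), .inl (y, v)), (.inr true, .inr ⟨(m, y, v, false), fun h' => rfl⟩),
      (.inr true, .inr ⟨(m, y, v, true), fun h' => (h h').elim⟩), by simp, by simp, by simp, ?_⟩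
    ext q
    rw [hS]
    constructor
    · rintro (⟨⟨m', c'⟩, ⟨y', v'⟩, rfl, h'⟩ | ⟨⟨⟨m', y', v', c'⟩, h''⟩, rfl, rfl, rfl, rfl⟩)
      · simp only [mid, Subtype.mk.injEq, Prod.mk.injEq] at h'
        obtain ⟨rfl, rfl, rfl, h'⟩ := h'
        rw [if_neg h] at h'
        subst h'
        simp
      · cases c' <;> simp
    · rintro (rfl | rfl | rfl)
      · exact Or.inl ⟨_, _, rfl, by simp [mid, h]⟩
      · exact Or.inr ⟨_, rfl, rfl, rfl, rfl⟩
      · exact Or.inr ⟨_, rfl, rfl, rfl, rfl⟩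

lemma ncard_arcs_out [Finite M] (x : Pt M) :
    {q : ArcLabel M × Pt M | arc q.1 x q.2}.ncard = x.deg := by
  rcases x with e | x
  · refine ncard_arcs_pair e (fun w => (e.2, w)) (Prod.mk_right_injective _) fun q => ⟨?_, ?_⟩
    · obtain ⟨l | (_ | _), e' | x'⟩ := q <;> intro h
      · exact h.elim
      · exact Or.inl ⟨l, by rw [show mid l.1 l.2 e = x' from h]⟩
      · exact Or.inr ⟨e'.2, by rw [← show e'.1 = e.2 from h]⟩
      all_goals exact h.elim
    · rintro (⟨l, rfl⟩ | ⟨w, rfl⟩) <;> exact rfl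
  · refine ncard_arcs_mid x fun q => ⟨?_, ?_⟩
    · obtain ⟨l | (_ | _), e' | x'⟩ := q <;> intro h
      · exact Or.inl ⟨l, e', rfl, h⟩
      iterate 4 exact h.elim
      exact Or.inr ⟨x', rfl, h⟩
    · rintro (⟨l, e, rfl, h⟩ | ⟨x', rfl, h⟩) <;> exact h

lemma ncard_arcs_in [Finite M] (x : Pt M) :
    {q : ArcLabel M × Pt M | arc q.1 q.2 x}.ncard = x.deg := by
  rcases x with e | x
  · refine ncard_arcs_pair e (fun w => (w, e.1)) (Prod.mk_left_injective _) fun q => ⟨?_, ?_⟩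
    · obtain ⟨l | (_ | _), e' | x'⟩ := q <;> intro h
      · exact h.elim
      · exact Or.inl ⟨l, by rw [show mid l.1 l.2 e = x' from h]⟩
      · exact Or.inr ⟨e'.1, by rw [show e.1 = e'.2 from h]⟩
      all_goals exact h.elim
    · rintro (⟨l, rfl⟩ | ⟨w, rfl⟩) <;> exact rfl
  · refine ncard_arcs_mid x fun q => ⟨?_, ?_⟩
    · obtain ⟨l | (_ | _), e' | x'⟩ := q <;> intro h
      · exact Or.inl ⟨l, e', rfl, h⟩
      iterate 4 exact h.elim
      exact Or.inr ⟨x', rfl, h.1.symm, h.2.1.symm, h.2.2.symm⟩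
    · rintro (⟨l, e, rfl, h⟩ | ⟨x', rfl, h⟩)
      · exact h
      · exact ⟨h.1.symm, h.2.1.symm, h.2.2.symm⟩

end Action

section KindAt

/-- The kind of relation placed over a vertex of `theta g`. -/
noncomputable def kindAt (g k : ℕ) (t : ZMod (3 * g - 2)) : Kind :=
  if t.val = 3 * g - 3 then .const
  else if t.val = 3 * g - 6 then .shift
  else if t.val = 3 * g - 8 then .swap
  else if t.val = 3 * g - 9 then .diag
  else if t.val = 2 * g - 5 then .codiag
  else if t.val = 2 * g - 6 then .main
  else .fill (k + 2 - ((theta g).neighborSet t).ncard)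

variable {g k : ℕ}

lemma exists_kindAt_eq (hg : 7 ≤ g) (k : ℕ) {κ : Kind} (hκ : ∀ m, κ ≠ .fill m) :
    ∃ t, kindAt g k t = κ := by
  have h : ∀ a, a < 3 * g - 2 → ((a : ℕ) : ZMod (3 * g - 2)).val = a :=
    fun a ha => ZMod.val_natCast_of_lt ha
  cases κ with
  | const => exact ⟨((3 * g - 3 : ℕ) : ZMod _), by rw [kindAt, h _ (by omega), if_pos rfl]⟩
  | shift =>
    refine ⟨((3 * g - 6 : ℕ) : ZMod _), ?_⟩
    rw [kindAt, h _ (by omega), if_neg (by omega), if_pos rfl]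
  | swap =>
    refine ⟨((3 * g - 8 : ℕ) : ZMod _), ?_⟩
    rw [kindAt, h _ (by omega), if_neg (by omega), if_neg (by omega), if_pos rfl]
  | diag =>
    refine ⟨((3 * g - 9 : ℕ) : ZMod _), ?_⟩
    rw [kindAt, h _ (by omega), if_neg (by omega), if_neg (by omega), if_neg (by omega),
      if_pos rfl]
  | codiag =>
    refine ⟨((2 * g - 5 : ℕ) : ZMod _), ?_⟩
    rw [kindAt, h _ (by omega), if_neg (by omega), if_neg (by omega), if_neg (by omega),
      if_neg (by omega), if_pos rfl]
  | main =>
    refine ⟨((2 * g - 6 : ℕ) : ZMod _), ?_⟩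
    rw [kindAt, h _ (by omega), if_neg (by omega), if_neg (by omega), if_neg (by omega),
      if_neg (by omega), if_neg (by omega), if_pos rfl]
  | fill m => exact (hκ m rfl).elim

lemma add_one_ne_sub_one (hg : 7 ≤ g) (t : ZMod (3 * g - 2)) : t + 1 ≠ t - 1 := by
  intro h
  have h2 : ((2 : ℕ) : ZMod (3 * g - 2)) = (0 : ℕ) := by
    push_cast
    linear_combination h
  rw [natCast_eq_iff (by omega) (by omega)] at h2
  omega

lemma pair_subset_neighborSet_theta (hg : 7 ≤ g) (t : ZMod (3 * g - 2)) :
    {t + 1, t - 1} ⊆ (theta g).neighborSet t := by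
  rintro v (rfl | rfl)
  · exact (theta_adj hg).2 (Or.inl rfl)
  · exact (theta_adj hg).2 (Or.inr (Or.inl (by ring)))

lemma two_le_ncard_neighborSet_theta (hg : 7 ≤ g) (t : ZMod (3 * g - 2)) :
    2 ≤ ((theta g).neighborSet t).ncard := by
  have : NeZero (3 * g - 2) := ⟨by omega⟩
  exact (Set.ncard_pair (add_one_ne_sub_one hg t)).symm.trans_le
    (Set.ncard_le_ncard (pair_subset_neighborSet_theta hg t))

lemma ncard_neighborSet_theta_le (hg : 7 ≤ g) (t : ZMod (3 * g - 2)) :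
    ((theta g).neighborSet t).ncard ≤ 3 * g - 2 := by
  have : NeZero (3 * g - 2) := ⟨by omega⟩
  exact (Set.ncard_le_card _).trans_eq (Nat.card_zmod _)

lemma ncard_neighborSet_theta_eq_two (hg : 7 ≤ g) {a : ℕ} (ha : a < 3 * g - 2)
    (h : a = 3 * g - 3 ∨ a = 3 * g - 6 ∨ a = 3 * g - 8 ∨ a = 3 * g - 9 ∨ a = 2 * g - 5 ∨
      a = 2 * g - 6) : ((theta g).neighborSet (a : ZMod (3 * g - 2))).ncard = 2 := by
  refine Eq.trans (congrArg _ (Set.Subset.antisymm (fun v hv => ?_)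
    (pair_subset_neighborSet_theta hg _))) (Set.ncard_pair (add_one_ne_sub_one hg _))
  rcases (theta_adj hg).1 hv with h' | h' | ⟨h', -⟩ | ⟨h', h''⟩
  · exact Or.inl h'
  · exact Or.inr (by rw [h']; simp)
  · rw [anchor_natCast hg ha] at h'
    omega
  · obtain ⟨b, hb, rfl⟩ := exists_natCast hg v
    rw [anchor_natCast hg hb] at h'
    have := natCast_eq_cases hg (a := a) (b := b + (g - 1)) (by rw [h'', Nat.cast_add])
      (by omega) (by omega)
    omega

lemma kindAt_deg (hg : 7 ≤ g) (hk : 3 * g - 2 ≤ k) (t : ZMod (3 * g - 2)) :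
    (kindAt g k t).deg k ≤ k ∧
      ((theta g).neighborSet t).ncard + (kindAt g k t).deg k = k + 2 := by
  have : NeZero (3 * g - 2) := ⟨by omega⟩
  have h1 := two_le_ncard_neighborSet_theta hg t
  have h2 := ncard_neighborSet_theta_le hg t
  have h3 := ncard_neighborSet_theta_eq_two hg t.val_lt
  rw [ZMod.natCast_zmod_val] at h3
  unfold kindAt
  split_ifs <;> simp only [Kind.deg] <;> omega

end KindAt

section Realization

variable (M : Type) (g : ℕ)

/-- The size of the cyclic coordinates of the frame. -/
noncomputable def frameSize : ℕ := 3 * Nat.card M + 3 + (3 * g - 2)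

lemma exists_arcLabel_injective [Finite M] :
    ∃ ι : ArcLabel M → ZMod (frameSize M g), Function.Injective ι := by
  have : NeZero (frameSize M g) := ⟨by unfold frameSize; omega⟩
  have h : Nat.card (ArcLabel M) ≤ Nat.card (ZMod (frameSize M g)) := by
    rw [card_arcLabel, Nat.card_zmod]
    unfold frameSize
    omega
  have := Fintype.ofFinite (ArcLabel M)
  rw [Nat.card_eq_fintype_card, Nat.card_eq_fintype_card] at h
  obtain ⟨e⟩ := Function.Embedding.nonempty_of_card_le h
  exact ⟨e, e.injective⟩

variable {M g} [Monoid M]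

/-- The arcs of the labelled digraph, with the labels moved to `ZMod (frameSize M g)`. -/
def arcAt (ι : ArcLabel M → ZMod (frameSize M g)) (δ : ZMod (frameSize M g)) (x y : Pt M) : Prop :=
  ∃ l, ι l = δ ∧ arc l x y

/-- The graph realizing the monoid. -/
noncomputable def realization (ι : ArcLabel M → ZMod (frameSize M g)) : SimpleGraph
    (((Pt M × ZMod (frameSize M g) × ZMod (frameSize M g)) × Bool) × ZMod (3 * g - 2)) :=
  linked (theta g) fun t => bip (frameRel (arcAt ι) Pt.deg (kindAt g (frameSize M g) t))

variable {ι : ArcLabel M → ZMod (frameSize M g)}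

lemma Pt.deg_le [Finite M] (x : Pt M) : x.deg ≤ frameSize M g := by
  unfold frameSize
  cases x <;> simp only [Pt.deg] <;> omega

lemma ncard_arcAt (hι : Function.Injective ι) (r : ArcLabel M → Pt M → Prop) :
    {q : ZMod (frameSize M g) × Pt M | ∃ l, ι l = q.1 ∧ r l q.2}.ncard =
      {q : ArcLabel M × Pt M | r q.1 q.2}.ncard := by
  rw [← Set.ncard_image_of_injective _ (hι.prodMap (Function.injective_id (α := Pt M)))]
  congr 1
  ext ⟨δ, x⟩
  constructor
  · rintro ⟨l, rfl, h⟩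
    exact ⟨(l, x), h, rfl⟩
  · rintro ⟨⟨l, y⟩, h, h'⟩
    obtain ⟨rfl, rfl⟩ := Prod.mk.injEq .. ▸ h'
    exact ⟨l, rfl, h⟩

lemma ncard_neighborSet_realization [Finite M] (hg : 7 ≤ g) (hι : Function.Injective ι) (v) :
    ((realization ι).neighborSet v).ncard = frameSize M g + 2 := by
  have : NeZero (3 * g - 2) := ⟨by omega⟩
  have : NeZero (frameSize M g) := ⟨by unfold frameSize; omega⟩
  have hk : 3 ≤ frameSize M g := by unfold frameSize; omega
  obtain ⟨c, t⟩ := v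
  obtain ⟨h₁, h₂⟩ := kindAt_deg (k := frameSize M g) hg (by unfold frameSize; omega) t
  rw [realization, ncard_neighborSet_linked, ncard_neighborSet_bip, h₂]
  · exact ncard_frameRel_out hk Pt.deg_le
      (fun x => (ncard_arcAt hι fun l y => arc l x y).trans (ncard_arcs_out x)) _ h₁
  · exact ncard_frameRel_in hk Pt.deg_le
      (fun x => (ncard_arcAt hι fun l y => arc l y x).trans (ncard_arcs_in x)) _ h₁

lemma oddGirthEq_realization (hg : 7 ≤ g) (ι : ArcLabel M → ZMod (frameSize M g)) :
    OddGirthEq (realization ι) g :=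
  ⟨exists_isCycle_linked hg ((.inl (1, 1), 0, 0), false),
    fun _ w _ hw => le_length_of_odd_closed_walk hg
      (side := fun c => if c.2 then 1 else 0) (fun _ _ _ h => bip_side h) w hw⟩

/-- The endomorphism given by an element of the monoid. -/
noncomputable def realizationHom (ι : ArcLabel M → ZMod (frameSize M g)) (z : M) :
    realization ι →g realization ι where
  toFun v := (((act z v.1.1.1, v.1.1.2), v.1.2), v.2)
  map_rel' := by
    rintro ⟨c, t⟩ ⟨c', t'⟩ (⟨h, h'⟩ | ⟨h, h'⟩)
    · obtain rfl : c = c' := h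
      exact Or.inl ⟨rfl, h'⟩
    · refine Or.inr ⟨h, bip_map (f := fun p => (act z p.1, p.2)) (fun p q => ?_) h'⟩
      exact frameRel_map (fun δ x y ⟨l, hl, h⟩ => ⟨l, hl, act_arc z l x y h⟩) (act_deg z) _ p q

lemma realizationHom_bijective (hg : 7 ≤ g) (hodd : Odd g) (hι : Function.Injective ι) :
    Function.Bijective (realizationHom ι) := by
  constructor
  · refine fun z w h => act_injective fun x => ?_
    have := DFunLike.congr_fun h (((x, 0, 0), false), 0)
    simpa [realizationHom] using this
  · intro F
    obtain ⟨φ, hφ, hφ'⟩ := end_linked hg hodd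
      (side := fun c : (Pt M × ZMod (frameSize M g) × ZMod (frameSize M g)) × Bool =>
        if c.2 then 1 else 0) (fun _ _ _ h => bip_side h) F
    obtain ⟨f, hf, hf'⟩ := frame_rigid (τ := arcAt ι) (pdeg := Pt.deg) (φ := φ)
      (by unfold frameSize; omega) fun κ hκ p q h => by
        obtain ⟨t, rfl⟩ := exists_kindAt_eq hg (frameSize M g) hκ
        exact hφ' t p q h
    obtain ⟨z, rfl⟩ : ∃ z, f = act z := exists_act fun l x y h => by
      obtain ⟨l', hl, h'⟩ := hf' (ι l) x y ⟨l, rfl, h⟩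
      rwa [hι hl] at h'
    refine ⟨z, RelHom.ext fun ⟨⟨p, s⟩, t⟩ => ?_⟩
    exact ((hφ (p, s) t).trans (congrArg (·, t) (hf p s))).symm

end Realization

end RegularEnd

/-- Every finite monoid is isomorphic to the endomorphism monoid of a regular
finite simple graph of odd girth `g`, for any odd `g ≥ 7`. -/
theorem monoid_is_end_of_regular_graph (M : Type) [Monoid M] [Finite M]
    (g : ℕ) (hg : 7 ≤ g) (hodd : Odd g) :
    ∃ (V : Type) (_ : Fintype V) (G : SimpleGraph V) (d : ℕ),
      (∀ v, (G.neighborSet v).ncard = d) ∧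
      OddGirthEq G g ∧
      ∃ e : (G →g G) ≃ M,
        e SimpleGraph.Hom.id = 1 ∧
        ∀ f f' : G →g G, e (f.comp f') = e f * e f' := by
  have : NeZero (3 * g - 2) := ⟨by omega⟩
  have : NeZero (RegularEnd.frameSize M g) := ⟨by unfold RegularEnd.frameSize; omega⟩
  obtain ⟨ι, hι⟩ := RegularEnd.exists_arcLabel_injective M g
  let e := Equiv.ofBijective _ (RegularEnd.realizationHom_bijective hg hodd hι)
  refine ⟨_, Fintype.ofFinite _, RegularEnd.realization ι, _,
    RegularEnd.ncard_neighborSet_realization hg hι, RegularEnd.oddGirthEq_realization hg ι,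
    e.symm, ?_, fun f f' => ?_⟩
  · rw [Equiv.symm_apply_eq]
    refine RelHom.ext fun ⟨⟨⟨x, p⟩, s⟩, t⟩ => ?_
    change _ = (((RegularEnd.act 1 x, p), s), t)
    rw [RegularEnd.act_one]
    rfl
  · obtain ⟨z, rfl⟩ := e.surjective f
    obtain ⟨w, rfl⟩ := e.surjective f'
    rw [e.symm_apply_apply, e.symm_apply_apply, Equiv.symm_apply_eq]
    refine RelHom.ext fun ⟨⟨⟨x, p⟩, s⟩, t⟩ => ?_
    change (((RegularEnd.act z (RegularEnd.act w x), p), s), t) =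
      (((RegularEnd.act (z * w) x, p), s), t)
    rw [RegularEnd.act_mul]
end
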